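/- Parent Cayley–Hamilton identity for symplectic quantum matrix algebras: Let {R,F} be a compatible pair of R-matrices on V = ℂ^N in which F is strict skew invertible and R is skew invertible of Sp(2k) type. Then the matrix M of generators of M(R,F) and its image π(M), where π(X)_1 := Tr_{R(2)}(R_1 X_1 K_1), satisfy the k-th order matrix identity Σ_{i=0}^{k} (−q)^i · M^{[k−i]} · ε_i + q^{2k} Σ_{i=0}^{k−1} (−q)^{−i} · π(M)^{[k−i]} · ε_i = 0, where π(M)^{[0]} := I and π(M)^{[n+1]} := μ·φ^{−1}(ξ(M)·G^{−1}·π(M)^{[n]}·G) with G_1 := Tr_(2,3)(K_2 F_1^{−1} F_2^{−1}) ∈ End(V), and where ε_0 := 1, ε_i := Σ_{j=0}^{⌊i/2⌋} a_{i−2j} g^j for 1 ≤ i ≤ k. -/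

import Mathlib

open scoped BigOperators
open Matrix

noncomputable section

namespace QMA

/-- The space of operators on `V^{⊗ n}` (matrices indexed by multi-indices),
    with entries in `A`, where `V = ℂ^N`. -/
abbrev MatV (N n : ℕ) (A : Type*) := Matrix (Fin n → Fin N) (Fin n → Fin N) A

variable {N : ℕ} [NeZero N] {A : Type*}

/-- The `j`-th component of a multi-index (junk value if out of range). -/
def idx {n : ℕ} (a : Fin n → Fin N) (j : ℕ) : Fin N :=
  if h : j < n then a ⟨j, h⟩ else ⟨0, Nat.pos_of_ne_zero (NeZero.ne N)⟩

/-- Place a two-factor operator `X` on the (0-indexed) tensor factors `p, p+1`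
    of `V^{⊗ n}`, acting as the identity elsewhere. -/
def lift2 [Semiring A] {n : ℕ} (p : ℕ) (X : MatV N 2 A) : MatV N n A :=
  fun a b =>
    if ∀ m : Fin n, (m : ℕ) = p ∨ (m : ℕ) = p + 1 ∨ a m = b m then
      X ![idx a p, idx a (p + 1)] ![idx b p, idx b (p + 1)]
    else 0

/-- Place a one-factor operator `X` on the (0-indexed) tensor factor `p`
    of `V^{⊗ n}`, acting as the identity elsewhere. -/
def lift1 [Semiring A] {n : ℕ} (p : ℕ) (X : Matrix (Fin N) (Fin N) A) : MatV N n A :=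
  fun a b =>
    if ∀ m : Fin n, (m : ℕ) = p ∨ a m = b m then X (idx a p) (idx b p) else 0

/-- Extend an operator on `V^{⊗ n}` to `V^{⊗ (n+1)}` by the identity on the last factor. -/
def ext1 [Semiring A] {n : ℕ} (X : MatV N n A) : MatV N (n + 1) A :=
  fun a b =>
    if a (Fin.last n) = b (Fin.last n) then X (fun t => a t.castSucc) (fun t => b t.castSucc)
    else 0

/-- The partial trace over the last tensor factor, weighted by the matrix `D`. -/
def ptrace [NonUnitalNonAssocSemiring A] {n : ℕ} (D : Matrix (Fin N) (Fin N) A)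
    (X : MatV N (n + 1) A) : MatV N n A :=
  fun a b => ∑ m : Fin N, ∑ c : Fin N, D m c * X (Fin.snoc a c) (Fin.snoc b m)

/-- The full `D`-weighted trace over all `n` tensor factors. -/
def trAll [NonUnitalNonAssocSemiring A] (D : Matrix (Fin N) (Fin N) A) :
    (n : ℕ) → MatV N n A → A
  | 0, X => X (fun i => i.elim0) (fun i => i.elim0)
  | n + 1, X => trAll D n (ptrace D X)

/-- The `D`-weighted trace over all tensor factors except the first. -/
def trTail [NonUnitalNonAssocSemiring A] (D : Matrix (Fin N) (Fin N) A) :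
    (j : ℕ) → MatV N (j + 1) A → MatV N 1 A
  | 0, X => X
  | j + 1, X => trTail D j (ptrace D X)

/-- Identify operators on `V^{⊗1}` with `N × N` matrices. -/
def toN (X : MatV N 1 A) : Matrix (Fin N) (Fin N) A := fun i j => X (fun _ => i) (fun _ => j)

/-- Entrywise embedding of complex matrices into matrices over a `ℂ`-algebra. -/
def cmap [Ring A] [Algebra ℂ A] {m : Type*} (X : Matrix m m ℂ) : Matrix m m A :=
  X.map (algebraMap ℂ A)

/-- Multiply all entries of a matrix by `c` on the right. -/
def rmulE [Mul A] {m : Type*} (X : Matrix m m A) (c : A) : Matrix m m A := fun a b => X a b * c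

/-- Multiply all entries of a matrix by `c` on the left. -/
def lmulE [Mul A] {m : Type*} (c : A) (X : Matrix m m A) : Matrix m m A := fun a b => c * X a b

/-- The operator `D` associated with a skew inverse `Ψ`: `D_1 = Tr_(2) Ψ₁₂`. -/
def Dof (Ψ : MatV N 2 ℂ) : Matrix (Fin N) (Fin N) ℂ :=
  fun i j => ∑ m : Fin N, Ψ ![i, m] ![j, m]

/-- `Ψ` is a skew inverse of the R-matrix `R`:
    `Tr_(2)(R₁₂ Ψ₂₃) = Tr_(2)(Ψ₁₂ R₂₃) = P₁₃`. -/
def SkewPair (R Ψ : MatV N 2 ℂ) : Prop :=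
  (∀ a1 a3 b1 b3 : Fin N,
      (∑ m : Fin N, ∑ c : Fin N, R ![a1, m] ![b1, c] * Ψ ![c, a3] ![m, b3]) =
        if a1 = b3 ∧ a3 = b1 then 1 else 0) ∧
  (∀ a1 a3 b1 b3 : Fin N,
      (∑ m : Fin N, ∑ c : Fin N, Ψ ![a1, m] ![b1, c] * R ![c, a3] ![m, b3]) =
        if a1 = b3 ∧ a3 = b1 then 1 else 0)

/-- The `q`-number `j_q = (q^j - q^{-j})/(q - q^{-1})`. -/
def nq (q : ℂ) (j : ℕ) : ℂ := (q ^ (j : ℤ) - q ^ (-(j : ℤ))) / (q - q⁻¹)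

/-- The rank-one projector `K = μ⁻¹ (q-q⁻¹)⁻¹ (qI - R)(q⁻¹I + R)` of a BMW-type R-matrix. -/
def bmwK (q μ : ℂ) (R : MatV N 2 ℂ) : MatV N 2 ℂ :=
  (μ⁻¹ * (q - q⁻¹)⁻¹) • ((q • (1 : MatV N 2 ℂ) - R) * (q⁻¹ • (1 : MatV N 2 ℂ) + R))

/-- The braid relation `R₁ R₂ R₁ = R₂ R₁ R₂`. -/
def IsBraid (R : MatV N 2 ℂ) : Prop :=
  lift2 (n := 3) 0 R * lift2 1 R * lift2 0 R = lift2 1 R * lift2 0 R * lift2 1 R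

/-- `R` is an R-matrix of BMW type with eigenvalues `q, -q⁻¹, μ`. -/
def IsBMW (q μ : ℂ) (R : MatV N 2 ℂ) : Prop :=
  (q • (1 : MatV N 2 ℂ) - R) * (q⁻¹ • (1 : MatV N 2 ℂ) + R) * (μ • (1 : MatV N 2 ℂ) - R) = 0 ∧
  lift2 (n := 3) 1 (bmwK q μ R) * lift2 0 (bmwK q μ R) =
      lift2 1 (bmwK q μ R) * lift2 0 R * lift2 1 R ∧
  lift2 (n := 3) 1 (bmwK q μ R) * lift2 0 (bmwK q μ R) =
      lift2 1 (bmwK q μ R) * lift2 0 R⁻¹ * lift2 1 R⁻¹ ∧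
  lift2 (n := 3) 0 (bmwK q μ R) * lift2 1 (bmwK q μ R) * lift2 0 (bmwK q μ R) =
      lift2 0 (bmwK q μ R)

/-- `{R, F}` is a compatible pair of R-matrices (twist relations). -/
def Compatible (R F : MatV N 2 ℂ) : Prop :=
  lift2 (n := 3) 0 R * lift2 1 F * lift2 0 F = lift2 1 F * lift2 0 F * lift2 1 R ∧
  lift2 (n := 3) 1 R * lift2 0 F * lift2 1 F = lift2 0 F * lift2 1 F * lift2 0 R

/-- The antisymmetrizers `A^{(i)} ∈ End(V^{⊗i})` of a BMW-type R-matrix. -/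
def asym (q μ : ℂ) (R : MatV N 2 ℂ) : (i : ℕ) → MatV N i ℂ
  | 0 => 1
  | 1 => 1
  | i + 2 =>
      (q ^ (i + 1) / nq q (i + 2)) •
        (ext1 (asym q μ R (i + 1)) *
          ((1 : MatV N (i + 2) ℂ) +
              ((q ^ (-(2 * ((i : ℤ) + 1))) - 1) / (q - q⁻¹)) • lift2 i R +
              (μ * (q ^ (-(2 * ((i : ℤ) + 1))) - 1) / (μ + q ^ (1 - 2 * ((i : ℤ) + 1)))) •
                lift2 i (bmwK q μ R)) *
          ext1 (asym q μ R (i + 1)))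

/-- The height-`k` cutting condition
    `A^{(k)} σ⁻_k(q^{-2k}) A^{(k)} = 0` in `End(V^{⊗(k+1)})`. -/
def HeightCut (q μ : ℂ) (R : MatV N 2 ℂ) (k : ℕ) : Prop :=
  ext1 (asym q μ R k) *
      ((1 : MatV N (k + 1) ℂ) +
          ((q ^ (-(2 * (k : ℤ))) - 1) / (q - q⁻¹)) • lift2 (k - 1) R +
          (μ * (q ^ (-(2 * (k : ℤ))) - 1) / (μ + q ^ (1 - 2 * (k : ℤ)))) •
            lift2 (k - 1) (bmwK q μ R)) *
      ext1 (asym q μ R k) = 0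

/-- `R` is an R-matrix of height `k`. -/
def HasHeight (q μ : ℂ) (R : MatV N 2 ℂ) (k : ℕ) : Prop :=
  2 ≤ k ∧ (∀ i, 2 ≤ i → i ≤ k → asym q μ R i ≠ 0) ∧ HeightCut q μ R k

section AlgebraSide

variable [Ring A] [Algebra ℂ A]

/-- The copies `M_{(i+1)}` of the quantum matrix inside `V^{⊗n}`:
    `M_{(1)} = M₁`, `M_{(i+1)} = F_i M_{(i)} F_i⁻¹`. -/
def Mcopy {n : ℕ} (F : MatV N 2 ℂ) (M : Matrix (Fin N) (Fin N) A) : ℕ → MatV N n A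
  | 0 => lift1 0 M
  | j + 1 => cmap (lift2 j F) * Mcopy F M j * cmap (lift2 j F⁻¹)

/-- The product `M_{(1)} M_{(2)} ⋯ M_{(j)}`. -/
def Mprod {n : ℕ} (F : MatV N 2 ℂ) (M : Matrix (Fin N) (Fin N) A) : ℕ → MatV N n A
  | 0 => 1
  | j + 1 => Mprod F M j * Mcopy F M j

/-- The product `M_{(2)} M_{(3)} ⋯ M_{(j+1)}`. -/
def MprodFrom2 {n : ℕ} (F : MatV N 2 ℂ) (M : Matrix (Fin N) (Fin N) A) : ℕ → MatV N n A
  | 0 => 1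
  | j + 1 => MprodFrom2 F M j * Mcopy F M (j + 1)

/-- The defining relation `R₁ M_{(1)} M_{(2)} = M_{(1)} M_{(2)} R₁` of the
    quantum matrix algebra `M(R,F)`. -/
def QMArel (R F : MatV N 2 ℂ) (M : Matrix (Fin N) (Fin N) A) : Prop :=
  cmap (lift2 (n := 2) 0 R) * Mcopy F M 0 * Mcopy F M 1 =
    Mcopy F M 0 * Mcopy F M 1 * cmap (lift2 (n := 2) 0 R)

/-- The 2-contraction `g` of the quantum matrix `M`. -/
def gElt (q μ : ℂ) (R F ΨR : MatV N 2 ℂ) (M : Matrix (Fin N) (Fin N) A) : A :=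
  (μ * (q - q⁻¹) / ((q - μ) * (q⁻¹ + μ))) •
    trAll (cmap (Dof ΨR)) 2 (Mprod F M 2 * cmap (lift2 0 (bmwK q μ R)))

/-- The elementary symmetric functions `a_i` of the quantum matrix `M`. -/
def aElt (q μ : ℂ) (R F ΨR : MatV N 2 ℂ) (M : Matrix (Fin N) (Fin N) A) : ℕ → A
  | 0 => 1
  | i + 1 => trAll (cmap (Dof ΨR)) (i + 1) (Mprod F M (i + 1) * cmap (asym q μ R (i + 1)))

/-- The map `φ(X)₁ = Tr_{R(2)}(F₁ X₁ F₁⁻¹ R₁)`. -/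
def phi (R F ΨR : MatV N 2 ℂ) (X : Matrix (Fin N) (Fin N) A) : Matrix (Fin N) (Fin N) A :=
  toN (ptrace (cmap (Dof ΨR))
    (cmap (lift2 (n := 2) 0 F) * lift1 0 X * cmap (lift2 (n := 2) 0 F⁻¹) *
      cmap (lift2 (n := 2) 0 R)))

/-- The map `ξ(X)₁ = Tr_{R(2)}(F₁ X₁ F₁⁻¹ K₁)`. -/
def xi (q μ : ℂ) (R F ΨR : MatV N 2 ℂ) (X : Matrix (Fin N) (Fin N) A) :
    Matrix (Fin N) (Fin N) A :=
  toN (ptrace (cmap (Dof ΨR))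
    (cmap (lift2 (n := 2) 0 F) * lift1 0 X * cmap (lift2 (n := 2) 0 F⁻¹) *
      cmap (lift2 (n := 2) 0 (bmwK q μ R))))

/-- The map `φ⁻¹(X)₁ = μ⁻² Tr_{R_f(2)}(F₁⁻¹ X₁ R₁⁻¹ F₁)`,
    where the `R_f`-trace has weight `D_{F⁻¹} (D_{R⁻¹})⁻¹ D_F`. -/
def phiInv (μ : ℂ) (R F ΨF ΨFinv ΨRinv : MatV N 2 ℂ) (X : Matrix (Fin N) (Fin N) A) :
    Matrix (Fin N) (Fin N) A :=
  (μ⁻¹) ^ 2 •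
    toN (ptrace (cmap (Dof ΨFinv * (Dof ΨRinv)⁻¹ * Dof ΨF))
      (cmap (lift2 (n := 2) 0 F⁻¹) * lift1 0 X * cmap (lift2 (n := 2) 0 R⁻¹) *
        cmap (lift2 (n := 2) 0 F)))

/-- Star-multiplication by `M`: `L(X) = M ⋆ X = M · φ(X)`. -/
def Lmap (R F ΨR : MatV N 2 ℂ) (M X : Matrix (Fin N) (Fin N) A) : Matrix (Fin N) (Fin N) A :=
  M * phi R F ΨR X

/-- The star-powers `M^{[n]}` of the quantum matrix. -/
def starPow (R F ΨR : MatV N 2 ℂ) (M : Matrix (Fin N) (Fin N) A) : ℕ → Matrix (Fin N) (Fin N) A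
  | 0 => 1
  | n + 1 => M * phi R F ΨR (starPow R F ΨR M n)

/-- The wedge powers `M^{a^{(i)}} = Tr_{R(2,…,i)}(M_{(1)} ⋯ M_{(i)} A^{(i)})`. -/
def Mwedge (q μ : ℂ) (R F ΨR : MatV N 2 ℂ) (M : Matrix (Fin N) (Fin N) A) :
    ℕ → Matrix (Fin N) (Fin N) A
  | 0 => 1
  | i + 1 => toN (trTail (cmap (Dof ΨR)) i (Mprod F M (i + 1) * cmap (asym q μ R (i + 1))))

/-- The descendants `A^{(m,i)} = i_q · M^{[m]} ⋆ M^{a^{(i)}}` (here `m ≥ 0`). -/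
def Ad (q μ : ℂ) (R F ΨR : MatV N 2 ℂ) (M : Matrix (Fin N) (Fin N) A) (m i : ℕ) :
    Matrix (Fin N) (Fin N) A :=
  nq q i • (Lmap R F ΨR M)^[m] (Mwedge q μ R F ΨR M i)

/-- The descendants `B^{(m,i)}`, including the boundary value
    `B^{(0,i)} = i_q φ⁻¹(ξ(M^{a^{(i)}}))`. -/
def Bd (q μ : ℂ) (R F ΨR ΨF ΨFinv ΨRinv : MatV N 2 ℂ) (M : Matrix (Fin N) (Fin N) A) :
    ℕ → ℕ → Matrix (Fin N) (Fin N) A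
  | 0, i => nq q i • phiInv μ R F ΨF ΨFinv ΨRinv (xi q μ R F ΨR (Mwedge q μ R F ΨR M i))
  | m + 1, i => nq q i • (Lmap R F ΨR M)^[m] (M * xi q μ R F ΨR (Mwedge q μ R F ΨR M i))

/-- The boundary descendant
    `A^{(-1,i)} = i_q φ⁻¹(Tr_{R(2,…,i)}(M_{(2)} ⋯ M_{(i)} A^{(i)}))`. -/
def Aneg1 (q μ : ℂ) (R F ΨR ΨF ΨFinv ΨRinv : MatV N 2 ℂ) (M : Matrix (Fin N) (Fin N) A) :
    ℕ → Matrix (Fin N) (Fin N) A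
  | 0 => 0
  | i + 1 =>
      nq q (i + 1) •
        phiInv μ R F ΨF ΨFinv ΨRinv
          (toN (trTail (cmap (Dof ΨR)) i (MprodFrom2 F M i * cmap (asym q μ R (i + 1)))))

/-- The shifted family `AdS m i = A^{(m-1,i)}` (so that `AdS 0 i = A^{(-1,i)}`). -/
def AdS (q μ : ℂ) (R F ΨR ΨF ΨFinv ΨRinv : MatV N 2 ℂ) (M : Matrix (Fin N) (Fin N) A) :
    ℕ → ℕ → Matrix (Fin N) (Fin N) A
  | 0, i => Aneg1 q μ R F ΨR ΨF ΨFinv ΨRinv M i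
  | m + 1, i => Ad q μ R F ΨR M m i

/-- The coefficients `ε_i` of the symplectic Cayley-Hamilton identity. -/
def eps (q μ : ℂ) (R F ΨR : MatV N 2 ℂ) (M : Matrix (Fin N) (Fin N) A) (k i : ℕ) : A :=
  if i ≤ k then
    ∑ j ∈ Finset.range (i / 2 + 1), aElt q μ R F ΨR M (i - 2 * j) * gElt q μ R F ΨR M ^ j
  else
    (∑ j ∈ Finset.range ((2 * k - i) / 2 + 1),
        aElt q μ R F ΨR M (2 * k - i - 2 * j) * gElt q μ R F ΨR M ^ j) *
      gElt q μ R F ΨR M ^ (i - k)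

/-- The map `π(X)₁ = Tr_{R(2)}(R₁ X₁ K₁)`. -/
def piMap (q μ : ℂ) (R ΨR : MatV N 2 ℂ) (X : Matrix (Fin N) (Fin N) A) :
    Matrix (Fin N) (Fin N) A :=
  toN (ptrace (cmap (Dof ΨR))
    (cmap (lift2 (n := 2) 0 R) * lift1 0 X * cmap (lift2 (n := 2) 0 (bmwK q μ R))))

end AlgebraSide

/-- The matrix `G₁ = Tr_(2,3)(K₂ F₁⁻¹ F₂⁻¹)`. -/
def Gmat (q μ : ℂ) (R F : MatV N 2 ℂ) : Matrix (Fin N) (Fin N) ℂ :=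
  toN (trTail (1 : Matrix (Fin N) (Fin N) ℂ) 2
    (lift2 (n := 3) 1 (bmwK q μ R) * lift2 0 F⁻¹ * lift2 1 F⁻¹))

end QMA

end

noncomputable section

namespace QMA

variable {N : ℕ} [NeZero N] {A : Type*} [Ring A] [Algebra ℂ A]

/-- The star-powers `π(M)^{[n]}` of `π(M)`:
`π(M)^{[0]} = I` and `π(M)^{[n+1]} = μ φ⁻¹(ξ(M) G⁻¹ π(M)^{[n]} G)`. -/
def piPow (q μ : ℂ) (R F ΨR ΨF ΨFinv ΨRinv : MatV N 2 ℂ) (M : Matrix (Fin N) (Fin N) A) :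
    ℕ → Matrix (Fin N) (Fin N) A
  | 0 => 1
  | n + 1 =>
      μ • phiInv μ R F ΨF ΨFinv ΨRinv
          (xi q μ R F ΨR M * cmap (Gmat q μ R F)⁻¹ *
            piPow q μ R F ΨR ΨF ΨFinv ΨRinv M n * cmap (Gmat q μ R F))

end QMA

end

section
namespace QMA

section Words

variable {E : Type*} [Ring E]

theorem tl {U V : E} (h : ∀ x, U * x = V * x) : U = V := by simpa using h 1

theorem ra2 {a b c : E} (h : a * b = c) (x : E) : a * (b * x) = c * x := by
  rw [← h]; simp only [mul_assoc]

theorem ra3 {a b c d : E} (h : a * b * c = d) (x : E) : a * (b * (c * x)) = d * x := by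
  rw [← h]; simp only [mul_assoc]

/-- Two-sided inverses. -/
structure Inv2 (a b : E) : Prop where
  l : a * b = 1
  r : b * a = 1

theorem Inv2.symm {a b : E} (h : Inv2 a b) : Inv2 b a := ⟨h.r, h.l⟩

theorem Inv2.mul {a b c d : E} (h : Inv2 a b) (h' : Inv2 c d) : Inv2 (a * c) (d * b) :=
  ⟨tl fun x => by simp only [mul_assoc, ra2 h.l, ra2 h'.l, one_mul],
   tl fun x => by simp only [mul_assoc, ra2 h.r, ra2 h'.r, one_mul]⟩

theorem Inv2.lcan {a b x y : E} (h : Inv2 a b) (e : a * x = a * y) : x = y := by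
  rw [← one_mul x, ← one_mul y, ← h.r, mul_assoc, mul_assoc, e]

theorem Inv2.rcan {a b x y : E} (h : Inv2 a b) (e : x * a = y * a) : x = y := by
  rw [← mul_one x, ← mul_one y, ← h.l, ← mul_assoc, ← mul_assoc, e]

/-- `a u = u b` gives `a u⁻¹ = u⁻¹ b`-type rules. -/
theorem Inv2.conj {u v a b : E} (h : Inv2 u v) (e : a * u = u * b) : v * a = b * v :=
  h.rcan (h.lcan (tl fun x => by
    simp only [mul_assoc, ra2 h.l, ra2 h.r, ra2 e, one_mul]))

/-- Passing to inverses in an intertwining relation. -/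
theorem Inv2.inter {a a' b b' u : E} (ha : Inv2 a a') (hb : Inv2 b b') (e : a * u = u * b) :
    a' * u = u * b' :=
  ha.lcan (hb.rcan (tl fun x => by
    simp only [mul_assoc, ra2 ha.l, ra2 hb.r, ra2 e, one_mul]))

end Words

/-- An abstract model of a Birman–Murakami–Wenzl tower with a compatible braid family `F`. -/
structure Tower (E : Type*) [Ring E] [Algebra ℂ E] (q μ : ℂ) where
  S : ℕ → Subalgebra ℂ E
  mono : ∀ n, S n ≤ S (n + 1)
  R : ℕ → E
  Ri : ℕ → E
  F : ℕ → E
  Fi : ℕ → E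
  K : ℕ → E
  R_mem : ∀ n, R n ∈ S (n + 2)
  Ri_mem : ∀ n, Ri n ∈ S (n + 2)
  F_mem : ∀ n, F n ∈ S (n + 2)
  Fi_mem : ∀ n, Fi n ∈ S (n + 2)
  R_comm' : ∀ n, ∀ x ∈ S n, x * R n = R n * x
  F_comm' : ∀ n, ∀ x ∈ S n, x * F n = F n * x
  RR : ∀ n, Inv2 (R n) (Ri n)
  FF : ∀ n, Inv2 (F n) (Fi n)
  Rbraid : ∀ n, R n * R (n + 1) * R n = R (n + 1) * R n * R (n + 1)
  Fbraid : ∀ n, F n * F (n + 1) * F n = F (n + 1) * F n * F (n + 1)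
  RFF : ∀ n, R n * F (n + 1) * F n = F (n + 1) * F n * R (n + 1)
  FFR : ∀ n, R (n + 1) * F n * F (n + 1) = F n * F (n + 1) * R n
  Kdef : ∀ n, K n = (q - q⁻¹)⁻¹ • (Ri n - R n) + 1
  q0 : q ≠ 0
  lam : q - q⁻¹ ≠ 0
  mu0 : μ ≠ 0
  RK : ∀ n, R n * K n = μ • K n
  KR : ∀ n, K n * R n = μ • K n
  K21 : ∀ n, K (n + 1) * K n = K (n + 1) * R n * R (n + 1)
  K21' : ∀ n, K (n + 1) * K n = K (n + 1) * Ri n * Ri (n + 1)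
  K121 : ∀ n, K n * K (n + 1) * K n = K n
  tr_ex : ∀ n, ∀ x ∈ S (n + 1), ∃ y ∈ S n, K n * x * K n = y * K n
  resL : ∀ n, ∀ x ∈ S (n + 2), ∃ y ∈ S (n + 1), x * K n = y * K n
  resR : ∀ n, ∀ x ∈ S (n + 2), ∃ y ∈ S (n + 1), K n * x = K n * y
  cancel : ∀ n, ∀ x ∈ S n, x * K n = 0 → x = 0

namespace Tower

variable {E : Type*} [Ring E] [Algebra ℂ E] {q μ : ℂ} (T : Tower E q μ)

theorem mono' {m n : ℕ} (h : m ≤ n) : T.S m ≤ T.S n := monotone_nat_of_le_succ T.mono h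

theorem sm {m n : ℕ} {x : E} (hx : x ∈ T.S m) (h : m ≤ n := by omega) : x ∈ T.S n := T.mono' h hx

theorem K_mem (n : ℕ) : T.K n ∈ T.S (n + 2) := by
  rw [T.Kdef]
  exact add_mem (Subalgebra.smul_mem _ (sub_mem (T.Ri_mem n) (T.R_mem n)) _) (one_mem _)

theorem R_comm {m n : ℕ} {x : E} (hx : x ∈ T.S m) (h : m ≤ n := by omega) :
    x * T.R n = T.R n * x := T.R_comm' n x (T.sm hx h)

theorem F_comm {m n : ℕ} {x : E} (hx : x ∈ T.S m) (h : m ≤ n := by omega) :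
    x * T.F n = T.F n * x := T.F_comm' n x (T.sm hx h)

theorem Ri_comm {m n : ℕ} {x : E} (hx : x ∈ T.S m) (h : m ≤ n := by omega) :
    x * T.Ri n = T.Ri n * x := ((T.RR n).inter (T.RR n) (T.R_comm hx h).symm).symm

theorem Fi_comm {m n : ℕ} {x : E} (hx : x ∈ T.S m) (h : m ≤ n := by omega) :
    x * T.Fi n = T.Fi n * x := ((T.FF n).inter (T.FF n) (T.F_comm hx h).symm).symm

theorem K_comm {m n : ℕ} {x : E} (hx : x ∈ T.S m) (h : m ≤ n := by omega) :
    x * T.K n = T.K n * x := by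
  rw [T.Kdef]
  simp only [mul_add, add_mul, mul_smul_comm, smul_mul_assoc, mul_sub, sub_mul, T.R_comm hx h,
    T.Ri_comm hx h, mul_one, one_mul]

/-- Anything intertwined by `u` for `R` is intertwined for `K`. -/
theorem K_inter {a b : ℕ} {u : E} (h : T.R a * u = u * T.R b) : T.K a * u = u * T.K b := by
  have h' := (T.RR a).inter (T.RR b) h
  rw [T.Kdef, T.Kdef]
  simp only [mul_add, add_mul, mul_smul_comm, smul_mul_assoc, mul_sub, sub_mul, h, h', mul_one,
    one_mul]

theorem Ri_inter {a b : ℕ} {u : E} (h : T.R a * u = u * T.R b) : T.Ri a * u = u * T.Ri b :=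
  (T.RR a).inter (T.RR b) h

theorem RiK (n : ℕ) : T.Ri n * T.K n = μ⁻¹ • T.K n := by
  have h := T.RK n
  refine (T.RR n).lcan ?_
  rw [← mul_assoc, (T.RR n).l, mul_smul_comm, h, smul_smul, inv_mul_cancel₀ T.mu0, one_smul, one_mul]

theorem Ri_eq (n : ℕ) : T.Ri n = T.R n - (q - q⁻¹) • 1 + (q - q⁻¹) • T.K n := by
  rw [T.Kdef, smul_add, smul_smul, mul_inv_cancel₀ T.lam]; module

theorem R12R (n : ℕ) : T.R n * (T.R (n + 1) * T.R n) = (T.R (n + 1) * T.R n) * T.R (n + 1) := by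
  rw [← mul_assoc, T.Rbraid]

theorem R21R (n : ℕ) : T.R (n + 1) * (T.R n * T.R (n + 1)) = (T.R n * T.R (n + 1)) * T.R n := by
  rw [← mul_assoc, ← T.Rbraid]

theorem KR21 (n : ℕ) : T.K n * T.R (n + 1) * T.R n = T.R (n + 1) * T.R n * T.K (n + 1) := by
  rw [mul_assoc]; exact T.K_inter (T.R12R n)

theorem KR12 (n : ℕ) : T.K (n + 1) * T.R n * T.R (n + 1) = T.R n * T.R (n + 1) * T.K n := by
  rw [mul_assoc]; exact T.K_inter (T.R21R n)

theorem KRi21 (n : ℕ) : T.K n * T.Ri (n + 1) * T.Ri n = T.Ri (n + 1) * T.Ri n * T.K (n + 1) := by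
  rw [mul_assoc]
  exact (((T.RR n).mul (T.RR (n + 1))).conj (by rw [← mul_assoc]; exact T.KR12 n)).symm

/-- The half twist on three strands. -/
theorem half (n : ℕ) : T.R n * (T.R n * T.R (n + 1) * T.R n) =
    (T.R n * T.R (n + 1) * T.R n) * T.R (n + 1) := by
  conv_lhs => rw [T.Rbraid]
  conv_rhs => rw [T.Rbraid]
  exact tl fun x => by simp only [mul_assoc, ra3 (T.Rbraid n)]

theorem half' (n : ℕ) : T.R (n + 1) * (T.R n * T.R (n + 1) * T.R n) =
    (T.R n * T.R (n + 1) * T.R n) * T.R n := by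
  exact tl fun x => by simp only [mul_assoc, ra3 (T.Rbraid n).symm]

theorem K12 (n : ℕ) : T.K n * T.K (n + 1) = T.K n * T.R (n + 1) * T.R n := by
  have hI := ((T.RR n).mul (T.RR (n + 1))).mul (T.RR n)
  refine hI.rcan ?_
  have e1 := T.K_inter (T.half n)
  have e2 := T.K_inter (T.half' n)
  have e3 := T.half n
  have e4 := T.half' n
  generalize T.R n * T.R (n + 1) * T.R n = D at *
  have := T.K21 n
  exact tl fun x => by simp only [mul_assoc, ra2 e1, ra2 e2, ra2 e3, ra2 e4, ra2 this]

theorem K12' (n : ℕ) : T.K n * T.K (n + 1) = T.K n * T.Ri (n + 1) * T.Ri n := by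
  have hI := ((T.RR n).mul (T.RR (n + 1))).mul (T.RR n)
  refine hI.rcan ?_
  have e1 := T.K_inter (T.half n)
  have e2 := T.K_inter (T.half' n)
  have e3 := T.Ri_inter (T.half n)
  have e4 := T.Ri_inter (T.half' n)
  generalize T.R n * T.R (n + 1) * T.R n = D at *
  have := T.K21' n
  exact tl fun x => by simp only [mul_assoc, ra2 e1, ra2 e2, ra2 e3, ra2 e4, ra2 this]

theorem K212 (n : ℕ) : T.K (n + 1) * T.K n * T.K (n + 1) = T.K (n + 1) := by
  have hI := ((T.RR n).mul (T.RR (n + 1))).mul (T.RR n)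
  refine hI.rcan ?_
  have e1 := T.K_inter (T.half n)
  have e2 := T.K_inter (T.half' n)
  generalize T.R n * T.R (n + 1) * T.R n = D at *
  have := T.K121 n
  exact tl fun x => by simp only [mul_assoc, ra2 e1, ra2 e2, ra3 this]

theorem R12K (n : ℕ) : T.R n * T.R (n + 1) * T.K n = T.K (n + 1) * T.K n := by
  rw [T.K21, T.KR12]

theorem R21K (n : ℕ) : T.R (n + 1) * T.R n * T.K (n + 1) = T.K n * T.K (n + 1) := by
  rw [T.K12, T.KR21]

theorem Ri21K (n : ℕ) : T.Ri (n + 1) * T.Ri n * T.K (n + 1) = T.K n * T.K (n + 1) := by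
  rw [T.K12', T.KRi21]

/-! Rules moving a crossing next to a cup or cap. -/
theorem K2R1 (n : ℕ) : T.K (n + 1) * T.R n = T.K (n + 1) * T.K n * T.Ri (n + 1) :=
  (T.RR (n + 1)).rcan (by rw [mul_assoc (_ * _), (T.RR _).r, mul_one, T.K21])

theorem K1R2 (n : ℕ) : T.K n * T.R (n + 1) = T.K n * T.K (n + 1) * T.Ri n :=
  (T.RR n).rcan (by rw [mul_assoc (_ * _), (T.RR _).r, mul_one, T.K12])

theorem K1Ri2 (n : ℕ) : T.K n * T.Ri (n + 1) = T.K n * T.K (n + 1) * T.R n :=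
  (T.RR n).symm.rcan (by rw [mul_assoc (_ * _), (T.RR _).l, mul_one, T.K12'])

theorem R1K2 (n : ℕ) : T.R n * T.K (n + 1) = T.Ri (n + 1) * T.K n * T.K (n + 1) :=
  (T.RR (n + 1)).lcan (by
    rw [← mul_assoc, ← mul_assoc, ← mul_assoc, (T.RR _).l, one_mul, T.R21K])

theorem Ri1K2 (n : ℕ) : T.Ri n * T.K (n + 1) = T.R (n + 1) * T.K n * T.K (n + 1) :=
  (T.RR (n + 1)).symm.lcan (by
    rw [← mul_assoc, ← mul_assoc, ← mul_assoc, (T.RR _).r, one_mul, T.Ri21K])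

theorem R2K1 (n : ℕ) : T.R (n + 1) * T.K n = T.Ri n * T.K (n + 1) * T.K n :=
  (T.RR n).lcan (by
    rw [← mul_assoc, ← mul_assoc, ← mul_assoc, (T.RR _).l, one_mul, T.R12K])

theorem K2R1K2 (n : ℕ) : T.K (n + 1) * T.R n * T.K (n + 1) = μ⁻¹ • T.K (n + 1) := by
  rw [T.K2R1, mul_assoc, T.RiK, mul_smul_comm, T.K212]

/-! Relations with the braid family `F`. -/
theorem RF21 (n : ℕ) : T.R n * (T.F (n + 1) * T.F n) = (T.F (n + 1) * T.F n) * T.R (n + 1) := by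
  rw [← mul_assoc, T.RFF]

theorem RF12 (n : ℕ) : T.R (n + 1) * (T.F n * T.F (n + 1)) = (T.F n * T.F (n + 1)) * T.R n := by
  rw [← mul_assoc, T.FFR]

theorem KF21 (n : ℕ) : T.K n * (T.F (n + 1) * T.F n) = (T.F (n + 1) * T.F n) * T.K (n + 1) :=
  T.K_inter (T.RF21 n)

theorem KF12 (n : ℕ) : T.K (n + 1) * (T.F n * T.F (n + 1)) = (T.F n * T.F (n + 1)) * T.K n :=
  T.K_inter (T.RF12 n)

theorem FI21 (n : ℕ) : Inv2 (T.F (n + 1) * T.F n) (T.Fi n * T.Fi (n + 1)) :=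
  (T.FF _).mul (T.FF _)

theorem FI12 (n : ℕ) : Inv2 (T.F n * T.F (n + 1)) (T.Fi (n + 1) * T.Fi n) :=
  (T.FF _).mul (T.FF _)

theorem KFi12 (n : ℕ) : T.K (n + 1) * (T.Fi n * T.Fi (n + 1)) = (T.Fi n * T.Fi (n + 1)) * T.K n :=
  ((T.FI21 n).conj (T.KF21 n)).symm

theorem KFi21 (n : ℕ) : T.K n * (T.Fi (n + 1) * T.Fi n) = (T.Fi (n + 1) * T.Fi n) * T.K (n + 1) :=
  ((T.FI12 n).conj (T.KF12 n)).symm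

theorem RFi21 (n : ℕ) : T.R n * (T.Fi (n + 1) * T.Fi n) = (T.Fi (n + 1) * T.Fi n) * T.R (n + 1) :=
  ((T.FI12 n).conj (T.RF12 n)).symm

theorem FF21 (n : ℕ) : T.F n * (T.F (n + 1) * T.F n) = (T.F (n + 1) * T.F n) * T.F (n + 1) := by
  rw [← mul_assoc, T.Fbraid]

theorem FF12 (n : ℕ) : T.F (n + 1) * (T.F n * T.F (n + 1)) = (T.F n * T.F (n + 1)) * T.F n := by
  rw [← mul_assoc, ← T.Fbraid]

theorem FFi12 (n : ℕ) : T.F (n + 1) * (T.Fi n * T.Fi (n + 1)) = (T.Fi n * T.Fi (n + 1)) * T.F n :=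
  ((T.FI21 n).conj (T.FF21 n)).symm

theorem K2F1 (n : ℕ) : T.K (n + 1) * T.F n = T.F n * T.F (n + 1) * T.K n * T.Fi (n + 1) :=
  (T.FF (n + 1)).rcan (tl fun x => by
    simp only [mul_assoc, ra2 (T.FF _).r, one_mul, ra3 ((mul_assoc _ _ _).trans (T.KF12 n))])

theorem K2Fi1 (n : ℕ) : T.K (n + 1) * T.Fi n = T.Fi n * T.Fi (n + 1) * T.K n * T.F (n + 1) :=
  (T.FF (n + 1)).symm.rcan (tl fun x => by
    simp only [mul_assoc, ra2 (T.FF _).l, one_mul, ra3 ((mul_assoc _ _ _).trans (T.KFi12 n))])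

theorem Fi1K2 (n : ℕ) : T.Fi n * T.K (n + 1) = T.F (n + 1) * T.K n * T.Fi (n + 1) * T.Fi n :=
  (T.FF n).rcan (tl fun x => by
    simp only [mul_assoc, ra2 (T.FF _).r, one_mul, ra2 (T.K2F1 n)])

theorem F1K2 (n : ℕ) : T.F n * T.K (n + 1) = T.Fi (n + 1) * T.K n * T.F (n + 1) * T.F n :=
  (T.FF n).symm.rcan (tl fun x => by
    simp only [mul_assoc, ra2 (T.FF _).l, one_mul, ra2 (T.K2Fi1 n)])

end Tower
end QMA
end

section
namespace QMA
namespace Tower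

variable {E : Type*} [Ring E] [Algebra ℂ E] {q μ : ℂ} (T : Tower E q μ)

open Classical in
/-- The weighted partial trace over strand `n`. -/
noncomputable def tr (n : ℕ) (x : E) : E :=
  if h : x ∈ T.S (n + 1) then μ • (T.tr_ex n x h).choose else 0

theorem tr_mem (n : ℕ) (x : E) : T.tr n x ∈ T.S n := by
  unfold tr
  split_ifs with h
  · exact Subalgebra.smul_mem _ (T.tr_ex n x h).choose_spec.1 _
  · exact zero_mem _

theorem tr_spec {n : ℕ} {x : E} (h : x ∈ T.S (n + 1)) :
    T.K n * x * T.K n = μ⁻¹ • (T.tr n x * T.K n) := by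
  unfold tr
  rw [dif_pos h, smul_mul_assoc, smul_smul, inv_mul_cancel₀ T.mu0, one_smul]
  exact (T.tr_ex n x h).choose_spec.2

theorem cancel_eq {n : ℕ} {x y : E} (hx : x ∈ T.S n) (hy : y ∈ T.S n)
    (h : x * T.K n = y * T.K n) : x = y :=
  sub_eq_zero.1 (T.cancel n _ (sub_mem hx hy) (by rw [sub_mul, h, sub_self]))

theorem smul_mu_inv_inj (T : Tower E q μ) {x y : E} (h : μ⁻¹ • x = μ⁻¹ • y) : x = y := by
  have := congrArg (fun z => μ • z) h
  simpa [smul_smul, mul_inv_cancel₀ T.mu0] using this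

theorem smul_mu_inj (T : Tower E q μ) {x y : E} (h : μ • x = μ • y) : x = y := by
  have := congrArg (fun z => μ⁻¹ • z) h
  simpa [smul_smul, inv_mul_cancel₀ T.mu0] using this

theorem tr_eq {n : ℕ} {x y : E} (hx : x ∈ T.S (n + 1)) (hy : y ∈ T.S n)
    (h : T.K n * x * T.K n = μ⁻¹ • (y * T.K n)) : T.tr n x = y :=
  T.cancel_eq (T.tr_mem n x) hy (T.smul_mu_inv_inj (by rw [← T.tr_spec hx, h]))

theorem tr_add {n : ℕ} {x y : E} (hx : x ∈ T.S (n + 1)) (hy : y ∈ T.S (n + 1)) :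
    T.tr n (x + y) = T.tr n x + T.tr n y :=
  T.tr_eq (add_mem hx hy) (add_mem (T.tr_mem _ _) (T.tr_mem _ _)) (by
    rw [mul_add, add_mul, T.tr_spec hx, T.tr_spec hy, add_mul, smul_add])

theorem tr_smul {n : ℕ} {x : E} (c : ℂ) (hx : x ∈ T.S (n + 1)) :
    T.tr n (c • x) = c • T.tr n x :=
  T.tr_eq (Subalgebra.smul_mem _ hx c) (Subalgebra.smul_mem _ (T.tr_mem _ _) c) (by
    rw [mul_smul_comm, smul_mul_assoc, T.tr_spec hx, smul_mul_assoc, smul_comm])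

theorem tr_sub {n : ℕ} {x y : E} (hx : x ∈ T.S (n + 1)) (hy : y ∈ T.S (n + 1)) :
    T.tr n (x - y) = T.tr n x - T.tr n y :=
  T.tr_eq (sub_mem hx hy) (sub_mem (T.tr_mem _ _) (T.tr_mem _ _)) (by
    rw [mul_sub, sub_mul, T.tr_spec hx, T.tr_spec hy, sub_mul, smul_sub])

theorem tr_mul_left {n : ℕ} {x y : E} (hy : y ∈ T.S n) (hx : x ∈ T.S (n + 1)) :
    T.tr n (y * x) = y * T.tr n x :=
  T.tr_eq (mul_mem (T.mono n hy) hx) (mul_mem hy (T.tr_mem _ _)) (by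
    rw [← mul_assoc, ← T.K_comm hy, mul_assoc, mul_assoc, ← mul_assoc (T.K n), T.tr_spec hx,
      mul_smul_comm, mul_assoc])

theorem tr_mul_right {n : ℕ} {x y : E} (hy : y ∈ T.S n) (hx : x ∈ T.S (n + 1)) :
    T.tr n (x * y) = T.tr n x * y :=
  T.tr_eq (mul_mem hx (T.mono n hy)) (mul_mem (T.tr_mem _ _) hy) (by
    rw [← mul_assoc, mul_assoc _ y, T.K_comm hy, ← mul_assoc, T.tr_spec hx,
      smul_mul_assoc, mul_assoc, ← T.K_comm hy, mul_assoc])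

theorem tr_R (n : ℕ) : T.tr (n + 1) (T.R n) = 1 :=
  T.tr_eq (T.R_mem n) (one_mem _) (by rw [T.K2R1K2, one_mul])

theorem tr_K (n : ℕ) : T.tr (n + 1) (T.K n) = μ • 1 :=
  T.tr_eq (T.K_mem n) (Subalgebra.smul_mem _ (one_mem _) _) (by
    rw [T.K212, smul_mul_assoc, one_mul, smul_smul, inv_mul_cancel₀ T.mu0, one_smul])

theorem tr_conj {n : ℕ} {Z : E} (hZ : Z ∈ T.S (n + 1)) :
    T.tr (n + 1) (T.F n * Z * T.Fi n) = T.tr n Z := by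
  have ht := T.tr_mem n Z
  refine T.tr_eq (mul_mem (mul_mem (T.F_mem n) (T.mono _ hZ)) (T.Fi_mem n)) (T.mono _ ht) ?_
  have e : T.K (n + 1) * (T.F n * Z * T.Fi n) * T.K (n + 1) =
      T.F n * T.F (n + 1) * (T.K n * Z * T.K n) * T.Fi (n + 1) * T.Fi n := tl fun x => by
    simp only [mul_assoc, ra2 (T.K2F1 n), ra2 (T.Fi1K2 n), ra2 (T.F_comm hZ (n := n + 1)),
      ra2 (T.FF (n + 1)).r, one_mul]
  rw [e, T.tr_spec hZ]
  simp only [mul_smul_comm, smul_mul_assoc]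
  congr 1
  exact tl fun x => by
    simp only [mul_assoc, ra2 (T.F_comm ht (n := n)).symm, ra2 (T.F_comm ht (n := n + 1)).symm,
      ra3 (T.KF12 n).symm, ra2 (T.FF _).l, one_mul]

theorem tr_conj' {n : ℕ} {Z : E} (hZ : Z ∈ T.S (n + 1)) :
    T.tr (n + 1) (T.Fi n * Z * T.F n) = T.tr n Z := by
  have ht := T.tr_mem n Z
  refine T.tr_eq (mul_mem (mul_mem (T.Fi_mem n) (T.mono _ hZ)) (T.F_mem n)) (T.mono _ ht) ?_
  have e : T.K (n + 1) * (T.Fi n * Z * T.F n) * T.K (n + 1) =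
      T.Fi n * T.Fi (n + 1) * (T.K n * Z * T.K n) * T.F (n + 1) * T.F n := tl fun x => by
    simp only [mul_assoc, ra2 (T.K2Fi1 n), ra2 (T.F1K2 n), ra2 (T.Fi_comm hZ (n := n + 1)),
      ra2 (T.FF (n + 1)).l, one_mul]
  rw [e, T.tr_spec hZ]
  simp only [mul_smul_comm, smul_mul_assoc]
  congr 1
  exact tl fun x => by
    simp only [mul_assoc, ra2 (T.Fi_comm ht (n := n)).symm, ra2 (T.Fi_comm ht (n := n + 1)).symm,
      ra3 (T.KFi12 n).symm, ra2 (T.FF _).r, one_mul]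

/-- Collapse of a cup: any element next to `K` can be moved to its first strand. -/
theorem cup {n : ℕ} {Z : E} (hZ : Z ∈ T.S (n + 2)) :
    Z * T.K n = μ⁻¹ • (T.tr (n + 1) (Z * T.K n) * T.K n) := by
  obtain ⟨y, hy, e⟩ := T.resL n Z hZ
  rw [T.tr_eq (y := μ • y) (mul_mem hZ (T.K_mem n)) (Subalgebra.smul_mem _ hy _), smul_mul_assoc,
    smul_smul, inv_mul_cancel₀ T.mu0, one_smul, e]
  rw [e, smul_mul_assoc, smul_smul, inv_mul_cancel₀ T.mu0, one_smul, ← mul_assoc, ← T.K_comm hy,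
    mul_assoc, mul_assoc, ← mul_assoc (T.K _), T.K212]

theorem cap {n : ℕ} {Z : E} (hZ : Z ∈ T.S (n + 2)) :
    T.K n * Z = μ⁻¹ • (T.K n * T.tr (n + 1) (T.K n * Z)) := by
  obtain ⟨y, hy, e⟩ := T.resR n Z hZ
  rw [T.tr_eq (y := μ • y) (mul_mem (T.K_mem n) hZ) (Subalgebra.smul_mem _ hy _), mul_smul_comm,
    smul_smul, inv_mul_cancel₀ T.mu0, one_smul, e]
  rw [e, smul_mul_assoc, smul_smul, inv_mul_cancel₀ T.mu0, one_smul, mul_assoc, mul_assoc,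
    T.K_comm hy, ← mul_assoc, ← mul_assoc, T.K212]

theorem cup_cancel {n : ℕ} {x y : E} (hx : x ∈ T.S (n + 1)) (hy : y ∈ T.S (n + 1))
    (h : x * T.K n = y * T.K n) : x = y := by
  refine T.cancel_eq hx hy ?_
  rw [← T.K212, ← mul_assoc, ← mul_assoc, ← mul_assoc, ← mul_assoc, T.K_comm hx, T.K_comm hy,
    mul_assoc _ x, mul_assoc _ y, h]

theorem cap_cancel {n : ℕ} {x y : E} (hx : x ∈ T.S (n + 1)) (hy : y ∈ T.S (n + 1))
    (h : T.K n * x = T.K n * y) : x = y := by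
  refine T.cancel_eq hx hy ?_
  have e : ∀ x ∈ T.S (n + 1), T.K (n + 1) * x = T.K (n + 1) * (T.K n * x) * T.K (n + 1) := by
    intro x hx
    conv_lhs => rw [← T.K212, mul_assoc, ← T.K_comm hx]
    simp only [mul_assoc]
  rw [T.K_comm hx, T.K_comm hy, e x hx, e y hy, h]

theorem cup_cancel' {n : ℕ} {x y : E} (hx : x ∈ T.S (n + 1)) (hy : y ∈ T.S (n + 1))
    (h : μ⁻¹ • (x * T.K n) = μ⁻¹ • (y * T.K n)) : x = y :=
  T.cup_cancel hx hy (T.smul_mu_inv_inj h)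

/-- The nested double cup–cap. -/
noncomputable def nest (n : ℕ) : E := T.K (n + 1) * T.K n * T.K (n + 2) * T.K (n + 1)

theorem KK_comm (n : ℕ) : T.K n * T.K (n + 2) = T.K (n + 2) * T.K n := T.K_comm (T.K_mem n)

theorem nest_eq (n : ℕ) : T.nest n = T.K (n + 1) * T.K (n + 2) * T.K n * T.K (n + 1) := by
  unfold nest; rw [mul_assoc (T.K (n + 1)), T.KK_comm, ← mul_assoc]

theorem R_nest (n : ℕ) : T.R n * T.nest n = T.R (n + 2) * T.nest n := by
  conv_rhs => rw [nest_eq]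
  unfold nest
  exact tl fun x => by
    simp only [mul_assoc, ra2 (T.R1K2 n), ra2 (T.R2K1 (n + 1)), ra3 (T.K121 n), ra3 (T.K212 (n+1))]
    simp only [mul_assoc, ra2 (T.KK_comm n)]

theorem nest_R (n : ℕ) : T.nest n * T.R n = T.nest n * T.R (n + 2) := by
  conv_lhs => rw [nest_eq]
  unfold nest
  exact tl fun x => by
    simp only [mul_assoc, ra2 (T.K2R1 n), ra2 (T.K1R2 (n + 1)), ra3 (T.K121 n), ra3 (T.K212 (n+1))]
    simp only [mul_assoc, ra2 (T.KK_comm n)]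

theorem nest_spec {n : ℕ} {Z : E} (hZ : Z ∈ T.S (n + 2)) :
    T.nest n * Z * T.nest n = (μ⁻¹ * μ⁻¹) • (T.tr n (T.tr (n + 1) Z) * T.nest n) := by
  have h1 := T.tr_spec hZ
  have h2 := T.tr_spec (T.tr_mem (n + 1) Z)
  have hm := T.tr_mem (n + 1) Z
  have hm' := T.tr_mem n (T.tr (n + 1) Z)
  have e : T.nest n * Z * T.nest n =
    T.K (n + 1) * T.K n * T.K (n + 2) * (T.K (n + 1) * Z * T.K (n + 1)) * T.K (n + 2) * T.K n *
      T.K (n + 1) := by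
    rw [nest_eq]
    exact tl fun x => by simp only [mul_assoc, ra2 (T.KK_comm n)]
  rw [e, h1, mul_smul, mul_smul_comm, smul_mul_assoc, smul_mul_assoc, smul_mul_assoc]
  congr 1
  generalize T.tr (n + 1) Z = W at *
  generalize T.tr n W = t at *
  have e : T.K (n + 1) * T.K n * T.K (n + 2) * (W * T.K (n + 1)) * T.K (n + 2) * T.K n *
      T.K (n + 1) = T.K (n + 1) * (T.K n * W * T.K n) * T.K (n + 2) * T.K (n + 1) := by
    exact tl fun x => by
      simp only [mul_assoc, ra2 (T.K_comm hm (n := n + 2)).symm, ra3 (T.K212 (n + 1)),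
        ra2 (T.KK_comm n)]
  rw [e, h2]
  simp only [mul_smul_comm, smul_mul_assoc]
  congr 1
  unfold nest
  simp only [← mul_assoc, T.K_comm hm' (n := n + 1)]

theorem nest_cancel {n : ℕ} {x y : E} (hx : x ∈ T.S n) (hy : y ∈ T.S n)
    (h : x * T.nest n = y * T.nest n) : x = y := by
  refine T.cancel_eq hx hy (T.cancel_eq (n := n + 2) (mul_mem (T.sm hx) (T.K_mem n))
    (mul_mem (T.sm hy) (T.K_mem n)) ?_)
  have e : ∀ x ∈ T.S n, x * T.K n * T.K (n + 2) = T.K n * (x * T.nest n) * T.K (n + 2) := by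
    intro x hx
    unfold nest
    exact tl fun z => by
      simp only [mul_assoc, ra2 (T.K_comm hx (n := n)).symm, ra3 (T.K121 n), ra3 (T.K212 (n + 1))]
  rw [e x hx, e y hy, h]

theorem cyc {n : ℕ} {Z : E} (hZ : Z ∈ T.S (n + 2)) :
    T.tr n (T.tr (n + 1) (T.R n * Z)) = T.tr n (T.tr (n + 1) (Z * T.R n)) := by
  refine T.nest_cancel (T.tr_mem _ _) (T.tr_mem _ _) (T.smul_mu_inv_inj (T.smul_mu_inv_inj ?_))
  rw [smul_smul, smul_smul, ← T.nest_spec (mul_mem (T.R_mem n) hZ),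
    ← T.nest_spec (mul_mem hZ (T.R_mem n))]
  rw [← mul_assoc, T.nest_R, mul_assoc _ _ Z, ← T.R_comm hZ, mul_assoc, mul_assoc, mul_assoc,
    ← T.R_nest]
  simp only [mul_assoc]

/-- Trace over the strands `a, …, a + m - 1`. -/
noncomputable def mtr (a : ℕ) : ℕ → E → E
  | 0, Z => Z
  | m + 1, Z => mtr a m (T.tr (a + m) Z)

theorem mtr_bot (a m : ℕ) (Z : E) : T.mtr a (m + 1) Z = T.tr a (T.mtr (a + 1) m Z) := by
  induction m generalizing Z with
  | zero => rfl
  | succ m ih =>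
    have e : a + 1 + m = a + (m + 1) := by omega
    rw [mtr, ih, mtr, e]

theorem mtr_mem {a m : ℕ} {Z : E} (hZ : Z ∈ T.S (a + m)) : T.mtr a m Z ∈ T.S a := by
  induction m generalizing Z with
  | zero => exact hZ
  | succ m ih => exact ih (T.tr_mem _ _)

theorem mtr_add {a m : ℕ} {x y : E} (hx : x ∈ T.S (a + m)) (hy : y ∈ T.S (a + m)) :
    T.mtr a m (x + y) = T.mtr a m x + T.mtr a m y := by
  induction m generalizing x y with
  | zero => rfl
  | succ m ih =>
    rw [← add_assoc] at hx hy
    rw [mtr, T.tr_add hx hy, ih (T.tr_mem _ _) (T.tr_mem _ _)]; rfl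

theorem mtr_smul {a m : ℕ} {x : E} (c : ℂ) (hx : x ∈ T.S (a + m)) :
    T.mtr a m (c • x) = c • T.mtr a m x := by
  induction m generalizing x with
  | zero => rfl
  | succ m ih =>
    rw [← add_assoc] at hx
    rw [mtr, T.tr_smul c hx, ih (T.tr_mem _ _)]; rfl

theorem mtr_mul_left {a m : ℕ} {x y : E} (hy : y ∈ T.S a) (hx : x ∈ T.S (a + m)) :
    T.mtr a m (y * x) = y * T.mtr a m x := by
  induction m generalizing x with
  | zero => rfl
  | succ m ih =>
    rw [← add_assoc] at hx
    rw [mtr, T.tr_mul_left (T.sm hy) hx, ih (T.tr_mem _ _)]; rfl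

theorem mtr_mul_right {a m : ℕ} {x y : E} (hy : y ∈ T.S a) (hx : x ∈ T.S (a + m)) :
    T.mtr a m (x * y) = T.mtr a m x * y := by
  induction m generalizing x with
  | zero => rfl
  | succ m ih =>
    rw [← add_assoc] at hx
    rw [mtr, T.tr_mul_right (T.sm hy) hx, ih (T.tr_mem _ _)]; rfl

/-- Elements that can be cycled under the trace over strands `a, …, a + m - 1`. -/
structure Cyc (a m : ℕ) (y : E) : Prop where
  mem : y ∈ T.S (a + m)
  eq : ∀ Z ∈ T.S (a + m), T.mtr a m (y * Z) = T.mtr a m (Z * y)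

variable {T}

theorem Cyc.mul {a m : ℕ} {x y : E} (hx : T.Cyc a m x) (hy : T.Cyc a m y) : T.Cyc a m (x * y) :=
  ⟨mul_mem hx.mem hy.mem, fun Z hZ => by
    rw [mul_assoc, hx.eq _ (mul_mem hy.mem hZ), mul_assoc, hy.eq _ (mul_mem hZ hx.mem), mul_assoc]⟩

theorem Cyc.add {a m : ℕ} {x y : E} (hx : T.Cyc a m x) (hy : T.Cyc a m y) : T.Cyc a m (x + y) :=
  ⟨add_mem hx.mem hy.mem, fun Z hZ => by
    rw [add_mul, mul_add, T.mtr_add (mul_mem hx.mem hZ) (mul_mem hy.mem hZ),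
      T.mtr_add (mul_mem hZ hx.mem) (mul_mem hZ hy.mem), hx.eq Z hZ, hy.eq Z hZ]⟩

theorem Cyc.smul {a m : ℕ} {x : E} (c : ℂ) (hx : T.Cyc a m x) : T.Cyc a m (c • x) :=
  ⟨Subalgebra.smul_mem _ hx.mem c, fun Z hZ => by
    rw [smul_mul_assoc, mul_smul_comm, T.mtr_smul c (mul_mem hx.mem hZ),
      T.mtr_smul c (mul_mem hZ hx.mem), hx.eq Z hZ]⟩

theorem Cyc.one {a m : ℕ} : T.Cyc a m 1 :=
  ⟨one_mem _, fun Z _ => by rw [one_mul, mul_one]⟩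

theorem Cyc.inv {a m : ℕ} {x y : E} (hx : T.Cyc a m x) (h : Inv2 x y) (hy : y ∈ T.S (a + m)) :
    T.Cyc a m y :=
  ⟨hy, fun Z hZ => by
    have := hx.eq (y * Z * y) (mul_mem (mul_mem hy hZ) hy)
    rw [← mul_assoc, ← mul_assoc, h.l, one_mul, mul_assoc, h.r, mul_one] at this
    exact this.symm⟩

theorem Cyc.R {a m j : ℕ} (h1 : a ≤ j) (h2 : j + 2 ≤ a + m) : T.Cyc a m (T.R j) := by
  refine ⟨T.sm (T.R_mem j) h2, ?_⟩
  induction m with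
  | zero => omega
  | succ m ih =>
    intro Z hZ
    rw [← add_assoc] at hZ
    rcases Nat.lt_or_ge (j + 1) (a + m) with h | h
    · rw [mtr, T.tr_mul_left (T.sm (T.R_mem j)) hZ, ih (by omega) _ (T.tr_mem _ _), mtr,
        T.tr_mul_right (T.sm (T.R_mem j)) hZ]
    · obtain ⟨m, rfl⟩ : ∃ l, m = l + 1 := ⟨m - 1, by omega⟩
      obtain rfl : j = a + m := by omega
      simp only [mtr]
      exact congrArg _ (T.cyc (n := a + m) hZ)

theorem Cyc.Ri {a m j : ℕ} (h1 : a ≤ j) (h2 : j + 2 ≤ a + m) : T.Cyc a m (T.Ri j) :=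
  (Cyc.R h1 h2).inv (T.RR j) (T.sm (T.Ri_mem j) h2)

theorem Cyc.K {a m j : ℕ} (h1 : a ≤ j) (h2 : j + 2 ≤ a + m) : T.Cyc a m (T.K j) := by
  rw [T.Kdef, sub_eq_add_neg (T.Ri j), ← neg_one_smul ℂ (T.R j)]
  exact (((Cyc.Ri h1 h2).add ((Cyc.R h1 h2).smul _)).smul _).add Cyc.one

variable (T)

/-- The product `F_a F_{a+1} ⋯ F_{a+m-1}`. -/
def Fp (a : ℕ) : ℕ → E
  | 0 => 1
  | m + 1 => Fp a m * T.F (a + m)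

/-- The inverse of `Fp`. -/
def Fpi (a : ℕ) : ℕ → E
  | 0 => 1
  | m + 1 => T.Fi (a + m) * Fpi a m

theorem Fp_inv (a m : ℕ) : Inv2 (T.Fp a m) (T.Fpi a m) := by
  induction m with
  | zero => exact ⟨one_mul 1, one_mul 1⟩
  | succ m ih => exact ih.mul (T.FF _)

theorem Fp_mem (a m : ℕ) : T.Fp a m ∈ T.S (a + m + 1) := by
  induction m with
  | zero => exact one_mem _
  | succ m ih => exact mul_mem (T.mono _ ih) (T.F_mem _)

theorem Fpi_mem (a m : ℕ) : T.Fpi a m ∈ T.S (a + m + 1) := by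
  induction m with
  | zero => exact one_mem _
  | succ m ih => exact mul_mem (T.Fi_mem _) (T.mono _ ih)

theorem mtr_shift {a m : ℕ} {Z : E} (hZ : Z ∈ T.S (a + m)) :
    T.mtr (a + 1) m (T.Fp a m * Z * T.Fpi a m) = T.mtr a m Z := by
  induction m generalizing Z with
  | zero => simp [Fp, Fpi, mtr]
  | succ m ih =>
    have e : a + 1 + m = a + m + 1 := by omega
    rw [← add_assoc] at hZ
    rw [Fp, Fpi, mtr, mtr, e]
    have : T.Fp a m * T.F (a + m) * Z * (T.Fi (a + m) * T.Fpi a m) =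
      T.Fp a m * ((T.F (a + m) * Z * T.Fi (a + m)) * T.Fpi a m) := by simp only [mul_assoc]
    have hm : T.F (a + m) * Z * T.Fi (a + m) ∈ T.S (a + m + 1 + 1) :=
      mul_mem (mul_mem (T.F_mem _) (T.mono _ hZ)) (T.Fi_mem _)
    rw [this, T.tr_mul_left (T.Fp_mem a m) (mul_mem hm (T.mono _ (T.Fpi_mem a m))),
      T.tr_mul_right (T.Fpi_mem a m) hm, T.tr_conj hZ, ← mul_assoc, ih (T.tr_mem _ _)]

end Tower
end QMA
end

section
namespace QMA
namespace Tower

variable {E : Type*} [Ring E] [Algebra ℂ E] {q μ : ℂ}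

/-- The coefficients of the antisymmetrizer recursion. -/
noncomputable def qn (q : ℂ) (j : ℕ) : ℂ := (q ^ (j : ℤ) - q ^ (-(j : ℤ))) / (q - q⁻¹)

noncomputable def cA (q : ℂ) (i : ℕ) : ℂ := q ^ i / qn q (i + 1)

noncomputable def al (q : ℂ) (i : ℕ) : ℂ := (q ^ (-(2 * (i : ℤ))) - 1) / (q - q⁻¹)

noncomputable def be (q μ : ℂ) (i : ℕ) : ℂ :=
  μ * (q ^ (-(2 * (i : ℤ))) - 1) / (μ + q ^ (1 - 2 * (i : ℤ)))

variable (T : Tower E q μ)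

include T in
theorem zpow_shift (n : ℕ) :
    q ^ (-(2 * ((n + 1 : ℕ) : ℤ))) = q ^ (-(2 * (n : ℤ))) / (q * q) := by
  have h0 := T.q0
  rw [show q * q = q ^ (2 : ℤ) by norm_cast; ring, ← zpow_sub₀ h0]
  congr 1; push_cast; ring

include T in
theorem al_rec (n : ℕ) : al q (n + 1) + q⁻¹ - q⁻¹ * q⁻¹ * al q n = 0 := by
  have h0 := T.q0
  have h1 := T.lam
  unfold al
  rw [T.zpow_shift]
  generalize q ^ (-(2 * (n : ℤ))) = Q
  have h3 : q ^ 2 - 1 ≠ 0 := by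
    intro h; apply h1; field_simp; linear_combination h
  field_simp
  ring

include T in
theorem be_rec {n : ℕ} (hn : μ + q ^ (1 - 2 * (n : ℤ)) ≠ 0)
    (hn' : μ + q ^ (1 - 2 * ((n + 1 : ℕ) : ℤ)) ≠ 0) :
    μ * (be q μ (n + 1) - al q (n + 1) * (q - q⁻¹)) + q * (q - q⁻¹) * al q (n + 1) * be q μ n -
      (q - q⁻¹) * be q μ (n + 1) * be q μ n + q⁻¹ * be q μ (n + 1) = 0 ∧
    - q * al q (n + 1) * be q μ n + be q μ (n + 1) * be q μ n + q⁻¹ * al q n * be q μ (n + 1)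
      = 0 := by
  have h0 := T.q0
  have h1 := T.lam
  have e1 := T.zpow_shift n
  have e2 : q ^ (1 - 2 * (n : ℤ)) = q ^ (-(2 * (n : ℤ))) * q := by
    rw [← zpow_add_one₀ h0]; congr 1; ring
  have e3 : q ^ (1 - 2 * ((n + 1 : ℕ) : ℤ)) = q ^ (-(2 * (n : ℤ))) / q := by
    rw [div_eq_mul_inv, ← zpow_sub_one₀ h0]; congr 1; push_cast; ring
  unfold al be
  rw [e2] at hn
  rw [e3] at hn'
  rw [e1, e2, e3]
  generalize q ^ (-(2 * (n : ℤ))) = Q at *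
  have h2 : μ * q + Q ≠ 0 := by
    intro h; apply hn'; field_simp; linear_combination h
  have h3 : q ^ 2 - 1 ≠ 0 := by
    intro h; apply h1; field_simp; linear_combination h
  have h2' : q * μ + Q ≠ 0 := by rwa [mul_comm q]
  have h2'' : Q + q * μ ≠ 0 := by rwa [add_comm]
  obtain ⟨a, ha⟩ : ∃ a, a = (μ + Q * q)⁻¹ := ⟨_, rfl⟩
  obtain ⟨b, hb⟩ : ∃ b, b = (μ * q + Q)⁻¹ := ⟨_, rfl⟩
  have ha' : a * (μ + Q * q) = 1 := by rw [ha, inv_mul_cancel₀ hn]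
  have hb' : b * (μ * q + Q) = 1 := by rw [hb, inv_mul_cancel₀ h2]
  have e4 : (μ + Q / q)⁻¹ = q * b := by
    rw [hb, inv_eq_iff_eq_inv, mul_inv, inv_inv]; field_simp
  rw [div_eq_mul_inv _ (μ + Q * q), div_eq_mul_inv _ (μ + Q / q), ← ha, e4]
  constructor
  · field_simp
    rw [ha, hb]
    field_simp
    ring
  · field_simp
    rw [ha, hb]
    field_simp
    ring

include T in
theorem be_one (h : μ + q⁻¹ ≠ 0) :
    al q 1 = -q⁻¹ ∧ (μ + q⁻¹) * be q μ 1 = - q⁻¹ * (q - q⁻¹) * μ := by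
  have h0 := T.q0
  have h1 := T.lam
  have h3 : q ^ 2 - 1 ≠ 0 := by
    intro h; apply h1; field_simp; linear_combination h
  have h4 : μ * q + 1 ≠ 0 := by
    intro h'; apply h; field_simp; linear_combination h'
  have e1 := T.zpow_shift 0
  have e2 : q ^ (1 - 2 * ((1 : ℕ) : ℤ)) = q⁻¹ := by norm_num
  unfold al be
  rw [e1, e2]
  simp only [CharP.cast_eq_zero, mul_zero, neg_zero, _root_.zpow_zero]
  constructor
  · field_simp; ring
  · field_simp; ring

/-- The baxterized factor. -/
noncomputable def sg (i j : ℕ) : E := 1 + al q i • T.R j + be q μ i • T.K j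

theorem sg_mem (i j : ℕ) : T.sg i j ∈ T.S (j + 2) :=
  add_mem (add_mem (one_mem _) (Subalgebra.smul_mem _ (T.R_mem j) _))
    (Subalgebra.smul_mem _ (T.K_mem j) _)

theorem sg_comm {m n i : ℕ} {x : E} (hx : x ∈ T.S m) (h : m ≤ n := by omega) :
    x * T.sg i n = T.sg i n * x := by
  simp only [sg, mul_add, add_mul, mul_smul_comm, smul_mul_assoc, T.R_comm hx h, T.K_comm hx h,
    mul_one, one_mul]

theorem sg_inter {a b i : ℕ} {u : E} (h : T.R a * u = u * T.R b) :
    T.sg i a * u = u * T.sg i b := by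
  simp only [sg, mul_add, add_mul, mul_smul_comm, smul_mul_assoc, h, T.K_inter h, mul_one, one_mul]

/-- The antisymmetrizer on the strands `p, …, p + n - 1`. -/
noncomputable def As (p : ℕ) : ℕ → E
  | 0 => 1
  | 1 => 1
  | n + 2 => cA q (n + 1) • (As p (n + 1) * T.sg (n + 1) (p + n) * As p (n + 1))

theorem As_mem (p n : ℕ) : T.As p n ∈ T.S (p + n) := by
  induction n with
  | zero => exact one_mem _
  | succ n ih =>
    cases n with
    | zero => exact one_mem _
    | succ n =>
      exact Subalgebra.smul_mem _ (mul_mem (mul_mem (T.sm ih) (T.sm (T.sg_mem _ _)))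
        (T.sm ih)) _

theorem As_inter {p p' n : ℕ} {u : E}
    (h : ∀ j, j + 2 ≤ n → T.R (p + j) * u = u * T.R (p' + j)) : T.As p n * u = u * T.As p' n := by
  induction n with
  | zero => simp [As]
  | succ n ih =>
    cases n with
    | zero => simp [As]
    | succ n =>
      have h1 := ih fun j hj => h j (by omega)
      have h2 := T.sg_inter (i := n + 1) (h n (by omega))
      simp only [As, smul_mul_assoc, mul_smul_comm]
      congr 1
      exact tl fun x => by simp only [mul_assoc, ra2 h1, ra2 h2]

theorem As_cyc {a m p n : ℕ} (h1 : a ≤ p) (h2 : p + n ≤ a + m) : T.Cyc a m (T.As p n) := by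
  induction n with
  | zero => exact Cyc.one
  | succ n ih =>
    cases n with
    | zero => exact Cyc.one
    | succ n =>
      refine (((ih (by omega)).mul ?_).mul (ih (by omega))).smul _
      exact (Cyc.one.add ((Cyc.R (by omega) (by omega)).smul _)).add
        ((Cyc.K (by omega) (by omega)).smul _)

theorem R_sq (j : ℕ) : T.R j * T.R j = 1 + (q - q⁻¹) • T.R j - ((q - q⁻¹) * μ) • T.K j := by
  have h := congrArg (fun x => T.R j * x) (T.Ri_eq j)
  simp only [mul_add, mul_sub, mul_smul_comm, T.RK, (T.RR j).l, smul_smul, mul_one] at h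
  rw [h]; module

theorem absorb_one {j : ℕ} (h : μ + q⁻¹ ≠ 0) :
    T.R j * T.sg 1 j = (-q⁻¹) • T.sg 1 j ∧ T.sg 1 j * T.R j = (-q⁻¹) • T.sg 1 j := by
  obtain ⟨h1, h2⟩ := T.be_one h
  have h3 : q⁻¹ * q = 1 := inv_mul_cancel₀ T.q0
  unfold sg
  constructor
  · simp only [mul_add, mul_one, mul_smul_comm, T.RK, T.R_sq, h1]
    linear_combination (norm := module) h2 • T.K j - h3 • T.R j
  · simp only [add_mul, one_mul, smul_mul_assoc, T.KR, T.R_sq, h1]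
    linear_combination (norm := module) h2 • T.K j - h3 • T.R j

theorem absorb_left {j n : ℕ} {P : E} (hn : μ + q ^ (1 - 2 * (n : ℤ)) ≠ 0)
    (hn' : μ + q ^ (1 - 2 * ((n + 1 : ℕ) : ℤ)) ≠ 0)
    (hR : T.R j * P = (-q⁻¹) • P) (hRi : T.Ri j * P = (-q) • P) (hK : T.K j * P = 0) :
    T.R (j + 1) * (T.sg n j * T.sg (n + 1) (j + 1) * P) =
      (-q⁻¹) • (T.sg n j * T.sg (n + 1) (j + 1) * P) := by
  have s1 := T.al_rec n
  obtain ⟨s2, s3⟩ := T.be_rec hn hn'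
  have h3 : q⁻¹ * q = 1 := inv_mul_cancel₀ T.q0
  have e1 : T.R (j + 1) * (T.R (j + 1) * P) = P + (q - q⁻¹) • (T.R (j + 1) * P)
      - ((q - q⁻¹) * μ) • (T.K (j + 1) * P) := by
    rw [← mul_assoc, T.R_sq]; simp only [add_mul, sub_mul, smul_mul_assoc, one_mul]
  have e2 : T.R (j + 1) * (T.K (j + 1) * P) = μ • (T.K (j + 1) * P) := by
    rw [← mul_assoc, T.RK, smul_mul_assoc]
  have e3 : T.R (j + 1) * (T.R j * (T.R (j + 1) * P)) = (-q⁻¹) • (T.R j * (T.R (j + 1) * P)) := by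
    rw [← mul_assoc, ← mul_assoc, ← T.Rbraid, mul_assoc, mul_assoc, hR, mul_smul_comm,
      mul_smul_comm]
  have e4 : T.R (j + 1) * (T.R j * (T.K (j + 1) * P)) = T.K j * (T.K (j + 1) * P) := by
    rw [← mul_assoc, ← mul_assoc, T.R21K, mul_assoc]
  have e0 : ∀ x, T.Ri j * x = T.R j * x - (q - q⁻¹) • x + (q - q⁻¹) • (T.K j * x) := fun x => by
    rw [T.Ri_eq]; simp only [add_mul, sub_mul, smul_mul_assoc, one_mul]
  have e5 : T.R (j + 1) * (T.K j * (T.R (j + 1) * P)) = (-q) • (T.R j * (T.K (j + 1) * P) -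
      (q - q⁻¹) • (T.K (j + 1) * P) + (q - q⁻¹) • (T.K j * (T.K (j + 1) * P))) := by
    rw [← mul_assoc, T.R2K1, mul_assoc (T.Ri j), T.K21', mul_assoc, mul_assoc, mul_assoc, ra2 (T.RR _).r,
      one_mul, hRi, mul_smul_comm, mul_smul_comm, e0]
  have e6 : T.R (j + 1) * (T.K j * (T.K (j + 1) * P)) = (T.R j * (T.K (j + 1) * P) -
      (q - q⁻¹) • (T.K (j + 1) * P) + (q - q⁻¹) • (T.K j * (T.K (j + 1) * P))) := by
    rw [← mul_assoc, T.R2K1, mul_assoc, mul_assoc, ra3 (T.K212 _), e0]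
  have e7 : T.K j * (T.R (j + 1) * P) = (-q) • (T.K j * (T.K (j + 1) * P)) := by
    rw [← mul_assoc, T.K1R2, mul_assoc, hRi, mul_smul_comm, mul_assoc]
  simp only [sg, add_mul, mul_add, one_mul, mul_one, smul_mul_assoc, mul_smul_comm, mul_assoc, hR,
    hK, e1, e2, e3, e4, e5, e6, e7, smul_zero, mul_zero]
  have s4 := congrArg (q * ·) s3
  simp only [mul_zero] at s4
  linear_combination (norm := module) s1 • P + (s1 * q) • (T.R (j + 1) * P) - h3 • (T.R (j + 1) * P) + (al q n * q⁻¹ * h3) • (T.R (j + 1) * P) +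
    s2 • (T.K (j + 1) * P) + s3 • (T.R j * (T.K (j + 1) * P)) + s4 • (T.K j * (T.K (j + 1) * P)) -
    (be q μ (n + 1) * al q n * h3) • (T.K j * (T.K (j + 1) * P))

theorem absorb_right {j n : ℕ} {P : E} (hn : μ + q ^ (1 - 2 * (n : ℤ)) ≠ 0)
    (hn' : μ + q ^ (1 - 2 * ((n + 1 : ℕ) : ℤ)) ≠ 0)
    (hR : P * T.R j = (-q⁻¹) • P) (hRi : P * T.Ri j = (-q) • P) (hK : P * T.K j = 0) :
    P * T.sg (n + 1) (j + 1) * T.sg n j * T.R (j + 1) =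
      (-q⁻¹) • (P * T.sg (n + 1) (j + 1) * T.sg n j) := by
  have s1 := T.al_rec n
  obtain ⟨s2, s3⟩ := T.be_rec hn hn'
  have h3 : q⁻¹ * q = 1 := inv_mul_cancel₀ T.q0
  have e1 : P * T.R (j + 1) * T.R (j + 1) = P + (q - q⁻¹) • (P * T.R (j + 1))
      - ((q - q⁻¹) * μ) • (P * T.K (j + 1)) := by
    rw [mul_assoc, T.R_sq]; simp only [mul_add, mul_sub, mul_smul_comm, mul_one]
  have e2 : P * T.K (j + 1) * T.R (j + 1) = μ • (P * T.K (j + 1)) := by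
    rw [mul_assoc, T.KR, mul_smul_comm]
  have e3 : P * T.R (j + 1) * T.R j * T.R (j + 1) = (-q⁻¹) • (P * T.R (j + 1) * T.R j) := by
    rw [mul_assoc P, mul_assoc P, ← T.Rbraid, ← mul_assoc, ← mul_assoc, hR, smul_mul_assoc,
      smul_mul_assoc, ← mul_assoc]
  have e4 : P * T.K (j + 1) * T.R j * T.R (j + 1) = P * T.K (j + 1) * T.K j := by
    rw [mul_assoc P, mul_assoc P, ← T.K21, mul_assoc]
  have e0 : ∀ x, x * T.Ri j = x * T.R j - (q - q⁻¹) • x + (q - q⁻¹) • (x * T.K j) := fun x => by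
    rw [T.Ri_eq]; simp only [mul_add, mul_sub, mul_smul_comm, mul_one]
  have e5 : P * T.R (j + 1) * T.K j * T.R (j + 1) = (-q) • (P * T.K (j + 1) * T.R j -
      (q - q⁻¹) • (P * T.K (j + 1)) + (q - q⁻¹) • (P * T.K (j + 1) * T.K j)) := by
    rw [← e0, ← smul_mul_assoc, ← smul_mul_assoc, ← hRi]
    exact tl fun x => by
      simp only [mul_assoc, ra2 (T.R2K1 j), ra2 (T.K1R2 j), ra3 (T.K212 j)]
  have e6 : P * T.K (j + 1) * T.K j * T.R (j + 1) = (P * T.K (j + 1) * T.R j -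
      (q - q⁻¹) • (P * T.K (j + 1)) + (q - q⁻¹) • (P * T.K (j + 1) * T.K j)) := by
    rw [← e0]
    exact tl fun x => by
      simp only [mul_assoc, ra2 (T.K1R2 j), ra3 (T.K212 j)]
  have e7 : P * T.R (j + 1) * T.K j = (-q) • (P * T.K (j + 1) * T.K j) := by
    rw [← smul_mul_assoc, ← smul_mul_assoc, ← hRi]
    exact tl fun x => by simp only [mul_assoc, ra2 (T.R2K1 j)]
  simp only [sg, add_mul, mul_add, one_mul, mul_one, smul_mul_assoc, mul_smul_comm, hR,
    hK, e1, e2, e3, e4, e5, e6, e7, smul_zero, mul_zero, zero_mul]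
  have s4 := congrArg (q * ·) s3
  simp only [mul_zero] at s4
  linear_combination (norm := module) s1 • P + (s1 * q) • (P * T.R (j + 1)) - h3 • (P * T.R (j + 1)) +
    (al q n * q⁻¹ * h3) • (P * T.R (j + 1)) +
    s2 • (P * T.K (j + 1)) + s3 • (P * T.K (j + 1) * T.R j) + s4 • (P * T.K (j + 1) * T.K j) -
    (be q μ (n + 1) * al q n * h3) • (P * T.K (j + 1) * T.K j)

theorem absorb_inv_left {j : ℕ} {P : E} (h : T.R j * P = (-q⁻¹) • P) :
    T.Ri j * P = (-q) • P ∧ T.K j * P = 0 := by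
  have h1 : T.Ri j * P = (-q) • P := by
    refine (T.RR j).lcan ?_
    rw [← mul_assoc, (T.RR j).l, one_mul, mul_smul_comm, h, smul_smul]
    simp [T.q0]
  refine ⟨h1, ?_⟩
  rw [T.Kdef, add_mul, smul_mul_assoc, sub_mul, h1, h, one_mul, ← sub_smul, smul_smul,
    show -q - -q⁻¹ = -(q - q⁻¹) by ring, mul_neg, inv_mul_cancel₀ T.lam]
  module

theorem absorb_inv_right {j : ℕ} {P : E} (h : P * T.R j = (-q⁻¹) • P) :
    P * T.Ri j = (-q) • P ∧ P * T.K j = 0 := by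
  have h1 : P * T.Ri j = (-q) • P := by
    refine (T.RR j).rcan ?_
    rw [mul_assoc, (T.RR j).r, mul_one, smul_mul_assoc, h, smul_smul]
    simp [T.q0]
  refine ⟨h1, ?_⟩
  rw [T.Kdef, mul_add, mul_smul_comm, mul_sub, h1, h, mul_one, ← sub_smul, smul_smul,
    show -q - -q⁻¹ = -(q - q⁻¹) by ring, mul_neg, inv_mul_cancel₀ T.lam]
  module

include T in
theorem cA_norm (m : ℕ) (h : qn q (m + 1) ≠ 0) : cA q m * (1 - q⁻¹ * al q m) = 1 := by
  have h0 := T.q0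
  have h1 := T.lam
  have e : 1 - q⁻¹ * al q m = q ^ (-(m : ℤ)) * qn q (m + 1) := by
    unfold al qn
    rw [show -(2 * (m : ℤ)) = -(m : ℤ) + -(m : ℤ) by ring, zpow_add₀ h0,
      show ((m + 1 : ℕ) : ℤ) = (m : ℤ) + 1 by push_cast; ring, neg_add, zpow_add₀ h0, zpow_add₀ h0,
      _root_.zpow_one, _root_.zpow_neg_one]
    have : q ^ (-(m : ℤ)) * q ^ (m : ℤ) = 1 := by rw [← zpow_add₀ h0]; simp
    have h2 : (q - q⁻¹) * (q - q⁻¹)⁻¹ = 1 := mul_inv_cancel₀ h1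
    rw [div_eq_mul_inv, div_eq_mul_inv]
    linear_combination -h2 - (q * (q - q⁻¹)⁻¹) * this
  rw [e, cA, _root_.zpow_neg, _root_.zpow_natCast]
  field_simp

/-- The genericity conditions up to level `k`. -/
structure Gen (q μ : ℂ) (k : ℕ) : Prop where
  qn_ne : ∀ i, 2 ≤ i → i ≤ k → qn q i ≠ 0
  mu_ne : ∀ i : ℕ, 1 ≤ i → i ≤ k → μ + q ^ (1 - 2 * (i : ℤ)) ≠ 0

theorem As_absorb {k : ℕ} (hg : Gen q μ k) (p n : ℕ) (hn : n ≤ k) :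
    (∀ j, j + 2 ≤ n → T.R (p + j) * T.As p n = (-q⁻¹) • T.As p n ∧
      T.As p n * T.R (p + j) = (-q⁻¹) • T.As p n) ∧ T.As p n * T.As p n = T.As p n := by
  induction n using Nat.strong_induction_on with
  | _ n ih =>
  match n with
  | 0 => exact ⟨fun j hj => by omega, one_mul 1⟩
  | 1 => exact ⟨fun j hj => by omega, one_mul 1⟩
  | n + 2 =>
    obtain ⟨i1, i2⟩ := ih (n + 1) (by omega) (by omega)
    have key : ∀ j, j + 2 ≤ n + 2 → T.R (p + j) * T.As p (n + 2) = (-q⁻¹) • T.As p (n + 2) ∧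
        T.As p (n + 2) * T.R (p + j) = (-q⁻¹) • T.As p (n + 2) := by
      intro j hj
      by_cases hj' : j + 2 ≤ n + 1
      · obtain ⟨h1, h2⟩ := i1 j hj'
        simp only [As, mul_smul_comm, smul_mul_assoc]
        rw [mul_assoc _ _ (T.R _), h2, mul_assoc (T.As p (n + 1)), ← mul_assoc (T.R (p + j)), h1]
        simp only [mul_smul_comm, smul_mul_assoc, mul_assoc]
        exact ⟨smul_comm _ _ _, smul_comm _ _ _⟩
      · obtain rfl : j = n := by omega
        match j with
        | 0 =>
          have hm := hg.mu_ne 1 le_rfl (by omega)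
          norm_num at hm
          obtain ⟨h1, h2⟩ := T.absorb_one (j := p) hm
          simp only [As, mul_smul_comm, smul_mul_assoc, one_mul, mul_one, add_zero, zero_add, h1, h2]
          exact ⟨smul_comm _ _ _, smul_comm _ _ _⟩
        | n + 1 =>
          obtain ⟨j1, j2⟩ := ih (n + 1) (by omega) (by omega)
          obtain ⟨h1, h2⟩ := i1 n (by omega)
          have hn1 := hg.mu_ne (n + 1) (by omega) (by omega)
          have hn2 := hg.mu_ne (n + 2) (by omega) (by omega)
          have k1 := T.absorb_left hn1 hn2 h1 (T.absorb_inv_left h1).1 (T.absorb_inv_left h1).2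
          have k2 := T.absorb_right hn1 hn2 h2 (T.absorb_inv_right h2).1 (T.absorb_inv_right h2).2
          have hA := T.As_mem p (n + 1)
          have a1 : T.As p (n + 1) * T.As p (n + 2) = T.As p (n + 2) := by
            simp only [As, mul_smul_comm, ← mul_assoc, j2]
          have a2 : T.As p (n + 2) * T.As p (n + 1) = T.As p (n + 2) := by
            simp only [As, smul_mul_assoc, mul_assoc, j2]
          have c1 := T.R_comm (n := p + n + 1) hA
          have c2 := T.sg_comm (n := p + n + 1) (i := n + 2) hA
          have f1 : T.As p (n + 3) = (cA q (n + 2) * cA q (n + 1)) • (T.As p (n + 1) *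
              (T.sg (n + 1) (p + n) * T.sg (n + 2) (p + n + 1) * T.As p (n + 2))) := by
            conv_lhs => rw [As]
            conv_lhs => enter [2, 1, 1]; rw [As]
            simp only [smul_mul_assoc, smul_smul]
            congr 1
            exact tl fun x => by
              simp only [mul_assoc, ← add_assoc, ra2 c2, ra2 a1]
          have f2 : T.As p (n + 3) = (cA q (n + 2) * cA q (n + 1)) • (T.As p (n + 2) *
              T.sg (n + 2) (p + n + 1) * T.sg (n + 1) (p + n) * T.As p (n + 1)) := by
            conv_lhs => rw [As]
            conv_lhs => enter [2, 2]; rw [As]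
            simp only [mul_smul_comm, smul_smul]
            congr 1
            exact tl fun x => by
              simp only [mul_assoc, ← add_assoc, ra2 c2.symm, ra2 a2]
          constructor
          · rw [f1, mul_smul_comm, ← mul_assoc, ← add_assoc, ← c1, mul_assoc, k1, mul_smul_comm,
              smul_comm]
          · rw [f2, smul_mul_assoc, mul_assoc, ← add_assoc, c1, ← mul_assoc, k2, smul_mul_assoc,
              smul_comm]
    refine ⟨key, ?_⟩
    obtain ⟨h1, h2⟩ := key n le_rfl
    have a2 : T.As p (n + 2) * T.As p (n + 1) = T.As p (n + 2) := by
      simp only [As, smul_mul_assoc, mul_assoc, i2]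
    have a3 : T.As p (n + 2) * T.sg (n + 1) (p + n) = (1 - q⁻¹ * al q (n + 1)) • T.As p (n + 2) := by
      rw [sg, mul_add, mul_add, mul_one, mul_smul_comm, mul_smul_comm, (T.absorb_inv_right h2).2, h2]
      module
    conv_lhs => rw [As]
    rw [mul_smul_comm, ← mul_assoc, ← mul_assoc]
    change cA q (n + 1) • (T.As p (n + 2) * _ * _ * _) = _
    rw [a2, a3, smul_mul_assoc, a2, smul_smul, T.cA_norm _ (hg.qn_ne _ (by omega) hn), one_smul]

/-- The product `R a * R (a + 1) * ⋯`. -/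
def Rp (a : ℕ) : ℕ → E
  | 0 => 1
  | m + 1 => Rp a m * T.R (a + m)

/-- The inverse of `Rp`. -/
def Rpi (a : ℕ) : ℕ → E
  | 0 => 1
  | m + 1 => T.Ri (a + m) * Rpi a m

theorem Rp_inv (a m : ℕ) : Inv2 (T.Rp a m) (T.Rpi a m) := by
  induction m with
  | zero => exact ⟨one_mul 1, one_mul 1⟩
  | succ m ih => exact ih.mul (T.RR _)

theorem Rp_mem (a m : ℕ) : T.Rp a m ∈ T.S (a + m + 1) := by
  induction m with
  | zero => exact one_mem _
  | succ m ih => exact mul_mem (T.mono _ ih) (T.R_mem _)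

theorem Rp_head (a m : ℕ) : T.Rp a (m + 1) = T.R a * T.Rp (a + 1) m := by
  induction m with
  | zero => simp [Rp]
  | succ m ih =>
    rw [Rp, ih, Rp, mul_assoc]
    congr 3; omega

theorem Rp_pass {a b m : ℕ} (h : a + m < b) : T.R b * T.Rp a m = T.Rp a m * T.R b :=
  (T.R_comm (T.Rp_mem a m) (by omega)).symm

theorem R_Rp {a j m : ℕ} (h : j + 2 ≤ m) : T.R (a + j + 1) * T.Rp a m = T.Rp a m * T.R (a + j) := by
  induction m with
  | zero => omega
  | succ m ih =>
    by_cases hj : j + 2 ≤ m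
    · have := T.R_comm (n := a + m) (T.R_mem (a + j))
      rw [Rp, ← mul_assoc, ih hj, mul_assoc, this, mul_assoc]
    · obtain rfl : m = j + 1 := by omega
      have h1 := T.Rp_pass (a := a) (b := a + j + 1) (m := j) (by omega)
      exact tl fun x => by
        simp only [Rp, mul_assoc, ← add_assoc, ra2 h1, ra3 (T.Rbraid (a + j)).symm]

theorem Rp_Rp {a i m : ℕ} (h : i ≤ m) :
    T.Rp (a + 1) i * T.Rp a (m + 1) = T.Rp a (m + 1) * T.Rp a i := by
  induction i with
  | zero => simp [Rp]
  | succ i ih =>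
    have h1 := T.R_Rp (a := a) (j := i) (m := m + 1) (by omega)
    rw [Rp, mul_assoc, add_right_comm, h1, ← mul_assoc, ih (by omega), mul_assoc]
    rfl

theorem Rp_As {k : ℕ} (hg : Gen q μ k) {p n a m : ℕ} (hn : n ≤ k) (h1 : p ≤ a)
    (h2 : a + m + 1 ≤ p + n) : T.Rp a m * T.As p n = T.As p n * T.Rp a m := by
  obtain ⟨h, -⟩ := T.As_absorb hg p n hn
  induction m with
  | zero => simp [Rp]
  | succ m ih =>
    obtain ⟨j, hj⟩ := Nat.exists_eq_add_of_le h1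
    obtain ⟨e1, e2⟩ := h (j + m) (by omega)
    rw [Rp, mul_assoc, show a + m = p + (j + m) by omega, e1, mul_smul_comm, ih (by omega),
      ← mul_assoc, ← ih (by omega), mul_assoc, e2, mul_smul_comm]

theorem flip {k : ℕ} (hg : Gen q μ k) (p n : ℕ) (hn : n + 1 ≤ k) :
    (T.Rp (p + 1) n * T.Rp p (n + 1)) *
        (T.As p (n + 1) * T.sg (n + 1) (p + n) * T.As p (n + 1)) =
      T.As (p + 1) (n + 1) * T.sg (n + 1) p * T.As (p + 1) (n + 1) *
        (T.Rp (p + 1) n * T.Rp p (n + 1)) := by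
  have h1 : T.R p * (T.Rp (p + 1) n * T.Rp p (n + 1)) =
      T.Rp (p + 1) n * T.Rp p (n + 1) * T.R (p + n) := by
    rw [T.Rp_Rp le_rfl, ← T.Rp_Rp le_rfl, ← mul_assoc, ← T.Rp_head, T.Rp_Rp le_rfl, mul_assoc]
    rfl
  have h2 : T.As (p + 1) (n + 1) * (T.Rp (p + 1) n * T.Rp p (n + 1)) =
      T.Rp (p + 1) n * T.Rp p (n + 1) * T.As p (n + 1) := by
    rw [← mul_assoc, ← T.Rp_As hg hn (by omega) (by omega), mul_assoc, mul_assoc]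
    congr 1
    refine T.As_inter fun j hj => ?_
    rw [add_right_comm]
    exact T.R_Rp (by omega)
  have h3 := T.sg_inter (i := n + 1) h1
  exact tl fun x => by
    have r : ∀ {a b c d : E}, a * (b * c) = b * c * d → ∀ x,
        a * (b * (c * x)) = b * (c * (d * x)) := fun {a b c d} h x => by
      rw [ra3 ((mul_assoc _ _ _).trans h)]; simp only [mul_assoc]
    simp only [mul_assoc]
    rw [r h2, r h3, r h2]

theorem As_flip {k : ℕ} (hg : Gen q μ k) (p n : ℕ) (hn : n + 2 ≤ k) :
    T.As p (n + 2) = cA q (n + 1) • (T.As (p + 1) (n + 1) * T.sg (n + 1) p * T.As (p + 1) (n + 1)) := by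
  have hI := (T.Rp_inv (p + 1) n).mul (T.Rp_inv p (n + 1))
  refine hI.rcan ?_
  rw [smul_mul_assoc, ← T.flip hg p n (by omega), ← mul_smul_comm]
  change _ = _ * T.As p (n + 2)
  rw [mul_assoc, T.Rp_As hg (p := p) (n := n + 2) hn (by omega) (by omega), ← mul_assoc,
    ← T.Rp_As hg (p := p) (n := n + 2) hn (by omega) (by omega), mul_assoc]

theorem cut_flip {n : ℕ} (hg : Gen q μ (n + 1)) (p : ℕ)
    (h : T.As p (n + 1) * T.sg (n + 1) (p + n) * T.As p (n + 1) = 0) :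
    T.As (p + 1) (n + 1) * T.sg (n + 1) p * T.As (p + 1) (n + 1) = 0 := by
  have hI := (T.Rp_inv (p + 1) n).mul (T.Rp_inv p (n + 1))
  refine hI.rcan ?_
  rw [← T.flip hg p n le_rfl, h, mul_zero, zero_mul]

end Tower
end QMA
end

section
namespace QMA
namespace Tower

variable {E : Type*} [Ring E] [Algebra ℂ E] {q μ : ℂ} (T : Tower E q μ)

/-- The copies of an operator on the first strand, transported along the strands by `F`. -/
def cp (X : E) : ℕ → E
  | 0 => X
  | j + 1 => T.F j * cp X j * T.Fi j

variable {T}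

theorem cp_mem {X : E} (hX : X ∈ T.S 1) (j : ℕ) : T.cp X j ∈ T.S (j + 1) := by
  induction j with
  | zero => exact hX
  | succ j ih => exact mul_mem (mul_mem (T.F_mem j) (T.mono _ ih)) (T.Fi_mem j)

theorem cp_F (X : E) (j : ℕ) : T.cp X (j + 1) * T.F j = T.F j * T.cp X j := by
  rw [cp, mul_assoc, (T.FF j).r, mul_one]

theorem cp_pass {X u : E} (hX : X ∈ T.S 1) {j i : ℕ} (hu : u ∈ T.S (j + 2)) (h : j + 2 ≤ i)
    {u' : E} (h1 : u * (T.F (j + 1) * T.F j) = T.F (j + 1) * T.F j * u')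
    (h2 : ∀ x ∈ T.S (j + 1), x * u' = u' * x) : T.cp X i * u = u * T.cp X i := by
  induction i with
  | zero => omega
  | succ i ih =>
    by_cases hi : j + 2 ≤ i
    · have c1 := T.F_comm (n := i) hu
      have c2 := T.Fi_comm (n := i) hu
      exact tl fun x => by simp only [cp, mul_assoc, ra2 c2.symm, ra2 (ih hi), ra2 c1]
    · obtain rfl : i = j + 1 := by omega
      have c := h2 _ (cp_mem hX j)
      have h3 := (T.FI21 j).conj h1
      have e : T.cp X (j + 1 + 1) = T.F (j + 1) * T.F j * T.cp X j * (T.Fi j * T.Fi (j + 1)) := by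
        simp only [cp, mul_assoc]
      generalize T.F (j + 1) * T.F j = f at h1 h3 e
      generalize T.Fi j * T.Fi (j + 1) = f' at h3 e
      rw [e, mul_assoc, h3, ← mul_assoc, mul_assoc f, c, ← mul_assoc, ← h1]
      simp only [mul_assoc]

theorem cp_R {X : E} (hX : X ∈ T.S 1) {i j : ℕ} (h : j + 2 ≤ i) :
    T.cp X i * T.R j = T.R j * T.cp X i :=
  cp_pass hX (T.R_mem j) h (T.RF21 j) fun _ hx => T.R_comm hx

theorem cp_F_far {X : E} (hX : X ∈ T.S 1) {i j : ℕ} (h : j + 2 ≤ i) :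
    T.cp X i * T.F j = T.F j * T.cp X i :=
  cp_pass hX (T.F_mem j) h (T.FF21 j) fun _ hx => T.F_comm hx

theorem cp_K {X : E} (hX : X ∈ T.S 1) {i j : ℕ} (h : j + 2 ≤ i) :
    T.cp X i * T.K j = T.K j * T.cp X i :=
  cp_pass hX (T.K_mem j) h (T.KF21 j) fun _ hx => T.K_comm hx

theorem cp_two_step {X Y : E} (hX : X ∈ T.S 1) (hY : Y ∈ T.S 1) (j : ℕ) :
    T.cp X (j + 1) * T.cp Y (j + 2) * (T.F j * T.F (j + 1)) =
      T.F j * T.F (j + 1) * (T.cp X j * T.cp Y (j + 1)) := by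
  have h1 := T.F_comm (n := j + 1) (cp_mem hX j)
  have h2 := cp_F_far hY (i := j + 2) (j := j) le_rfl
  exact tl fun x => by
    simp only [mul_assoc, ra2 h2, ra2 (cp_F (T := T) Y (j + 1)), ra2 (cp_F (T := T) X j), ra2 h1]

/-- A quantum matrix on the first strand. -/
structure QM (T : Tower E q μ) (M : E) : Prop where
  mem : M ∈ T.S 1
  rel : T.R 0 * (M * (T.F 0 * M * T.Fi 0)) = M * (T.F 0 * M * T.Fi 0) * T.R 0

variable {M : E} (Q : QM T M)
include Q

theorem QM.rel' (j : ℕ) :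
    T.R j * (T.cp M j * T.cp M (j + 1)) = T.cp M j * T.cp M (j + 1) * T.R j := by
  induction j with
  | zero => exact Q.rel
  | succ j ih =>
    refine (T.FI12 j).rcan ?_
    have h : T.cp M (j + 1) * T.cp M (j + 1 + 1) * _ = _ := cp_two_step Q.mem Q.mem j
    have hR := T.RF12 j
    rw [mul_assoc, h, ← mul_assoc, hR, mul_assoc, ih, ← mul_assoc, ← h, mul_assoc _ _ (T.R j), ← hR, mul_assoc, mul_assoc, mul_assoc]

omit Q in
/-- The product `M_a M_{a+1} ⋯ M_{a+n-1}`. -/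
def Mp (T : Tower E q μ) (M : E) (a : ℕ) : ℕ → E
  | 0 => 1
  | n + 1 => Mp T M a n * T.cp M (a + n)

theorem QM.Mp_mem (a n : ℕ) : T.Mp M a n ∈ T.S (a + n) := by
  induction n with
  | zero => exact one_mem _
  | succ n ih => exact mul_mem (T.mono _ ih) (cp_mem Q.mem _)

omit Q in
theorem Mp_head (a n : ℕ) : T.Mp M a (n + 1) = T.cp M a * T.Mp M (a + 1) n := by
  induction n with
  | zero => simp [Mp]
  | succ n ih =>
    rw [Mp, ih, Mp, mul_assoc]; congr 3; omega

theorem QM.Mp_R {a n j : ℕ} (h1 : a ≤ j) (h2 : j + 2 ≤ a + n) :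
    T.Mp M a n * T.R j = T.R j * T.Mp M a n := by
  induction n with
  | zero => omega
  | succ n ih =>
    by_cases hn : j + 2 ≤ a + n
    · rw [Mp, mul_assoc, cp_R Q.mem hn, ← mul_assoc, ih hn, mul_assoc]
    · obtain ⟨m, rfl⟩ : ∃ m, n = m + 1 := ⟨n - 1, by omega⟩
      obtain rfl : j = a + m := by omega
      have h := Q.rel' (a + m)
      have h' := T.R_comm (n := a + m) (Q.Mp_mem a m)
      rw [Mp, Mp, mul_assoc (T.Mp M a m), mul_assoc, ← add_assoc, ← h, ← mul_assoc, h', mul_assoc]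

theorem QM.Mp_K {a n j : ℕ} (h1 : a ≤ j) (h2 : j + 2 ≤ a + n) :
    T.Mp M a n * T.K j = T.K j * T.Mp M a n :=
  (T.K_inter (Q.Mp_R h1 h2).symm).symm

theorem QM.Mp_As {a n p m : ℕ} (h1 : a ≤ p) (h2 : p + m ≤ a + n) :
    T.Mp M a n * T.As p m = T.As p m * T.Mp M a n :=
  (T.As_inter fun j hj => (Q.Mp_R (by omega) (by omega)).symm).symm

omit Q in
theorem cp_Fp {X : E} (hX : X ∈ T.S 1) {a j m : ℕ} (h : j + 1 ≤ m) :
    T.cp X (a + j + 1) * T.Fp a m = T.Fp a m * T.cp X (a + j) := by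
  have far : ∀ i ≤ j, T.cp X (a + j + 1) * T.Fp a i = T.Fp a i * T.cp X (a + j + 1) := by
    intro i hi
    induction i with
    | zero => simp [Fp]
    | succ i ih =>
      rw [Fp, ← mul_assoc, ih (by omega), mul_assoc, cp_F_far hX (by omega), mul_assoc]
  induction m with
  | zero => omega
  | succ m ih =>
    by_cases hm : j + 1 ≤ m
    · have := T.F_comm (n := a + m) (cp_mem hX (a + j))
      rw [Fp, ← mul_assoc, ih hm, mul_assoc, this, mul_assoc]
    · obtain rfl : m = j := by omega
      rw [Fp, ← mul_assoc, far _ le_rfl, mul_assoc, cp_F, mul_assoc]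

omit Q in
theorem R_Fp {a j m : ℕ} (h : j + 2 ≤ m) : T.R (a + j + 1) * T.Fp a m = T.Fp a m * T.R (a + j) := by
  induction m with
  | zero => omega
  | succ m ih =>
    by_cases hj : j + 2 ≤ m
    · have := T.F_comm (n := a + m) (T.R_mem (a + j))
      rw [Fp, ← mul_assoc, ih hj, mul_assoc, this, mul_assoc]
    · obtain rfl : m = j + 1 := by omega
      have h1 := (T.R_comm (n := a + j + 1) (T.Fp_mem a j)).symm
      exact tl fun x => by
        simp only [Fp, mul_assoc, ← add_assoc, ra2 h1, ra3 (T.FFR (a + j))]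

theorem QM.Mp_Fp {a m : ℕ} : T.Mp M (a + 1) m * T.Fp a m = T.Fp a m * T.Mp M a m := by
  have : ∀ i ≤ m, T.Mp M (a + 1) i * T.Fp a m = T.Fp a m * T.Mp M a i := by
    intro i hi
    induction i with
    | zero => simp [Mp]
    | succ i ih =>
      rw [Mp, mul_assoc, add_right_comm, cp_Fp Q.mem (by omega), ← mul_assoc, ih (by omega), mul_assoc]
      rfl
  exact this m le_rfl

omit Q in
theorem As_Fp {a m : ℕ} : T.As (a + 1) m * T.Fp a m = T.Fp a m * T.As a m :=
  T.As_inter fun j hj => by rw [add_right_comm]; exact R_Fp hj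

omit Q in
theorem Fp_head (a m : ℕ) : T.Fp a (m + 1) = T.F a * T.Fp (a + 1) m := by
  induction m with
  | zero => simp [Fp]
  | succ m ih => rw [Fp, ih, Fp, mul_assoc]; congr 3; omega

omit Q in
theorem Fpi_head (a m : ℕ) : T.Fpi a (m + 1) = T.Fpi (a + 1) m * T.Fi a := by
  induction m with
  | zero => simp [Fpi]
  | succ m ih => rw [Fpi, ih, Fpi, ← mul_assoc]; congr 3; omega

omit Q in
/-- The wedge powers with all but the first strand traced out. -/
noncomputable def We (T : Tower E q μ) (M : E) (i : ℕ) : E :=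
  T.mtr 1 i (T.Mp M 0 (i + 1) * T.As 0 (i + 1))

theorem QM.We_arg_mem (i : ℕ) : T.Mp M 0 (i + 1) * T.As 0 (i + 1) ∈ T.S (1 + i) :=
  mul_mem (T.sm (Q.Mp_mem 0 (i + 1))) (T.sm (T.As_mem 0 (i + 1)))

theorem QM.We_mem (i : ℕ) : T.We M i ∈ T.S 1 := T.mtr_mem (Q.We_arg_mem i)

theorem QM.We_cp (p i : ℕ) : T.mtr (p + 1) i (T.Mp M p (i + 1) * T.As p (i + 1)) =
    T.cp (T.We M i) p := by
  induction p with
  | zero => simp only [zero_add]; rfl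
  | succ p ih =>
    have hm : T.Mp M p (i + 1) * T.As p (i + 1) ∈ T.S (p + 1 + i) :=
      mul_mem (T.sm (Q.Mp_mem p (i + 1))) (T.sm (T.As_mem p (i + 1)))
    have h1 : T.Mp M (p + 1) (i + 1) * T.As (p + 1) (i + 1) =
        T.F p * (T.Fp (p + 1) i * (T.Mp M p (i + 1) * T.As p (i + 1)) * T.Fpi (p + 1) i) * T.Fi p := by
      refine (T.Fp_inv p (i + 1)).rcan ?_
      rw [mul_assoc, As_Fp, ← mul_assoc, Q.Mp_Fp]
      conv_rhs => rw [mul_assoc, mul_assoc, mul_assoc, ← mul_assoc (T.Fpi _ _), ← Fpi_head,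
        (T.Fp_inv _ _).r, mul_one, ← mul_assoc, ← Fp_head]
      rw [mul_assoc]
    have h2 : T.Fp (p + 1) i * (T.Mp M p (i + 1) * T.As p (i + 1)) * T.Fpi (p + 1) i ∈
        T.S (p + 2 + i) :=
      mul_mem (mul_mem (T.sm (T.Fp_mem _ _)) (T.sm hm)) (T.sm (T.Fpi_mem _ _))
    rw [h1, T.mtr_mul_right (T.Fi_mem p) (mul_mem (T.sm (T.F_mem p)) h2),
      T.mtr_mul_left (T.F_mem p) h2, T.mtr_shift hm, ih]
    rfl

theorem QM.cy {i : ℕ} {B : E} (hB : T.Cyc 1 (i + 2) B)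
    (hBM : T.Mp M 1 (i + 2) * B = B * T.Mp M 1 (i + 2)) (hBm : B ∈ T.S 3) :
    T.tr 1 (T.tr 2 (T.cp M 1 * T.cp (T.We M i) 2 * B * T.K 0)) =
      T.tr 1 (T.tr 2 (T.cp M 1 * T.cp (T.We M i) 2 * T.K 0 * B)) := by
  have hA := T.As_mem 2 (i + 1)
  have hMm := Q.Mp_mem 1 (i + 2)
  have hZ : T.Mp M 2 (i + 1) * T.As 2 (i + 1) ∈ T.S (2 + 1 + i) :=
    mul_mem (T.sm (Q.Mp_mem 2 (i + 1))) (T.sm hA)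
  have red : ∀ C ∈ T.S 3, T.tr 1 (T.tr 2 (T.cp M 1 * T.cp (T.We M i) 2 * C)) =
      T.mtr 1 (i + 2) (T.Mp M 1 (i + 2) * (T.As 2 (i + 1) * C)) := by
    intro C hC
    have h1 : T.cp M 1 ∈ T.S 3 := T.sm (cp_mem Q.mem 1)
    have e : T.Mp M 1 (i + 2) = T.cp M 1 * T.Mp M 2 (i + 1) := Mp_head 1 (i + 1)
    rw [← Q.We_cp 2 i, mul_assoc, ← T.mtr_mul_right hC hZ, ← T.mtr_mul_left h1
      (mul_mem hZ (T.sm hC)), T.mtr_bot, T.mtr_bot, e]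
    simp only [mul_assoc]
  have hK0 : T.K 0 ∈ T.S 3 := T.sm (T.K_mem 0)
  have c1 : T.As 2 (i + 1) * T.K 0 = T.K 0 * T.As 2 (i + 1) := by
    refine T.As_inter fun j hj => (T.R_comm (T.K_mem 0)).symm
  have hAc : T.Cyc 1 (i + 2) (T.As 2 (i + 1)) := T.As_cyc (by omega) (by omega)
  have hAM := Q.Mp_As (a := 1) (n := i + 2) (p := 2) (m := i + 1) (by omega) (by omega)
  rw [mul_assoc, red _ (mul_mem hBm hK0), mul_assoc _ (T.K 0), red _ (mul_mem hK0 hBm)]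
  rw [← mul_assoc, hAM, mul_assoc, hAc.eq _ (mul_mem hMm (mul_mem hB.mem (T.sm hK0)))]
  rw [mul_assoc, mul_assoc, ← c1, ← mul_assoc, hBM, mul_assoc,
    hB.eq _ (mul_mem hMm (mul_mem hAc.mem (T.sm hK0)))]
  simp only [mul_assoc]

end Tower
end QMA
end

section
namespace QMA
namespace Tower

variable {E : Type*} [Ring E] [Algebra ℂ E] {q μ : ℂ} {T : Tower E q μ}

/-! ### The operators `G` and their inverses -/

variable (T) in
theorem exists_G (n : ℕ) : ∃ G ∈ T.S (n + 1),
    T.K (n + 1) * (T.Fi n * T.Fi (n + 1)) * T.K (n + 1) = G * T.K (n + 1) := by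
  obtain ⟨y, hy, e⟩ := T.resL (n + 1) (T.Fi (n + 1)) (T.Fi_mem _)
  have hm : T.Fi n * y ∈ T.S (n + 2) := mul_mem (T.Fi_mem n) hy
  refine ⟨μ⁻¹ • T.tr (n + 1) (T.Fi n * y), Subalgebra.smul_mem _ (T.tr_mem _ _) _, ?_⟩
  rw [smul_mul_assoc, ← T.tr_spec hm, mul_assoc, mul_assoc, e, ← mul_assoc, ← mul_assoc,
    mul_assoc (T.K _)]

variable (T) in
theorem exists_H (n : ℕ) : ∃ H ∈ T.S (n + 1),
    T.K (n + 1) * (T.F (n + 1) * T.F n) * T.K (n + 1) = H * T.K (n + 1) := by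
  obtain ⟨y, hy, e⟩ := T.resR (n + 1) (T.F (n + 1)) (T.F_mem _)
  have hm : y * T.F n ∈ T.S (n + 2) := mul_mem hy (T.F_mem n)
  refine ⟨μ⁻¹ • T.tr (n + 1) (y * T.F n), Subalgebra.smul_mem _ (T.tr_mem _ _) _, ?_⟩
  rw [smul_mul_assoc, ← T.tr_spec hm, ← mul_assoc, e, mul_assoc (T.K _)]

variable (T) in
/-- The operator `G` on strand `n`. -/
noncomputable def G (n : ℕ) : E := (T.exists_G n).choose

variable (T) in
/-- The inverse of `G n`. -/
noncomputable def H (n : ℕ) : E := (T.exists_H n).choose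

theorem G_mem (n : ℕ) : T.G n ∈ T.S (n + 1) := (T.exists_G n).choose_spec.1

theorem H_mem (n : ℕ) : T.H n ∈ T.S (n + 1) := (T.exists_H n).choose_spec.1

theorem G_spec (n : ℕ) : T.K (n + 1) * (T.Fi n * T.Fi (n + 1)) * T.K (n + 1) =
    T.G n * T.K (n + 1) := (T.exists_G n).choose_spec.2

theorem H_spec (n : ℕ) : T.K (n + 1) * (T.F (n + 1) * T.F n) * T.K (n + 1) =
    T.H n * T.K (n + 1) := (T.exists_H n).choose_spec.2

theorem G_K (n : ℕ) : T.G n * T.K (n + 1) = T.Fi n * T.Fi (n + 1) * T.K n * T.K (n + 1) := by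
  rw [← G_spec, T.KFi12]

theorem H_K (n : ℕ) : T.H n * T.K (n + 1) = T.K (n + 1) * T.K n * (T.F (n + 1) * T.F n) := by
  rw [← H_spec, mul_assoc, ← T.KF21, mul_assoc]

theorem G_K_comm (n : ℕ) : T.G n * T.K (n + 1) = T.K (n + 1) * T.G n := T.K_comm (G_mem n)

theorem GH (n : ℕ) : Inv2 (T.G n) (T.H n) := by
  constructor
  · refine T.cancel_eq (n := n + 1) (mul_mem (G_mem n) (H_mem n)) (one_mem _) ?_
    rw [mul_assoc, H_K]
    refine tl fun x => ?_
    simp only [mul_assoc, ra2 (G_K n),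
      ra3 (T.K121 n), ra3 ((mul_assoc _ _ _).trans (T.KF21 n)), ra2 (T.FF _).r, one_mul]
  · refine T.cancel_eq (n := n + 1) (mul_mem (H_mem n) (G_mem n)) (one_mem _) ?_
    rw [mul_assoc, ← G_spec]
    refine tl fun x => ?_
    simp only [mul_assoc, ra2 (H_K n), ra2 (T.FF _).l, one_mul, ra3 (T.K212 n)]

theorem K12_eq (n : ℕ) : T.K n * T.K (n + 1) = T.F (n + 1) * T.F n * (T.G n * T.K (n + 1)) := by
  rw [G_K, ← mul_assoc, ← mul_assoc, (T.FI21 n).l, one_mul]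

theorem G_pass {n : ℕ} {x : E} (hx : x ∈ T.S n) : T.G n * x = x * T.G n := by
  refine (T.cancel_eq (n := n + 1) (mul_mem (T.sm hx) (G_mem n)) (mul_mem (G_mem n) (T.sm hx))
    ?_).symm
  have h1 := T.K_comm (n := n + 1) hx
  have h2 := T.K_comm (n := n) hx
  have h3 := T.Fi_comm (n := n) hx
  have h4 := T.Fi_comm (n := n + 1) hx
  refine tl fun y => ?_
  simp only [mul_assoc, ra2 h1, ra2 (G_K n)]
  simp only [mul_assoc, ra2 h1.symm, ra2 h2.symm, ra2 h3.symm, ra2 h4.symm]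

theorem H_pass {n : ℕ} {x : E} (hx : x ∈ T.S n) : T.H n * x = x * T.H n :=
  (GH n).conj (G_pass hx).symm |>.trans rfl

variable (T) in
/-- Conjugation by `G` on the first strand. -/
noncomputable def ad (X : E) : E := T.H 0 * X * T.G 0

theorem ad_mem {X : E} (hX : X ∈ T.S 1) : T.ad X ∈ T.S 1 :=
  mul_mem (mul_mem (H_mem 0) hX) (G_mem 0)

theorem G_ad (X : E) : T.G 0 * T.ad X = X * T.G 0 := by
  rw [ad, ← mul_assoc, ← mul_assoc, (GH 0).l, one_mul]

theorem cp_KK {X : E} (hX : X ∈ T.S 1) : T.cp X 2 * (T.K 0 * T.K 1) = T.K 0 * T.K 1 * T.ad X := by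
  have h := T.K_comm (n := 1) (ad_mem hX)
  rw [mul_assoc, ← h]
  refine tl fun y => ?_
  have e : T.cp X 2 = T.F 1 * (T.F 0 * X * T.Fi 0) * T.Fi 1 := rfl
  simp only [e, mul_assoc, ra2 (T.K12_eq 0), ra2 (T.FF _).r, one_mul, ra2 h]
  simp only [mul_assoc, ra2 h.symm, ra2 (G_ad X)]

theorem F_mid (n : ℕ) : T.F n * T.F (n + 1) * T.F (n + 2) * (T.Fi n * T.Fi (n + 1)) =
    T.Fi (n + 1) * T.Fi (n + 2) * (T.F n * T.F (n + 1) * T.F (n + 2)) := by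
  refine ((T.FI21 (n + 1)).inter (T.FI21 n) ?_).symm
  have h := T.F_comm (n := n + 2) (T.F_mem n)
  refine tl fun x => ?_
  have h2 := ra3 ((mul_assoc _ _ _).trans (T.FF12 n))
  have h3 : ∀ x, T.F (n + 2) * (T.F (n + 1) * (T.F (n + 2) * x)) =
    T.F (n + 1) * (T.F (n + 2) * (T.F (n + 1) * x)) := fun x => by
      simpa only [mul_assoc] using congrArg (· * x) (T.FF12 (n + 1))
  have h2 : ∀ x, T.F (n + 1) * (T.F n * (T.F (n + 1) * x)) =
    T.F n * (T.F (n + 1) * (T.F n * x)) := fun x => by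
      simpa only [mul_assoc] using congrArg (· * x) (T.FF12 n)
  simp only [mul_assoc]
  rw [h2, ra2 h, mul_assoc, ra2 h.symm, mul_assoc, h3]

theorem G_K' (n : ℕ) : T.G n * T.K (n + 2) =
    T.F (n + 1) * T.F (n + 2) * T.G n * T.K (n + 1) * (T.Fi (n + 2) * T.Fi (n + 1)) := by
  refine (T.FI12 (n + 1)).rcan ?_
  have h1 := T.F_comm (n := n + 1) (G_mem (T := T) n)
  have h2 := T.F_comm (n := n + 2) (G_mem (T := T) n)
  have h3 : T.K (n + 2) * (T.F (n + 1) * T.F (n + 2)) = _ := T.KF12 (n + 1)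
  refine tl fun x => ?_
  simp only [mul_assoc, ra2 (T.FF _).r, one_mul, ra3 ((mul_assoc _ _ _).trans h3), ra2 h1, ra2 h2]

theorem F_G (n : ℕ) : T.F n * T.G n = T.G (n + 1) * T.F n := by
  refine T.cancel_eq (n := n + 2) (mul_mem (T.F_mem n) (T.sm (G_mem n)))
    (mul_mem (G_mem _) (T.F_mem n)) ?_
  have h3 : T.K n * T.F (n + 2) = _ := T.F_comm (T.K_mem n)
  have h4 : T.F n * T.K (n + 2) = _ := T.K_comm (T.F_mem n)
  have h5 : T.K (n + 2) * (T.F (n + 1) * T.F (n + 2)) = _ := T.KF12 (n + 1)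
  have h6 : T.G (n + 1) * T.K (n + 2) = _ := T.G_K (n + 1)
  calc T.F n * T.G n * T.K (n + 2)
      = T.F n * T.F (n + 1) * T.F (n + 2) * (T.Fi n * T.Fi (n + 1)) * (T.K n * T.K (n + 1) *
          (T.Fi (n + 2) * T.Fi (n + 1))) := by
        rw [mul_assoc, G_K']; exact tl fun x => by simp only [mul_assoc, ra2 (T.G_K n)]
    _ = T.Fi (n + 1) * T.Fi (n + 2) * (T.F n * T.F (n + 1) * (T.K n * T.F (n + 2)) * T.K (n + 1) *
          (T.Fi (n + 2) * T.Fi (n + 1))) := by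
        rw [F_mid, h3]; simp only [mul_assoc]
    _ = T.Fi (n + 1) * T.Fi (n + 2) * (T.K (n + 1) * T.F n * (T.F (n + 1) * T.F (n + 2) *
          T.K (n + 1)) * (T.Fi (n + 2) * T.Fi (n + 1))) := by
        exact tl fun x => by simp only [mul_assoc, ra3 ((mul_assoc _ _ _).trans (T.KF12 n))]
    _ = T.Fi (n + 1) * T.Fi (n + 2) * T.K (n + 1) * (T.F n * T.K (n + 2)) := by
        rw [← h5]; exact tl fun x => by simp only [mul_assoc, ra2 (T.FF _).l, one_mul]
    _ = T.G (n + 1) * T.F n * T.K (n + 2) := by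
        rw [mul_assoc _ (T.F n), h4, ← mul_assoc, ← mul_assoc, h6]

theorem F_G' (n : ℕ) : T.F n * T.G (n + 1) = T.G n * T.F n := by
  refine (T.cancel_eq (n := n + 2) (mul_mem (T.sm (G_mem n)) (T.F_mem n))
    (mul_mem (T.F_mem n) (G_mem _)) ?_).symm
  have h4 : T.F n * T.K (n + 2) = _ := T.K_comm (T.F_mem n)
  have h5 : T.K (n + 1) * (T.F (n + 2) * T.F (n + 1)) = _ := T.KF21 (n + 1)
  have h6 : T.G (n + 1) * T.K (n + 2) = _ := T.G_K (n + 1)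
  have h7 : T.K n * T.F (n + 2) = _ := T.F_comm (T.K_mem n)
  have h1 := T.Fi_comm (n := n + 1) (G_mem (T := T) n)
  have h2 := T.Fi_comm (n := n + 2) (G_mem (T := T) n)
  have h8 := T.F_comm (n := n + 2) (T.F_mem n)
  have h9 : T.Fi n * T.Fi (n + 1) * (T.F (n + 2) * T.F (n + 1) * T.F n) =
      T.F (n + 2) * T.F (n + 1) * T.F n * (T.Fi (n + 1) * T.Fi (n + 2)) := by
    refine (T.FI21 n).inter (T.FI21 (n + 1)) ?_
    have h3 : ∀ x, T.F (n + 1) * (T.F (n + 2) * (T.F (n + 1) * x)) =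
        T.F (n + 2) * (T.F (n + 1) * (T.F (n + 2) * x)) := fun x => by
      simpa only [mul_assoc] using congrArg (· * x) (T.FF21 (n + 1))
    have h2 : ∀ x, T.F n * (T.F (n + 1) * (T.F n * x)) =
        T.F (n + 1) * (T.F n * (T.F (n + 1) * x)) := fun x => by
      simpa only [mul_assoc] using congrArg (· * x) (T.FF21 n)
    refine tl fun x => ?_
    simp only [mul_assoc]
    rw [ra2 h8, mul_assoc, h2, h3, ra2 h8.symm, mul_assoc]
  calc T.G n * T.F n * T.K (n + 2)
      = T.G n * (T.Fi (n + 1) * T.Fi (n + 2)) * T.K (n + 1) *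
        (T.F (n + 2) * T.F (n + 1) * T.F n) := by
        have : T.K (n + 2) = T.Fi (n + 1) * T.Fi (n + 2) * (T.K (n + 1) *
          (T.F (n + 2) * T.F (n + 1))) := by
          rw [h5, ← mul_assoc]
          exact tl fun x => by simp only [mul_assoc, ra2 (T.FF _).r, one_mul]
        rw [mul_assoc, h4, this]; simp only [mul_assoc]
    _ = T.Fi (n + 1) * T.Fi (n + 2) * (T.Fi n * T.Fi (n + 1) * (T.K n * (T.K (n + 1) *
        (T.F (n + 2) * T.F (n + 1))) * T.F n)) := by
        exact tl fun x => by simp only [mul_assoc, ra2 h1, ra2 h2, ra2 (T.G_K n)]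
    _ = T.Fi (n + 1) * T.Fi (n + 2) * (T.Fi n * T.Fi (n + 1) * (T.F (n + 2) * (T.K n *
        (T.F (n + 1) * T.F n)) * T.K (n + 2))) := by
        rw [h5]
        refine tl fun x => ?_
        simp only [mul_assoc, ra2 h7, ra2 h4]
    _ = T.Fi (n + 1) * T.Fi (n + 2) * (T.Fi n * T.Fi (n + 1) * (T.F (n + 2) * T.F (n + 1) * T.F n) *
          (T.K (n + 1) * T.K (n + 2))) := by
        rw [T.KF21]; simp only [mul_assoc]
    _ = T.F n * T.G (n + 1) * T.K (n + 2) := by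
        rw [h9, mul_assoc (T.F n), h6]
        exact tl fun x => by simp only [mul_assoc, ra2 (T.FF _).r, one_mul]

theorem R_G (n : ℕ) : T.R n * (T.G n * T.G (n + 1)) = T.G n * T.G (n + 1) * T.R n := by
  have hG := G_mem (T := T) n
  refine T.cancel_eq (n := n + 2) (mul_mem (T.R_mem n) (mul_mem (T.sm hG) (G_mem _)))
    (mul_mem (mul_mem (T.sm hG) (G_mem _)) (T.R_mem n)) ?_
  have h4 : T.R n * T.K (n + 2) = _ := T.K_comm (T.R_mem n)
  have h6 : T.G (n + 1) * T.K (n + 2) = _ := T.G_K (n + 1)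
  have h1 := T.Fi_comm (n := n + 1) hG
  have h2 := T.Fi_comm (n := n + 2) hG
  have h3 := T.Fi_comm (n := n + 2) (T.Fi_mem n)
  have h5 : T.R (n + 1) * (T.Fi (n + 2) * T.Fi (n + 1)) = _ := T.RFi21 (n + 1)
  have h7 : T.K n * T.R (n + 2) = _ := T.R_comm (T.K_mem n)
  have h8 : T.Ri (n + 1) * T.K (n + 2) = _ := T.Ri1K2 (n + 1)
  have e : T.G n * T.G (n + 1) * T.K (n + 2) =
      T.Fi (n + 1) * T.Fi n * (T.Fi (n + 2) * T.Fi (n + 1)) * (T.K n * T.K (n + 1) * T.K (n + 2)) := by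
    rw [mul_assoc, h6]
    refine tl fun x => ?_
    simp only [mul_assoc, ra2 h1, ra2 h2, ra2 (T.G_K n)]
    rw [ra2 h3, mul_assoc]
  rw [mul_assoc (T.R n), e, mul_assoc (_ * _) (T.R n), h4, ← mul_assoc _ (T.K (n + 2)), e]
  refine tl fun x => ?_
  simp only [mul_assoc, ra3 ((mul_assoc _ _ _).trans h5), ra3 ((mul_assoc _ _ _).trans (T.RFi21 n))]
  rw [ra2 h7.symm, ra2 h4.symm, mul_assoc, mul_assoc]
  have h9 : T.K n * T.K (n + 1) * T.R n = _ := (T.K1Ri2 n).symm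
  rw [ra3 h9]
  simp only [mul_assoc, ra2 h8]

theorem GGH (n : ℕ) : Inv2 (T.G n * T.G (n + 1)) (T.H (n + 1) * T.H n) := (GH n).mul (GH (n + 1))

theorem K_G (n : ℕ) : T.K n * (T.G n * T.G (n + 1)) = T.G n * T.G (n + 1) * T.K n :=
  T.K_inter (R_G n)

theorem H_K' (n : ℕ) : T.H (n + 1) * T.H n * T.K n = T.K n * (T.H (n + 1) * T.H n) :=
  (GGH n).conj (K_G n)

theorem H_R (n : ℕ) : T.H (n + 1) * T.H n * T.R n = T.R n * (T.H (n + 1) * T.H n) :=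
  (GGH n).conj (R_G n)

theorem tr_ad {n : ℕ} {Z : E} (hZ : Z ∈ T.S (n + 1)) : T.tr n (T.H n * Z * T.G n) = T.tr n Z := by
  have hm : T.H n * Z * T.G n ∈ T.S (n + 1) := mul_mem (mul_mem (H_mem n) hZ) (G_mem n)
  refine T.tr_eq hm (T.tr_mem _ _) ?_
  have e : T.H n * Z * T.G n = T.H (n + 1) * T.H n * Z * (T.G n * T.G (n + 1)) := by
    have h : T.H (n + 1) * T.H n * Z * (T.G n * T.G (n + 1)) =
      T.H (n + 1) * (T.H n * Z * T.G n) * T.G (n + 1) := by simp only [mul_assoc]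
    rw [h, H_pass hm, mul_assoc _ _ (T.G (n + 1)), (GH (n + 1)).r, mul_one]
  rw [e]
  have h := H_K' (T := T) n
  have h' := K_G (T := T) n
  have h1 := T.tr_spec hZ
  have h2 : T.G n * T.G (n + 1) * T.tr n Z = T.tr n Z * (T.G n * T.G (n + 1)) := by
    rw [mul_assoc, G_pass (T.sm (T.tr_mem n Z)), ← mul_assoc, G_pass (T.tr_mem n Z), mul_assoc]
  have h3 := (GGH (T := T) n).r
  generalize T.G n * T.G (n + 1) = g at h h' h2 h3 ⊢
  generalize T.H (n + 1) * T.H n = gi at h h' h2 h3 ⊢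
  calc T.K n * (gi * Z * g) * T.K n
      = gi * (T.K n * Z * T.K n) * g := by
        rw [← mul_assoc, ← mul_assoc, ← h, mul_assoc _ g, ← h']
        simp only [mul_assoc]
    _ = μ⁻¹ • (gi * (g * (T.tr n Z * T.K n))) := by
        rw [h1, mul_smul_comm, smul_mul_assoc, mul_assoc, mul_assoc (T.tr n Z), h',
          ← mul_assoc (T.tr n Z), ← h2, mul_assoc _ _ (T.K n)]
    _ = μ⁻¹ • (T.tr n Z * T.K n) := by rw [← mul_assoc, h3, one_mul]

end Tower
end QMA
end

section
namespace QMA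
namespace Tower

variable {E : Type*} [Ring E] [Algebra ℂ E] {q μ : ℂ} {T : Tower E q μ}

/-! ### Twisted one-strand maps -/

variable (T) in
/-- `φ` on the first strand. -/
noncomputable def ph (X : E) : E := T.tr 1 (T.cp X 1 * T.R 0)

variable (T) in
/-- `ξ` on the first strand. -/
noncomputable def xi (X : E) : E := T.tr 1 (T.cp X 1 * T.K 0)

variable (T) in
/-- `π` on the first strand. -/
noncomputable def pp (X : E) : E := T.tr 1 (T.R 0 * X * T.K 0)

theorem ph_mem (X : E) : T.ph X ∈ T.S 1 := T.tr_mem _ _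

theorem xi_mem (X : E) : T.xi X ∈ T.S 1 := T.tr_mem _ _

theorem pp_mem (X : E) : T.pp X ∈ T.S 1 := T.tr_mem _ _

theorem cp1 (X : E) : T.cp X 1 = T.F 0 * X * T.Fi 0 := rfl

theorem cp2 (X : E) : T.cp X 2 = T.F 1 * (T.F 0 * X * T.Fi 0) * T.Fi 1 := rfl

theorem cp1_mem {X : E} (hX : X ∈ T.S 1) : T.cp X 1 ∈ T.S 2 := cp_mem hX 1

theorem cp_zero_strand {a : E} (ha : a ∈ T.S 0) (j : ℕ) : T.cp a j = a := by
  induction j with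
  | zero => rfl
  | succ j ih => rw [cp, ih, ← T.F_comm (n := j) ha, mul_assoc, (T.FF j).l, mul_one]

theorem cp_mul (X Y : E) (j : ℕ) : T.cp (X * Y) j = T.cp X j * T.cp Y j := by
  induction j with
  | zero => rfl
  | succ j ih =>
    simp only [cp, ih]
    exact tl fun x => by simp only [mul_assoc, ra2 (T.FF j).r, one_mul]

theorem cp_add (X Y : E) (j : ℕ) : T.cp (X + Y) j = T.cp X j + T.cp Y j := by
  induction j with
  | zero => rfl
  | succ j ih => simp only [cp, ih, mul_add, add_mul]

theorem cp_smul (c : ℂ) (X : E) (j : ℕ) : T.cp (c • X) j = c • T.cp X j := by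
  induction j with
  | zero => rfl
  | succ j ih => simp only [cp, ih, mul_smul_comm, smul_mul_assoc]

section linear
variable {X Y : E} (hX : X ∈ T.S 1) (hY : Y ∈ T.S 1)

include hX hY in
theorem ph_add : T.ph (X + Y) = T.ph X + T.ph Y := by
  rw [ph, cp_add, add_mul, T.tr_add (mul_mem (cp1_mem hX) (T.R_mem 0))
    (mul_mem (cp1_mem hY) (T.R_mem 0))]; rfl

include hX hY in
theorem xi_add : T.xi (X + Y) = T.xi X + T.xi Y := by
  rw [xi, cp_add, add_mul, T.tr_add (mul_mem (cp1_mem hX) (T.K_mem 0))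
    (mul_mem (cp1_mem hY) (T.K_mem 0))]; rfl

include hX in
theorem ph_smul (c : ℂ) : T.ph (c • X) = c • T.ph X := by
  rw [ph, cp_smul, smul_mul_assoc, T.tr_smul c (mul_mem (cp1_mem hX) (T.R_mem 0))]; rfl

include hX in
theorem xi_smul (c : ℂ) : T.xi (c • X) = c • T.xi X := by
  rw [xi, cp_smul, smul_mul_assoc, T.tr_smul c (mul_mem (cp1_mem hX) (T.K_mem 0))]; rfl

include hX in
theorem pp_smul (c : ℂ) : T.pp (c • X) = c • T.pp X := by
  rw [pp, mul_smul_comm, smul_mul_assoc,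
    T.tr_smul c (mul_mem (mul_mem (T.R_mem 0) (T.sm hX)) (T.K_mem 0))]; rfl

include hX in
theorem ph_mul_right {a : E} (ha : a ∈ T.S 0) : T.ph (X * a) = T.ph X * a := by
  rw [ph, cp_mul, cp_zero_strand ha, mul_assoc, T.R_comm ha, ← mul_assoc,
    T.tr_mul_right (T.sm ha) (mul_mem (cp1_mem hX) (T.R_mem 0))]; rfl

include hX in
theorem xi_mul_right {a : E} (ha : a ∈ T.S 0) : T.xi (X * a) = T.xi X * a := by
  rw [xi, cp_mul, cp_zero_strand ha, mul_assoc, T.K_comm ha, ← mul_assoc,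
    T.tr_mul_right (T.sm ha) (mul_mem (cp1_mem hX) (T.K_mem 0))]; rfl

include hX in
theorem ph_mul_left {a : E} (ha : a ∈ T.S 0) : T.ph (a * X) = a * T.ph X := by
  rw [ph, cp_mul, cp_zero_strand ha, mul_assoc,
    T.tr_mul_left (T.sm ha) (mul_mem (cp1_mem hX) (T.R_mem 0))]; rfl

include hX in
theorem cup_xi : T.cp X 1 * T.K 0 = μ⁻¹ • (T.xi X * T.K 0) := T.cup (n := 0) (cp1_mem hX)

include hX in
theorem cp_tr {u u' : E} (hu : u ∈ T.S 2) (h : u * (T.Fi 1 * T.Fi 0) = T.Fi 1 * T.Fi 0 * u') :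
    T.cp (T.tr 1 (T.cp X 1 * u)) 1 = T.tr 2 (T.cp X 2 * u') := by
  have hZ := mul_mem (cp1_mem hX) hu
  rw [cp1, ← T.tr_conj hZ, ← T.tr_mul_left (T.F_mem 0) (mul_mem (mul_mem (T.F_mem 1) (T.sm hZ))
    (T.Fi_mem 1)), ← T.tr_mul_right (T.Fi_mem 0) (mul_mem (T.sm (T.F_mem 0))
      (mul_mem (mul_mem (T.F_mem 1) (T.sm hZ)) (T.Fi_mem 1)))]
  congr 1
  have h1 := T.F_comm (n := 1) hX
  have h2 : ∀ x, T.F 0 * (T.F 1 * (T.F 0 * x)) = T.F 1 * (T.F 0 * (T.F 1 * x)) := fun x => by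
    simpa only [mul_assoc] using congrArg (· * x) (T.FF21 0)
  have h3 : ∀ x, T.F 1 * (T.Fi 0 * (T.Fi 1 * x)) = T.Fi 0 * (T.Fi 1 * (T.F 0 * x)) := fun x => by
    simpa only [mul_assoc] using congrArg (· * x) (T.FFi12 0)
  refine tl fun x => ?_
  simp only [cp1, cp2, mul_assoc, ra3 ((mul_assoc _ _ _).trans h), h2, ra2 h1.symm]
  have h4 : ∀ x, T.F 1 * (T.Fi 0 * (T.Fi 1 * (T.Fi 0 * x))) = T.Fi 0 * (T.Fi 1 * x) := fun x => by
    rw [h3, ra2 (T.FF 0).l, one_mul]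
  rw [h4]

include hX in
theorem cp_ph : T.cp (T.ph X) 1 = T.tr 2 (T.cp X 2 * T.R 1) := cp_tr hX (T.R_mem 0) (T.RFi21 0)

include hX in
theorem cp_xi : T.cp (T.xi X) 1 = T.tr 2 (T.cp X 2 * T.K 1) := cp_tr hX (T.K_mem 0) (T.KFi21 0)

theorem cp2_mem {X : E} (hX : X ∈ T.S 1) : T.cp X 2 ∈ T.S 3 := cp_mem hX 2

include hX in
theorem K_cp_ph : T.K 0 * T.cp (T.ph X) 1 = μ • (T.K 0 * T.ad X * T.Ri 0) := by
  have hK : T.K 1 ∈ T.S 3 := T.K_mem 1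
  rw [cp_ph hX, ← T.tr_mul_left (T.K_mem 0) (mul_mem (cp2_mem hX) (T.R_mem 1)), ← mul_assoc,
    ← cp_K hX le_rfl, mul_assoc, T.K1R2, ← mul_assoc, cp_KK hX, mul_assoc, mul_assoc,
    T.tr_mul_left (T.K_mem 0) (mul_mem hK (mul_mem (T.sm (ad_mem hX)) (T.sm (T.Ri_mem 0)))),
    T.tr_mul_right (mul_mem (T.sm (ad_mem hX)) (T.Ri_mem 0)) hK, T.tr_K, smul_mul_assoc, one_mul,
    mul_smul_comm, mul_assoc]

include hX in
theorem K_cp_xi : T.K 0 * T.cp (T.xi X) 1 = μ • (T.K 0 * T.ad X) := by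
  have hK : T.K 1 ∈ T.S 3 := T.K_mem 1
  rw [cp_xi hX, ← T.tr_mul_left (T.K_mem 0) (mul_mem (cp2_mem hX) hK), ← mul_assoc,
    ← cp_K hX le_rfl, mul_assoc, cp_KK hX, mul_assoc,
    T.tr_mul_left (T.K_mem 0) (mul_mem hK (T.sm (ad_mem hX))),
    T.tr_mul_right (T.sm (ad_mem hX)) hK, T.tr_K, smul_mul_assoc, one_mul,
    mul_smul_comm]

include hX in
theorem ph_pp : T.ph (T.pp X) = μ • T.xi X := by
  have e : T.cp (T.pp X) 1 = T.tr 2 (T.R 1 * (T.cp X 1 * T.K 1)) := by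
    have hZ : T.R 0 * X * T.K 0 ∈ T.S 2 := mul_mem (mul_mem (T.R_mem 0) (T.sm hX)) (T.K_mem 0)
    rw [cp1, pp, ← T.tr_conj hZ, ← T.tr_mul_left (T.F_mem 0) (mul_mem (mul_mem (T.F_mem 1)
      (T.sm hZ)) (T.Fi_mem 1)), ← T.tr_mul_right (T.Fi_mem 0) (mul_mem (T.sm (T.F_mem 0))
      (mul_mem (mul_mem (T.F_mem 1) (T.sm hZ)) (T.Fi_mem 1)))]
    congr 1
    have h1 := T.F_comm (n := 1) hX
    have h3 : T.R 1 * (T.F 0 * T.F 1) = T.F 0 * T.F 1 * T.R 0 := T.RF12 0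
    have h4 : ∀ y, T.F 0 * (T.F 1 * (T.R 0 * y)) = T.R 1 * (T.F 0 * (T.F 1 * y)) := fun y => by
      simpa only [mul_assoc] using congrArg (· * y) h3.symm
    refine tl fun x => ?_
    simp only [cp1, mul_assoc, ra3 ((mul_assoc _ _ _).trans (T.KFi21 0)), zero_add]
    rw [h4, ra2 h1.symm, mul_assoc, ra2 (T.FF 1).l, one_mul]
  have hX1 := cp1_mem hX
  have hK : T.K 1 ∈ T.S 3 := T.K_mem 1
  have hR : T.R 1 ∈ T.S 3 := T.R_mem 1
  have hRi : T.Ri 1 ∈ T.S 3 := T.Ri_mem 1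
  have hK0 : T.K 0 ∈ T.S 3 := T.sm (T.K_mem 0)
  have c := T.cyc (n := 1) (Z := T.cp X 1 * T.K 1 * T.K 0 * T.Ri 1)
    (mul_mem (mul_mem (mul_mem (T.sm hX1) hK) hK0) hRi)
  rw [ph, e, ← T.tr_mul_right (T.R_mem 0) (mul_mem hR (mul_mem (T.sm hX1) hK))]
  have e2 : T.R 1 * (T.cp X 1 * T.K 1) * T.R 0 = T.R 1 * (T.cp X 1 * T.K 1 * T.K 0 * T.Ri 1) :=
    tl fun x => by simp only [mul_assoc, ra2 (T.K2R1 0)]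
  rw [e2, c, mul_assoc _ (T.Ri 1), (T.RR 1).r, mul_one, T.tr_mul_right (T.K_mem 0)
    (mul_mem (T.sm hX1) hK), T.tr_mul_left hX1 hK, T.tr_K, mul_smul_comm, smul_mul_assoc, mul_one,
    T.tr_smul μ (mul_mem hX1 (T.K_mem 0))]
  rfl

end linear

end Tower
end QMA
end

section
namespace QMA
namespace Tower

variable {E : Type*} [Ring E] [Algebra ℂ E] {q μ : ℂ} {T : Tower E q μ}

/-! ### The contraction -/

/-- The value of the loop. -/
noncomputable def dl (q μ : ℂ) : ℂ := (q - μ) * (q⁻¹ + μ) / (q - q⁻¹)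

theorem K_sq (n : ℕ) : T.K n * T.K n = (μ⁻¹ * dl q μ) • T.K n := by
  have h0 := T.q0
  have h1 := T.lam
  have h2 := T.mu0
  have e := congrArg (· * T.K n) (T.Kdef n)
  simp only [add_mul, smul_mul_assoc, sub_mul, T.RiK, T.RK, one_mul] at e
  rw [e]
  have : μ⁻¹ * dl q μ = (q - q⁻¹)⁻¹ * (μ⁻¹ - μ) + 1 := by
    unfold dl
    have h3 : q ^ 2 - 1 ≠ 0 := by
      intro h; apply h1; field_simp; linear_combination h
    field_simp; ring
  rw [this]; module

theorem tr_unit (n : ℕ) : T.tr n 1 = dl q μ • 1 :=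
  T.tr_eq (one_mem _) (Subalgebra.smul_mem _ (one_mem _) _) (by
    rw [mul_one, K_sq, smul_mul_assoc, one_mul, smul_smul])

/-- The `2`-contraction. -/
noncomputable def gT (T : Tower E q μ) (M : E) : E :=
  (μ * (dl q μ)⁻¹) • T.tr 0 (T.tr 1 (M * T.cp M 1 * T.K 0))

theorem gT_mem (M : E) : T.gT M ∈ T.S 0 := Subalgebra.smul_mem _ (T.tr_mem _ _) _

section contraction
variable {M : E} (Q : QM T M) (hd : dl q μ ≠ 0)

include Q hd in
theorem QM.MMK : M * T.cp M 1 * T.K 0 = (μ⁻¹ * μ⁻¹) • (T.gT M * T.K 0) := by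
  have h0 := T.mu0
  have hM : M ∈ T.S 2 := T.sm Q.mem
  have hK : T.K 0 * (M * T.cp M 1) = M * T.cp M 1 * T.K 0 := T.K_inter Q.rel
  obtain ⟨y, hy, e⟩ := T.resL 0 (M * T.cp M 1) (mul_mem hM (cp1_mem Q.mem))
  have e1 : M * T.cp M 1 * T.K 0 = (dl q μ)⁻¹ • (T.tr 0 y * T.K 0) := by
    have : T.K 0 * (M * T.cp M 1 * T.K 0) = (μ⁻¹ * dl q μ) • (M * T.cp M 1 * T.K 0) := by
      rw [← mul_assoc, hK, mul_assoc, K_sq, mul_smul_comm]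
    rw [e, ← mul_assoc, T.tr_spec hy, ← e] at this
    calc M * T.cp M 1 * T.K 0 = ((dl q μ)⁻¹ * μ) • (μ⁻¹ * dl q μ) • (M * T.cp M 1 * T.K 0) := by
          rw [smul_smul, show (dl q μ)⁻¹ * μ * (μ⁻¹ * dl q μ) = 1 by field_simp, one_smul]
      _ = _ := by
          rw [← this, smul_smul]; congr 1; field_simp
  have hc : T.tr 0 y ∈ T.S 0 := T.tr_mem _ _
  have hg : T.gT M = (μ * μ * (dl q μ)⁻¹) • T.tr 0 y := by
    rw [gT, e1, T.tr_smul _ (mul_mem (T.sm hc) (T.K_mem 0)), T.tr_mul_left (T.sm hc) (T.K_mem 0),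
      T.tr_K, mul_smul_comm, mul_one, smul_smul, T.tr_smul _ (T.sm hc),
      show T.tr 0 (T.tr 0 y) = dl q μ • T.tr 0 y by
        conv_lhs => rw [← mul_one (T.tr 0 y)]
        rw [T.tr_mul_left hc (one_mem _), tr_unit, mul_smul_comm, mul_one]]
    simp only [smul_smul]
    congr 1; field_simp
  rw [e1, hg, smul_mul_assoc, smul_smul]
  congr 1; field_simp

include Q hd in
theorem QM.MMK1 : T.cp M 1 * T.cp M 2 * T.K 1 = (μ⁻¹ * μ⁻¹) • (T.gT M * T.K 1) := by
  have h := cp_two_step Q.mem Q.mem 0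
  refine (T.FI12 0).rcan ?_
  have hF : T.gT M * (T.F 0 * T.F 1) = T.F 0 * T.F 1 * T.gT M := by
    rw [← mul_assoc, T.F_comm (gT_mem M), mul_assoc, T.F_comm (gT_mem M), mul_assoc]
  have e : T.K 1 * (T.F 0 * T.F 1) = T.F 0 * T.F 1 * T.K 0 := T.KF12 0
  have h' : T.cp M 1 * T.cp M 2 * (T.F 0 * T.F 1) = T.F 0 * T.F 1 * (M * T.cp M 1) := h
  change _ * (T.F 0 * T.F 1) = _ * (T.F 0 * T.F 1)
  rw [mul_assoc, e, ← mul_assoc, h', mul_assoc, Q.MMK hd, smul_mul_assoc, mul_assoc _ (T.K 1), e,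
    ← mul_assoc, hF, mul_smul_comm, mul_assoc, mul_assoc, mul_assoc]

include Q hd in
theorem QM.M_xi : M * T.xi M = μ⁻¹ • T.gT M := by
  refine T.cup_cancel' (n := 0) (mul_mem Q.mem (xi_mem M))
    (Subalgebra.smul_mem _ (T.sm (gT_mem M)) _) ?_
  rw [mul_assoc, ← mul_smul_comm, ← cup_xi Q.mem, ← mul_assoc, Q.MMK hd, smul_mul_assoc, smul_smul]

include Q hd in
theorem QM.xi_ad : T.xi M * T.ad M = μ⁻¹ • T.gT M := by
  have hM := Q.mem
  have hx := xi_mem (T := T) M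
  have ha := ad_mem hM
  refine T.cup_cancel' (n := 1) (T.sm (mul_mem hx ha) )
    (T.sm (Subalgebra.smul_mem _ (gT_mem M) _)) ?_
  have hK : T.K 1 * (T.cp M 1 * T.cp M 2) = T.cp M 1 * T.cp M 2 * T.K 1 :=
    T.K_inter (Q.rel' 1)
  have e1 : T.cp M 1 * T.cp M 2 * T.K 1 * T.K 0 * T.K 1 = (μ⁻¹ * μ⁻¹) • (T.gT M * T.K 1) := by
    rw [Q.MMK1 hd, smul_mul_assoc, smul_mul_assoc, mul_assoc, mul_assoc, ← mul_assoc (T.K 1),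
      T.K212 0]
  rw [← hK] at e1
  have e2 : T.K 1 * (T.cp M 1 * T.cp M 2) * T.K 0 * T.K 1 =
      μ⁻¹ • (T.xi M * T.ad M * T.K 1) := by
    have h1 := T.K_comm (n := 1) hx
    have h2 := T.K_comm (n := 1) ha
    have h3 := cp_KK hM
    have h4 : ∀ x, T.cp M 1 * (T.K 0 * x) = μ⁻¹ • (T.xi M * (T.K 0 * x)) := fun x => by
      rw [← mul_assoc, cup_xi hM, smul_mul_assoc, mul_assoc]
    refine tl fun x => ?_
    simp only [mul_assoc, smul_mul_assoc, ra3 ((mul_assoc _ _ _).trans h3), h4, mul_smul_comm]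
    rw [ra2 h1.symm, mul_assoc, ra3 (T.K212 0), ra2 h2]
    simp only [mul_assoc]
  rw [← e2, e1, smul_mul_assoc, smul_smul]

include Q hd in
theorem QM.g_ad : T.gT M * T.ad M = M * T.gT M := by
  have h1 := Q.M_xi hd
  have h2 := Q.xi_ad hd
  refine T.smul_mu_inv_inj ?_
  rw [← smul_mul_assoc, ← h1, mul_assoc, h2, mul_smul_comm]

end contraction

/-! ### Further identities for the one-strand maps -/

section maps
variable {X : E} (hX : X ∈ T.S 1)

include hX in
theorem tr_KXR : T.tr 1 (T.K 0 * X * T.R 0) = T.pp X := by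
  have hm : T.R 0 * X * T.K 0 ∈ T.S 2 := mul_mem (mul_mem (T.R_mem 0) (T.sm hX)) (T.K_mem 0)
  refine T.tr_eq (mul_mem (mul_mem (T.K_mem 0) (T.sm hX)) (T.R_mem 0)) (pp_mem X) ?_
  rw [pp, ← T.tr_spec hm]
  have h1 := T.Ri_comm (n := 1) hX
  have e1 : T.R 0 * T.K 1 = T.Ri 1 * T.K 0 * T.K 1 := T.R1K2 0
  have e2 : T.K 1 * T.R 0 = T.K 1 * T.K 0 * T.Ri 1 := T.K2R1 0
  refine tl fun x => ?_
  simp only [mul_assoc, ra2 e1, ra2 e2, ra2 h1]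

include hX in
theorem tr_KXK : T.tr 1 (T.K 0 * X * T.K 0) = T.tr 0 X := by
  rw [T.tr_spec hX, T.tr_smul _ (mul_mem (T.sm (T.tr_mem 0 X)) (T.K_mem 0)),
    T.tr_mul_left (T.sm (T.tr_mem 0 X)) (T.K_mem 0), T.tr_K, mul_smul_comm, mul_one, smul_smul,
    inv_mul_cancel₀ T.mu0, one_smul]

include hX in
theorem tr_KX : T.tr 1 (T.K 0 * X) = μ • X := by
  rw [T.tr_mul_right hX (T.K_mem 0), T.tr_K, smul_mul_assoc, one_mul]

include hX in
theorem tr_KXRi : T.tr 1 (T.K 0 * X * T.Ri 0) =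
    T.pp X - ((q - q⁻¹) * μ) • X + (q - q⁻¹) • T.tr 0 X := by
  have m1 : T.K 0 * X ∈ T.S 2 := mul_mem (T.K_mem 0) (T.sm hX)
  have m2 := mul_mem m1 (T.R_mem 0)
  have m3 := mul_mem m1 (T.K_mem 0)
  rw [T.Ri_eq, mul_add, mul_sub, mul_smul_comm, mul_smul_comm, mul_one,
    T.tr_add (sub_mem m2 (Subalgebra.smul_mem _ m1 _)) (Subalgebra.smul_mem _ m3 _),
    T.tr_sub m2 (Subalgebra.smul_mem _ m1 _), T.tr_smul _ m1, T.tr_smul _ m3, tr_KXR hX,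
    tr_KX hX, tr_KXK hX, smul_smul]

theorem HF (n : ℕ) : T.F n * T.H n = T.H (n + 1) * T.F n :=
  ((GH (n + 1)).inter (GH n) (F_G n).symm).symm

theorem FiG (n : ℕ) : T.G n * T.Fi n = T.Fi n * T.G (n + 1) := ((T.FF n).conj (F_G n).symm).symm

theorem FiG' (n : ℕ) : T.G (n + 1) * T.Fi n = T.Fi n * T.G n :=
  ((T.FF n).conj (F_G' n).symm).symm

theorem cp_ad (X : E) : T.cp (T.ad X) 1 = T.H 1 * T.cp X 1 * T.G 1 := by
  have h1 : T.F 0 * T.H 0 = T.H 1 * T.F 0 := HF 0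
  have h2 : T.G 0 * T.Fi 0 = T.Fi 0 * T.G 1 := FiG 0
  exact tl fun x => by simp only [cp1, ad, mul_assoc, ra2 h1, ra2 h2]

include hX in
theorem cp_G : T.cp X 1 * T.G 0 = T.G 0 * T.cp X 1 := by
  have h1 : T.G 1 * T.Fi 0 = T.Fi 0 * T.G 0 := FiG' 0
  have h2 : T.F 0 * T.G 1 = T.G 0 * T.F 0 := F_G' 0
  have h3 : T.G 1 * X = X * T.G 1 := G_pass hX
  refine tl fun x => ?_
  simp only [cp1, mul_assoc, ra2 h1.symm]
  rw [ra2 h3.symm, mul_assoc, ra2 h2, mul_assoc]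

theorem ad_tr {Z : E} (hZ : Z ∈ T.S 2) :
    T.ad (T.tr 1 Z) = T.tr 1 (T.H 1 * T.H 0 * Z * (T.G 0 * T.G 1)) := by
  have hH : T.H 1 * T.H 0 = T.H 0 * T.H 1 := H_pass (H_mem 0)
  have hG : T.G 1 * T.G 0 = T.G 0 * T.G 1 := G_pass (G_mem 0)
  have m := mul_mem (mul_mem (H_mem (T := T) 1) hZ) (G_mem 1)
  rw [ad, ← tr_ad (n := 1) hZ, ← T.tr_mul_left (H_mem 0) m,
    ← T.tr_mul_right (G_mem 0) (mul_mem (T.sm (H_mem 0)) m)]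
  congr 1
  exact tl fun x => by simp only [mul_assoc, ra2 hH, ra2 hG]

theorem tr_zero_ad : T.tr 0 (T.ad X) = T.tr 0 X := by
  by_cases hX : X ∈ T.S 1
  · exact tr_ad hX
  · have : T.ad X ∉ T.S 1 := fun h => hX (by
      have : X = T.G 0 * T.ad X * T.H 0 := by rw [G_ad, mul_assoc, (GH 0).l, mul_one]
      rw [this]; exact mul_mem (mul_mem (G_mem 0) h) (H_mem 0))
    unfold tr; rw [dif_neg hX, dif_neg this]

include hX in
theorem ad_cp {O : E} (hO : O ∈ T.S 2) (h : O * (T.G 0 * T.G 1) = T.G 0 * T.G 1 * O) :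
    T.ad (T.tr 1 (T.cp X 1 * O)) = T.tr 1 (T.cp (T.ad X) 1 * O) := by
  rw [ad_tr (mul_mem (cp1_mem hX) hO), cp_ad]
  congr 1
  have h1 := cp_G hX
  refine tl fun x => ?_
  simp only [mul_assoc, ra3 ((mul_assoc _ _ _).trans h)]
  rw [ra2 h1, mul_assoc, ra2 (GH 0).r, one_mul]

include hX in
theorem ad_ph : T.ad (T.ph X) = T.ph (T.ad X) := ad_cp hX (T.R_mem 0) (R_G 0)

include hX in
theorem ad_pp : T.ad (T.pp X) = T.pp (T.ad X) := by
  rw [pp, ad_tr (mul_mem (mul_mem (T.R_mem 0) (T.sm hX)) (T.K_mem 0)), pp]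
  congr 1
  have h1 : T.H 1 * T.H 0 * T.R 0 = T.R 0 * (T.H 1 * T.H 0) := H_R 0
  have h2 : T.K 0 * (T.G 0 * T.G 1) = T.G 0 * T.G 1 * T.K 0 := K_G 0
  have hH : T.H 1 * T.H 0 = T.H 0 * T.H 1 := H_pass (H_mem 0)
  have h3 : T.H 1 * X = X * T.H 1 := H_pass hX
  have h4 : T.G 1 * T.G 0 = T.G 0 * T.G 1 := G_pass (G_mem 0)
  refine tl fun x => ?_
  simp only [mul_assoc, ra3 h1, ra3 ((mul_assoc _ _ _).trans h2)]
  rw [ra2 hH, mul_assoc, ra2 h3, ad, ra2 h4.symm]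
  simp only [mul_assoc]
  rw [ra2 (GH 1).r, one_mul]

end maps

section cycMW
variable {M : E} (Q : QM T M)

include Q in
theorem QM.xi_M_ph (i : ℕ) : T.xi (M * T.ph (T.We M i)) =
    T.xi M * (T.pp (T.ad (T.We M i)) - ((q - q⁻¹) * μ) • T.ad (T.We M i) +
      (q - q⁻¹) • T.tr 0 (T.ad (T.We M i))) := by
  have hW := Q.We_mem i
  have hM := cp1_mem Q.mem
  have hR : T.R 1 ∈ T.S 3 := T.R_mem 1
  have hK : T.K 0 ∈ T.S 3 := T.sm (T.K_mem 0)
  have c := Q.cy (i := i) (Cyc.R le_rfl (by omega)) (Q.Mp_R le_rfl (by omega)) (T.R_mem 1)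
  have hp : T.cp (T.ph (T.We M i)) 1 ∈ T.S 2 := cp1_mem (ph_mem _)
  have e1 : T.cp (M * T.ph (T.We M i)) 1 * T.K 0 =
      T.tr 2 (T.cp M 1 * T.cp (T.We M i) 2 * T.R 1 * T.K 0) := by
    rw [T.tr_mul_right (T.K_mem 0) (mul_mem (mul_mem (T.sm hM) (cp2_mem hW)) hR), mul_assoc,
      T.tr_mul_left hM (mul_mem (cp2_mem hW) hR), ← cp_ph hW, cp_mul]
  have e2 : T.tr 2 (T.cp M 1 * T.cp (T.We M i) 2 * T.K 0 * T.R 1) =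
      T.cp M 1 * T.K 0 * T.cp (T.ph (T.We M i)) 1 := by
    rw [mul_assoc (T.cp M 1), cp_K hW le_rfl, ← mul_assoc, mul_assoc _ (T.cp _ 2),
      T.tr_mul_left (mul_mem hM (T.K_mem 0)) (mul_mem (cp2_mem hW) hR), ← cp_ph hW]
  have ha := ad_mem hW
  have m : T.K 0 * T.ad (T.We M i) * T.Ri 0 ∈ T.S 2 :=
    mul_mem (mul_mem (T.K_mem 0) (T.sm ha)) (T.Ri_mem 0)
  have m' : T.xi M * (T.K 0 * T.ad (T.We M i) * T.Ri 0) ∈ T.S 2 :=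
    mul_mem (T.sm (xi_mem M)) m
  rw [xi, e1, c, e2, cup_xi Q.mem, smul_mul_assoc, mul_assoc, K_cp_ph hW, mul_smul_comm, smul_smul,
    inv_mul_cancel₀ T.mu0, one_smul, T.tr_mul_left (xi_mem M) m, tr_KXRi ha]

include Q in
theorem QM.xi_M_xi (i : ℕ) : T.xi (M * T.xi (T.We M i)) =
    μ • (T.xi M * T.ad (T.We M i)) := by
  have hW := Q.We_mem i
  have hM := cp1_mem Q.mem
  have hR : T.K 1 ∈ T.S 3 := T.K_mem 1
  have hK : T.K 0 ∈ T.S 3 := T.sm (T.K_mem 0)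
  have c := Q.cy (i := i) (Cyc.K le_rfl (by omega)) (Q.Mp_K le_rfl (by omega)) (T.K_mem 1)
  have e1 : T.cp (M * T.xi (T.We M i)) 1 * T.K 0 =
      T.tr 2 (T.cp M 1 * T.cp (T.We M i) 2 * T.K 1 * T.K 0) := by
    rw [T.tr_mul_right (T.K_mem 0) (mul_mem (mul_mem (T.sm hM) (cp2_mem hW)) hR), mul_assoc,
      T.tr_mul_left hM (mul_mem (cp2_mem hW) hR), ← cp_xi hW, cp_mul]
  have e2 : T.tr 2 (T.cp M 1 * T.cp (T.We M i) 2 * T.K 0 * T.K 1) =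
      T.cp M 1 * T.K 0 * T.cp (T.xi (T.We M i)) 1 := by
    rw [mul_assoc (T.cp M 1), cp_K hW le_rfl, ← mul_assoc, mul_assoc _ (T.cp _ 2),
      T.tr_mul_left (mul_mem hM (T.K_mem 0)) (mul_mem (cp2_mem hW) hR), ← cp_xi hW]
  have ha := ad_mem hW
  have m : T.K 0 * T.ad (T.We M i) ∈ T.S 2 := mul_mem (T.K_mem 0) (T.sm ha)
  rw [xi, e1, c, e2, cup_xi Q.mem, smul_mul_assoc, mul_assoc, K_cp_xi hW, mul_smul_comm, smul_smul,
    inv_mul_cancel₀ T.mu0, one_smul, T.tr_mul_left (xi_mem M) m, tr_KX ha, mul_smul_comm]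

end cycMW

end Tower
end QMA
end

section
namespace QMA
namespace Tower

variable {E : Type*} [Ring E] [Algebra ℂ E] {q μ : ℂ} {T : Tower E q μ}

/-! ### Recursion for the wedge powers -/

section recursion
variable {M : E} (Q : QM T M)

theorem tr_cp {X : E} (hX : X ∈ T.S 1) : T.tr 1 (T.cp X 1) = T.tr 0 X := T.tr_conj (n := 0) hX

theorem tr_cp_sg {X : E} (hX : X ∈ T.S 1) (i : ℕ) :
    T.tr 1 (T.cp X 1 * T.sg i 0) = T.tr 0 X + al q i • T.ph X + be q μ i • T.xi X := by
  have h := cp1_mem hX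
  have hR := mul_mem h (T.R_mem 0)
  have hK := mul_mem h (T.K_mem 0)
  rw [sg, mul_add, mul_add, mul_one, mul_smul_comm, mul_smul_comm,
    T.tr_add (add_mem h (Subalgebra.smul_mem _ hR _)) (Subalgebra.smul_mem _ hK _),
    T.tr_add h (Subalgebra.smul_mem _ hR _), T.tr_smul _ hR, T.tr_smul _ hK, tr_cp hX]
  rfl

include Q in
theorem QM.We_core {k i : ℕ} (hg : Gen q μ k) (hi : i + 1 ≤ k) :
    T.mtr 1 (i + 1) (T.Mp M 1 (i + 1) *
      (T.As 1 (i + 1) * T.sg (i + 1) 0 * T.As 1 (i + 1))) =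
      T.tr 0 (T.We M i) + al q (i + 1) • T.ph (T.We M i) + be q μ (i + 1) • T.xi (T.We M i) := by
  have mM : T.Mp M 1 (i + 1) ∈ T.S (1 + (i + 1)) := Q.Mp_mem 1 (i + 1)
  have mA : T.As 1 (i + 1) ∈ T.S (1 + (i + 1)) := T.As_mem 1 (i + 1)
  have ms : T.sg (i + 1) 0 ∈ T.S (1 + (i + 1)) := T.sm (T.sg_mem _ 0)
  have hc := (T.As_cyc (a := 1) (m := i + 1) (p := 1) (n := i + 1) le_rfl le_rfl).eq
    (T.Mp M 1 (i + 1) * (T.As 1 (i + 1) * T.sg (i + 1) 0)) (mul_mem mM (mul_mem mA ms))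
  have hA := (T.As_absorb hg 1 (i + 1) hi).2
  have hMA := Q.Mp_As (a := 1) (n := i + 1) (p := 1) (m := i + 1) le_rfl le_rfl
  rw [← mul_assoc, ← hc, show T.As 1 (i + 1) * (T.Mp M 1 (i + 1) *
      (T.As 1 (i + 1) * T.sg (i + 1) 0)) = T.Mp M 1 (i + 1) * T.As 1 (i + 1) * T.sg (i + 1) 0 from
    tl fun x => by simp only [mul_assoc, ra2 hMA.symm, ra2 hA], mtr_bot,
    T.mtr_mul_right (T.sg_mem _ 0) (T.sm (mul_mem mM mA)), Q.We_cp 1 i, tr_cp_sg (Q.We_mem i)]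

include Q in
theorem QM.We_succ {k i : ℕ} (hg : Gen q μ k) (hi : i + 2 ≤ k) :
    T.We M (i + 1) = cA q (i + 1) • (M * (T.tr 0 (T.We M i) + al q (i + 1) • T.ph (T.We M i) +
      be q μ (i + 1) • T.xi (T.We M i))) := by
  have mM : T.Mp M 1 (i + 1) ∈ T.S (1 + (i + 1)) := Q.Mp_mem 1 (i + 1)
  have mA : T.As 1 (i + 1) ∈ T.S (1 + (i + 1)) := T.As_mem 1 (i + 1)
  have ms : T.sg (i + 1) 0 ∈ T.S (1 + (i + 1)) := T.sm (T.sg_mem _ 0)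
  have m := mul_mem mM (mul_mem (mul_mem mA ms) mA)
  rw [← Q.We_core hg (by omega), We, T.As_flip hg 0 i hi, Mp_head, mul_smul_comm,
    T.mtr_smul _ ?_, mul_assoc]
  · congr 1
    exact T.mtr_mul_left Q.mem m
  · rw [mul_assoc]; exact mul_mem (T.sm Q.mem) m

include Q in
theorem QM.We_cut {i : ℕ} (hg : Gen q μ (i + 1))
    (h : T.As 0 (i + 1) * T.sg (i + 1) i * T.As 0 (i + 1) = 0) :
    T.tr 0 (T.We M i) + al q (i + 1) • T.ph (T.We M i) + be q μ (i + 1) • T.xi (T.We M i) = 0 := by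
  have hz := T.cut_flip hg 0 (by simpa using h)
  have mM : T.Mp M 1 (i + 1) ∈ T.S (1 + (i + 1)) := Q.Mp_mem 1 (i + 1)
  have h0 := T.mtr_mul_right (a := 1) (m := i + 1) (zero_mem _) mM
  simp only [mul_zero] at h0
  rw [← Q.We_core hg le_rfl]
  simp only [zero_add] at hz
  rw [hz, mul_zero, h0]

end recursion

/-! ### The operators `L` and `P` -/

/-- `pI` inverts `φ` on the first strand. -/
structure PhInv (T : Tower E q μ) (pI : E → E) : Prop where
  mem : ∀ X ∈ T.S 1, pI X ∈ T.S 1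
  left : ∀ X ∈ T.S 1, pI (T.ph X) = X
  right : ∀ X ∈ T.S 1, T.ph (pI X) = X

section LP
variable {pI : E → E} (I : PhInv T pI)

theorem PhInv.inj (I : PhInv T pI) {X Y : E} (hX : X ∈ T.S 1) (hY : Y ∈ T.S 1)
    (h : T.ph X = T.ph Y) : X = Y := by
  rw [← I.left X hX, h, I.left Y hY]

theorem PhInv.add (I : PhInv T pI) {X Y : E} (hX : X ∈ T.S 1) (hY : Y ∈ T.S 1) :
    pI (X + Y) = pI X + pI Y := by
  have mX := I.mem X hX
  have mY := I.mem Y hY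
  refine I.inj (I.mem _ (add_mem hX hY)) (add_mem mX mY) ?_
  rw [I.right _ (add_mem hX hY), ph_add mX mY, I.right X hX, I.right Y hY]

theorem PhInv.smul (I : PhInv T pI) {X : E} (hX : X ∈ T.S 1) (c : ℂ) :
    pI (c • X) = c • pI X := by
  have mX := I.mem X hX
  have m := Subalgebra.smul_mem _ hX c
  refine I.inj (I.mem _ m) (Subalgebra.smul_mem _ mX c) ?_
  rw [I.right _ m, ph_smul mX, I.right X hX]

theorem PhInv.mul_right (I : PhInv T pI) {X a : E} (hX : X ∈ T.S 1) (ha : a ∈ T.S 0) :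
    pI (X * a) = pI X * a := by
  have mX := I.mem X hX
  have m := mul_mem hX (T.sm (n := 1) ha)
  refine I.inj (I.mem _ m) (mul_mem mX (T.sm ha)) ?_
  rw [I.right _ m, ph_mul_right mX ha, I.right X hX]

theorem PhInv.mul_left (I : PhInv T pI) {X a : E} (hX : X ∈ T.S 1) (ha : a ∈ T.S 0) :
    pI (a * X) = a * pI X := by
  have mX := I.mem X hX
  have m := mul_mem (T.sm (n := 1) ha) hX
  refine I.inj (I.mem _ m) (mul_mem (T.sm ha) mX) ?_
  rw [I.right _ m, ph_mul_left mX ha, I.right X hX]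

theorem PhInv.pp_eq (I : PhInv T pI) {X : E} (hX : X ∈ T.S 1) :
    T.pp X = μ • pI (T.xi X) := by
  have m := I.mem _ (xi_mem (T := T) X)
  refine I.inj (pp_mem X) (Subalgebra.smul_mem _ m _) ?_
  rw [ph_smul m, I.right _ (xi_mem X), ph_pp hX]

theorem ad_mul (X Y : E) : T.ad (X * Y) = T.ad X * T.ad Y :=
  tl fun x => by simp only [ad, mul_assoc, ra2 (GH 0).l, one_mul]

theorem ad_add (X Y : E) : T.ad (X + Y) = T.ad X + T.ad Y := by
  simp only [ad, mul_add, add_mul]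

theorem ad_smul (c : ℂ) (X : E) : T.ad (c • X) = c • T.ad X := by
  simp only [ad, mul_smul_comm, smul_mul_assoc]

theorem ad_zero {a : E} (ha : a ∈ T.S 0) : T.ad a = a := by
  rw [ad, H_pass ha, mul_assoc, (GH 0).r, mul_one]

theorem ph_scalar {a : E} (ha : a ∈ T.S 0) : T.ph a = a := by
  rw [ph, cp_zero_strand ha, T.tr_mul_left (T.sm ha) (T.R_mem 0), T.tr_R, mul_one]

variable {M : E} (Q : QM T M)

/-- `X ↦ M φ(X)`. -/
noncomputable def Lm (Q : QM T M) : T.S 1 →ₗ[ℂ] T.S 1 where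
  toFun X := ⟨M * T.ph X, mul_mem Q.mem (ph_mem _)⟩
  map_add' X Y := Subtype.ext (by
    change M * T.ph (X + Y) = M * T.ph X + M * T.ph Y
    rw [ph_add X.2 Y.2, mul_add])
  map_smul' c X := Subtype.ext (by
    change M * T.ph (c • X) = c • (M * T.ph X)
    rw [ph_smul X.2, mul_smul_comm])

theorem PM_mem (I : PhInv T pI) (M : E) {X : E} (hX : X ∈ T.S 1) :
    μ • pI (T.xi M * T.ad X) ∈ T.S 1 :=
  Subalgebra.smul_mem _ (I.mem _ (mul_mem (xi_mem M) (ad_mem hX))) _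

/-- `X ↦ μ φ⁻¹(ξ(M) G⁻¹ X G)`. -/
noncomputable def Pm (I : PhInv T pI) (M : E) : T.S 1 →ₗ[ℂ] T.S 1 where
  toFun X := ⟨μ • pI (T.xi M * T.ad X), PM_mem I M X.2⟩
  map_add' X Y := Subtype.ext (by
    change μ • pI (T.xi M * T.ad (X + Y)) = μ • pI (T.xi M * T.ad X) + μ • pI (T.xi M * T.ad Y)
    rw [ad_add, mul_add, I.add (mul_mem (xi_mem M) (ad_mem X.2)) (mul_mem (xi_mem M) (ad_mem Y.2)),
      smul_add])
  map_smul' c X := Subtype.ext (by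
    change μ • pI (T.xi M * T.ad (c • X)) = c • (μ • pI (T.xi M * T.ad X))
    rw [ad_smul, mul_smul_comm, I.smul (mul_mem (xi_mem M) (ad_mem X.2)), smul_comm])

theorem Lm_coe (X : T.S 1) : (Lm Q X : E) = M * T.ph X := rfl

theorem Pm_coe (I : PhInv T pI) (X : T.S 1) : (Pm I M X : E) = μ • pI (T.xi M * T.ad X) := rfl

variable (hd : dl q μ ≠ 0)

include hd in
theorem LP_eq (X : T.S 1) : (Lm Q (Pm I M X) : E) = T.gT M * T.ad X := by
  have m := mul_mem (xi_mem (T := T) M) (ad_mem X.2)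
  rw [Lm_coe, Pm_coe, ph_smul (I.mem _ m), I.right _ m, mul_smul_comm, ← mul_assoc, Q.M_xi hd,
    smul_mul_assoc, smul_smul, mul_inv_cancel₀ T.mu0, one_smul]

include hd in
theorem PL_eq (X : T.S 1) : (Pm I M (Lm Q X) : E) = T.gT M * T.ad X := by
  have ha := ad_mem X.2
  rw [Pm_coe, Lm_coe, ad_mul, ← mul_assoc, Q.xi_ad hd, smul_mul_assoc,
    I.smul (mul_mem (T.sm (gT_mem M)) (ad_mem (ph_mem _))), smul_smul, mul_inv_cancel₀ T.mu0,
    one_smul, I.mul_left (ad_mem (ph_mem _)) (gT_mem M), ad_ph X.2, I.left _ ha]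

include hd in
theorem LP_comm (X : T.S 1) : Lm Q (Pm I M X) = Pm I M (Lm Q X) :=
  Subtype.ext (by rw [LP_eq I Q hd, PL_eq I Q hd])

/-- Elements for which `Γ(X) = X g`. -/
def GInv (T : Tower E q μ) (M X : E) : Prop := X ∈ T.S 1 ∧ T.gT M * T.ad X = X * T.gT M

theorem Lm_mul_right (X : T.S 1) {a : E} (ha : a ∈ T.S 0) :
    (Lm Q ⟨X * a, mul_mem X.2 (T.sm ha)⟩ : E) = Lm Q X * a := by
  rw [Lm_coe, Lm_coe, ph_mul_right X.2 ha, mul_assoc]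

theorem Pm_mul_right (X : T.S 1) {a : E} (ha : a ∈ T.S 0) :
    (Pm I M ⟨X * a, mul_mem X.2 (T.sm ha)⟩ : E) = Pm I M X * a := by
  rw [Pm_coe, Pm_coe, ad_mul, ad_zero ha, ← mul_assoc,
    I.mul_right (mul_mem (xi_mem M) (ad_mem X.2)) ha, smul_mul_assoc]

include hd in
theorem GInv.Lm {X : T.S 1} (h : GInv T M X) : GInv T M (Lm Q X) := by
  refine ⟨(Tower.Lm Q X).2, ?_⟩
  rw [← Lm_mul_right Q X (gT_mem M)]
  have e : (⟨X * T.gT M, mul_mem X.2 (T.sm (gT_mem M))⟩ : T.S 1) =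
    ⟨T.gT M * T.ad X, mul_mem (T.sm (gT_mem M)) (ad_mem X.2)⟩ := Subtype.ext h.2.symm
  rw [e, Lm_coe, Lm_coe, ad_mul, ← mul_assoc, Q.g_ad hd, mul_assoc, ad_ph X.2,
    ph_mul_left (ad_mem X.2) (gT_mem M)]

include I Q hd in
theorem GInv.Pm {X : T.S 1} (h : GInv T M X) : GInv T M (Pm I M X) := by
  refine ⟨(Tower.Pm I M X).2, ?_⟩
  rw [← Pm_mul_right I X (gT_mem M)]
  have e : (⟨X * T.gT M, mul_mem X.2 (T.sm (gT_mem M))⟩ : T.S 1) = Tower.Lm Q (Tower.Pm I M X) :=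
    Subtype.ext (by rw [LP_eq I Q hd]; exact h.2.symm)
  rw [e, ← LP_comm I Q hd, LP_eq I Q hd]

theorem GInv.add {X Y : E} (h : GInv T M X) (h' : GInv T M Y) : GInv T M (X + Y) :=
  ⟨add_mem h.1 h'.1, by rw [ad_add, mul_add, add_mul, h.2, h'.2]⟩

theorem GInv.smul {X : E} (c : ℂ) (h : GInv T M X) : GInv T M (c • X) :=
  ⟨Subalgebra.smul_mem _ h.1 c, by rw [ad_smul, mul_smul_comm, smul_mul_assoc, h.2]⟩

theorem GInv.tr {X : E} (h : GInv T M X) : GInv T M (T.tr 0 X) := by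
  have hm := T.tr_mem 0 X
  refine ⟨T.sm hm, ?_⟩
  rw [ad_zero hm, ← tr_zero_ad, ← T.tr_mul_left (gT_mem M) (ad_mem h.1), h.2,
    T.tr_mul_right (gT_mem M) h.1, tr_zero_ad]

theorem GInv.one : GInv T M 1 := ⟨one_mem _, by rw [ad_zero (one_mem _), mul_one, one_mul]⟩

end LP

end Tower
end QMA
end

section
namespace QMA

/-! ### Solving the coupled recursion -/

section solver
variable {Y : Type*} [AddCommGroup Y] [Module ℂ Y] (q : ℂ) (L P : Y →ₗ[ℂ] Y) (a : ℕ → Y)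

/-- Solution of the recursion with `P` switched off. -/
noncomputable def solU : ℕ → Y
  | 0 => a 0
  | n + 1 => q ^ (n + 1) • a (n + 1) - L (solU n)

/-- Solution of the recursion with `L` switched off. -/
noncomputable def solV : ℕ → Y
  | 0 => a 0
  | n + 1 => q⁻¹ ^ (n + 1) • a (n + 1) - P (solV n)

/-- The mixed solution. -/
noncomputable def solW : ℕ → Y
  | 0 => a 0
  | n + 1 => q ^ (n + 1) • a (n + 1) - L (solW n) - (q ^ (n + 1)) ^ 2 • P (solV q P a n)

theorem sol_invariant (hc : ∀ x, L (P x) = P (L x)) (n : ℕ) :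
    L (solW q L P a n - solU q L a n) =
      q ^ 2 • P (solW q L P a n - (q ^ n) ^ 2 • solV q P a n) := by
  induction n with
  | zero => simp [solU, solV, solW]
  | succ n ih =>
    have e1 : solW q L P a (n + 1) - solU q L a (n + 1) = -(q ^ 2 • P (solW q L P a n)) := by
      have e : q ^ 2 • P (solW q L P a n) = L (solW q L P a n) - L (solU q L a n) +
          (q ^ (n + 1)) ^ 2 • P (solV q P a n) := by
        rw [← map_sub, ih, map_sub, map_smul]
        module
      rw [e, solW, solU]
      module
    have e2 : solW q L P a (n + 1) - (q ^ (n + 1)) ^ 2 • solV q P a (n + 1) =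
        -L (solW q L P a n) := by
      rw [solW, solV]
      simp only [inv_pow]
      match_scalars <;> field_simp <;> ring
    rw [e1, e2, map_neg, map_neg, map_smul, hc, smul_neg]

theorem solV_eq (n : ℕ) :
    solV q P a n = (-1 : ℂ) ^ n • ∑ j ∈ Finset.range (n + 1), (-q⁻¹) ^ j • (P ^ (n - j)) (a j) := by
  induction n with
  | zero => simp [solV]
  | succ n ih =>
    rw [solV, ih, Finset.sum_range_succ _ (n + 1), map_smul, map_sum]
    have : ∑ j ∈ Finset.range (n + 1), (-q⁻¹) ^ j • (P ^ (n + 1 - j)) (a j) =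
        ∑ j ∈ Finset.range (n + 1), P ((-q⁻¹) ^ j • (P ^ (n - j)) (a j)) :=
      Finset.sum_congr rfl fun j hj => by
        have hj := Finset.mem_range.1 hj
        rw [map_smul, show n + 1 - j = (n - j) + 1 by omega, pow_succ']
        rfl
    rw [this, Nat.sub_self, pow_zero, Module.End.one_apply, smul_add, smul_smul,
      ← mul_pow, neg_one_mul, neg_neg, pow_succ]
    module

theorem solW_eq (hq : q ≠ 0) (n : ℕ) :
    solW q L P a n = (-1 : ℂ) ^ n • ∑ j ∈ Finset.range (n + 1), ∑ r ∈ Finset.range (n - j + 1),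
      ((-q) ^ j * q ^ (2 * r)) • (L ^ (n - j - r)) ((P ^ r) (a j)) := by
  induction n with
  | zero => simp [solW]
  | succ n ih =>
    rw [solW, ih, Finset.sum_range_succ _ (n + 1), solV_eq, map_smul, map_smul, map_sum, map_sum]
    have : ∑ j ∈ Finset.range (n + 1), ∑ r ∈ Finset.range (n + 1 - j + 1),
        ((-q) ^ j * q ^ (2 * r)) • (L ^ (n + 1 - j - r)) ((P ^ r) (a j)) =
        ∑ j ∈ Finset.range (n + 1), L (∑ r ∈ Finset.range (n - j + 1),
          ((-q) ^ j * q ^ (2 * r)) • (L ^ (n - j - r)) ((P ^ r) (a j))) +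
        (q ^ (n + 1)) ^ 2 • ∑ j ∈ Finset.range (n + 1),
          P ((-q⁻¹) ^ j • (P ^ (n - j)) (a j)) := by
      rw [Finset.smul_sum, ← Finset.sum_add_distrib]
      refine Finset.sum_congr rfl fun j hj => ?_
      have hj := Finset.mem_range.1 hj
      rw [show n + 1 - j + 1 = (n - j + 1) + 1 by omega, Finset.sum_range_succ, map_sum]
      congr 1
      · refine Finset.sum_congr rfl fun r hr => ?_
        have hr := Finset.mem_range.1 hr
        rw [map_smul, show n + 1 - j - r = (n - j - r) + 1 by omega, pow_succ' L]
        rfl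
      · rw [show n + 1 - j - (n - j + 1) = 0 by omega, pow_zero L, Module.End.one_apply, map_smul,
          smul_smul, pow_succ' P, Module.End.mul_apply]
        congr 1
        obtain ⟨d, rfl⟩ : ∃ d, n = j + d := ⟨n - j, by omega⟩
        rw [show j + d - j = d by omega, neg_pow q, neg_pow q⁻¹, inv_pow]
        field_simp
        ring
    rw [this, show n + 1 - (n + 1) + 1 = 0 + 1 by omega, Finset.sum_range_one, Nat.sub_self,
      Nat.sub_zero, pow_zero, pow_zero, pow_zero, mul_one, Module.End.one_apply,
      Module.End.one_apply, neg_pow q]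
    have h1 : (-1 : ℂ) ^ (n + 1) * ((-1) ^ (n + 1) * q ^ (n + 1)) = q ^ (n + 1) := by
      rw [← mul_assoc, ← mul_pow]; simp
    rw [smul_add, smul_smul ((-1 : ℂ) ^ (n + 1)), h1, pow_succ (-1 : ℂ)]
    module

variable {μ : ℂ} {x y : ℕ → Y} {k : ℕ}

theorem sol_uv (hq : q ≠ 0) (hμ : ∀ n, 1 ≤ n → n ≤ k → μ * q ^ (2 * n) + q ≠ 0)
    (hc : ∀ x, L (P x) = P (L x))
    (hx : ∀ n, n + 2 ≤ k → x (n + 1) = L (q ^ (n + 1) • a (n + 1) - x n -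
      ((q - q⁻¹) * q ^ (2 * (n + 1)) / (μ * q ^ (2 * (n + 1)) + q)) • y n))
    (hy : ∀ n, n + 2 ≤ k → y (n + 1) = P (q⁻¹ ^ (n + 1) • a (n + 1) - y n +
      (μ * (q - q⁻¹) * q / (μ * q ^ (2 * (n + 1)) + q)) • x n))
    (hx0 : x 0 = L (a 0)) (hy0 : y 0 = P (a 0)) (n : ℕ) (hn : n + 1 ≤ k) :
    q ^ (n + 1) • a (n + 1) - x n -
        ((q - q⁻¹) * q ^ (2 * (n + 1)) / (μ * q ^ (2 * (n + 1)) + q)) • y n =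
      (1 - (q - q⁻¹) / (μ * q ^ (2 * (n + 1)) + q)) • solU q L a (n + 1) +
        ((q - q⁻¹) / (μ * q ^ (2 * (n + 1)) + q)) • solW q L P a (n + 1) ∧
    q⁻¹ ^ (n + 1) • a (n + 1) - y n + (μ * (q - q⁻¹) * q / (μ * q ^ (2 * (n + 1)) + q)) • x n =
      (1 + (q - q⁻¹) * q * μ * q ^ (2 * (n + 1)) / (μ * q ^ (2 * (n + 1)) + q)) •
        solV q P a (n + 1) -
        ((q - q⁻¹) * q * μ / (μ * q ^ (2 * (n + 1)) + q)) • solW q L P a (n + 1) := by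
  induction n with
  | zero =>
    have h := hμ 1 le_rfl hn
    rw [hx0, hy0]
    simp only [solU, solV, solW, inv_pow, zero_add, mul_one] at h ⊢
    constructor <;> match_scalars <;> field_simp <;> ring
  | succ n ih =>
    obtain ⟨h1, h2⟩ := ih (by omega)
    have hI := sol_invariant q L P a hc (n + 1)
    rw [hx n hn, hy n hn, h1, h2]
    have m1 := hμ (n + 1) (by omega) (by omega)
    have m2 := hμ (n + 2) (by omega) (by omega)
    rw [show solU q L a (n + 1 + 1) = q ^ (n + 1 + 1) • a (n + 1 + 1) - L (solU q L a (n + 1)) from rfl,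
      show solV q P a (n + 1 + 1) = q⁻¹ ^ (n + 1 + 1) • a (n + 1 + 1) - P (solV q P a (n + 1)) from
        rfl,
      show solW q L P a (n + 1 + 1) = q ^ (n + 1 + 1) • a (n + 1 + 1) - L (solW q L P a (n + 1)) -
        (q ^ (n + 1 + 1)) ^ 2 • P (solV q P a (n + 1)) from rfl]
    simp only [map_add, map_sub, map_smul] at hI ⊢
    generalize L (solU q L a (n + 1)) = LU at *
    generalize L (solW q L P a (n + 1)) = LW at *
    generalize P (solW q L P a (n + 1)) = PW at *
    generalize P (solV q P a (n + 1)) = PV at *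
    obtain rfl : LU = LW - (q ^ 2 • PW - q ^ 2 • (q ^ (n + 1)) ^ 2 • PV) := by
      rw [← smul_sub, ← hI]; module
    have e1 : q ^ (2 * (n + 1)) = (q ^ (n + 1)) ^ 2 := by rw [mul_comm, pow_mul]
    have e2 : q ^ (2 * (n + 2)) = q ^ 2 * (q ^ (n + 1)) ^ 2 := by ring
    have e3 : q ^ (2 * (n + 1 + 1)) = q ^ 2 * (q ^ (n + 1)) ^ 2 := by ring
    have e4 : q ^ (n + 1 + 1) = q * q ^ (n + 1) := by ring
    rw [e1] at m1
    rw [e2] at m2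
    rw [e1, e3, e4, inv_pow, e4]
    have hz : q ^ (n + 1) ≠ 0 := pow_ne_zero _ hq
    clear ih h1 h2 hI hx hy hμ
    generalize q ^ (n + 1) = z at *
    have m3 : μ * q * z ^ 2 + 1 ≠ 0 := fun h => m2 (by linear_combination q * h)
    have m4 : μ * z ^ 2 * q + 1 ≠ 0 := fun h => m2 (by linear_combination q * h)
    have m5 : q * μ * z ^ 2 + 1 ≠ 0 := fun h => m2 (by linear_combination q * h)
    have m6 : q * z ^ 2 * μ + 1 ≠ 0 := fun h => m2 (by linear_combination q * h)
    have m7 : z ^ 2 * q * μ + 1 ≠ 0 := fun h => m2 (by linear_combination q * h)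
    have m8 : z ^ 2 * μ * q + 1 ≠ 0 := fun h => m2 (by linear_combination q * h)
    constructor <;> match_scalars <;> field_simp <;> ring

theorem solW_eq_zero (hq : q ≠ 0) (hl : q - q⁻¹ ≠ 0)
    (hμ : ∀ n, 1 ≤ n → n ≤ k → μ * q ^ (2 * n) + q ≠ 0)
    (hc : ∀ x, L (P x) = P (L x))
    (hx : ∀ n, n + 2 ≤ k → x (n + 1) = L (q ^ (n + 1) • a (n + 1) - x n -
      ((q - q⁻¹) * q ^ (2 * (n + 1)) / (μ * q ^ (2 * (n + 1)) + q)) • y n))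
    (hy : ∀ n, n + 2 ≤ k → y (n + 1) = P (q⁻¹ ^ (n + 1) • a (n + 1) - y n +
      (μ * (q - q⁻¹) * q / (μ * q ^ (2 * (n + 1)) + q)) • x n))
    (hx0 : x 0 = L (a 0)) (hy0 : y 0 = P (a 0)) (n : ℕ) (hn : k = n + 1)
    (hm : μ * q ^ (2 * k) = -q⁻¹)
    (hcut : q ^ (n + 1) • a (n + 1) - x n -
      ((q - q⁻¹) * q ^ (2 * (n + 1)) / (μ * q ^ (2 * (n + 1)) + q)) • y n = 0) :
    solW q L P a k = 0 := by
  have h := (sol_uv q L P a hq hμ hc hx hy hx0 hy0 n hn.ge).1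
  subst hn
  have e : (q - q⁻¹) / (μ * q ^ (2 * (n + 1)) + q) = 1 := by
    rw [hm, neg_add_eq_sub, div_self hl]
  rw [hcut, e, sub_self, zero_smul, one_smul, zero_add] at h
  exact h.symm

end solver

theorem sum_triangle_eq {α : Type*} [AddCommMonoid α] (k : ℕ) (f : ℕ → ℕ → α) :
    ∑ j ∈ Finset.range (k + 1), ∑ r ∈ Finset.range (k - j + 1), f j r =
      ∑ i ∈ Finset.range (k + 1), ∑ s ∈ Finset.range (i / 2 + 1), f (i - 2 * s) s +
      ∑ i ∈ Finset.range k, ∑ s ∈ Finset.range (i / 2 + 1), f (i - 2 * s) (k - i + s) := by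
  rw [Finset.sum_sigma', Finset.sum_sigma', Finset.sum_sigma',
    ← Finset.sum_filter_add_sum_filter_not _ (fun p : (_ : ℕ) × ℕ => 2 * p.2 ≤ k - p.1)]
  congr 1
  · refine Finset.sum_bij' (fun p _ => ⟨p.1 + 2 * p.2, p.2⟩) (fun p _ => ⟨p.1 - 2 * p.2, p.2⟩)
      ?_ ?_ ?_ ?_ ?_
    · simp only [Finset.mem_filter, Finset.mem_sigma, Finset.mem_range]; intros; omega
    · simp only [Finset.mem_filter, Finset.mem_sigma, Finset.mem_range]; intros; omega
    · rintro ⟨j, r⟩ _; simp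
    · rintro ⟨i, s⟩ h
      simp only [Finset.mem_sigma, Finset.mem_range] at h
      simp only [Sigma.mk.injEq, heq_eq_eq, and_true]; omega
    · rintro ⟨j, r⟩ _; simp
  · refine Finset.sum_bij' (fun p _ => ⟨2 * k - p.1 - 2 * p.2, k - p.1 - p.2⟩)
      (fun p _ => ⟨p.1 - 2 * p.2, k - p.1 + p.2⟩) ?_ ?_ ?_ ?_ ?_
    · simp only [Finset.mem_filter, Finset.mem_sigma, Finset.mem_range]; intros; omega
    · simp only [Finset.mem_filter, Finset.mem_sigma, Finset.mem_range]; intros; omega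
    · rintro ⟨j, r⟩ h
      simp only [Finset.mem_filter, Finset.mem_sigma, Finset.mem_range] at h
      simp only [Sigma.mk.injEq, heq_eq_eq]; omega
    · rintro ⟨i, s⟩ h
      simp only [Finset.mem_sigma, Finset.mem_range] at h
      simp only [Sigma.mk.injEq, heq_eq_eq]; omega
    · rintro ⟨j, r⟩ h
      simp only [Finset.mem_filter, Finset.mem_sigma, Finset.mem_range] at h
      change f j r = f (2 * k - j - 2 * r - 2 * (k - j - r)) (k - (2 * k - j - 2 * r) + (k - j - r))
      congr 1 <;> omega

namespace Tower

variable {E : Type*} [Ring E] [Algebra ℂ E] {q μ : ℂ} {T : Tower E q μ}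

/-- The elementary symmetric functions of `M`. -/
noncomputable def aT (T : Tower E q μ) (M : E) : ℕ → E
  | 0 => 1
  | i + 1 => T.tr 0 (T.We M i)

theorem aT_mem (M : E) (i : ℕ) : T.aT M i ∈ T.S 0 := by
  cases i with
  | zero => exact one_mem _
  | succ i => exact T.tr_mem _ _

/-- The star powers of `M`. -/
noncomputable def spT (T : Tower E q μ) (M : E) : ℕ → E
  | 0 => 1
  | n + 1 => M * T.ph (T.spT M n)

/-- The star powers of `π(M)`. -/
noncomputable def ppT (T : Tower E q μ) (pI : E → E) (M : E) : ℕ → E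
  | 0 => 1
  | n + 1 => μ • pI (T.xi M * T.ad (T.ppT pI M n))

section CH
variable {pI : E → E} (I : PhInv T pI) {M : E} (Q : QM T M)

theorem Lm_pow_one (n : ℕ) : (((Lm Q ^ n) 1 : T.S 1) : E) = T.spT M n := by
  induction n with
  | zero => rfl
  | succ n ih => rw [pow_succ', Module.End.mul_apply, Lm_coe, ih, spT]

theorem Pm_pow_one (n : ℕ) : (((Pm I M ^ n) 1 : T.S 1) : E) = T.ppT pI M n := by
  induction n with
  | zero => rfl
  | succ n ih => rw [pow_succ', Module.End.mul_apply, Pm_coe, ih, ppT]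

theorem Lm_pow_scalar (n : ℕ) {a : E} (ha : a ∈ T.S 0) :
    (((Lm Q ^ n) ⟨a, T.sm ha⟩ : T.S 1) : E) = T.spT M n * a := by
  induction n with
  | zero => exact (one_mul a).symm
  | succ n ih =>
    rw [pow_succ', Module.End.mul_apply, Lm_coe, ih, spT, mul_assoc, ← Lm_pow_one Q,
      ph_mul_right (SetLike.coe_mem _) ha]

theorem Pm_pow_scalar (n : ℕ) {a : E} (ha : a ∈ T.S 0) :
    (((Pm I M ^ n) ⟨a, T.sm ha⟩ : T.S 1) : E) = T.ppT pI M n * a := by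
  induction n with
  | zero => exact (one_mul a).symm
  | succ n ih =>
    rw [pow_succ', Module.End.mul_apply, Pm_coe, ih, ppT, ad_mul, ad_zero ha, ← mul_assoc,
      I.mul_right (mul_mem (xi_mem M) (ad_mem ?_)) ha, smul_mul_assoc]
    rw [← Pm_pow_one I]
    exact SetLike.coe_mem _

variable (hd : dl q μ ≠ 0)

include hd in
theorem LP_pow_scalar (r : ℕ) {a : E} (ha : a ∈ T.S 0) (hg : T.gT M * a = a * T.gT M) :
    (((Lm Q * Pm I M) ^ r) ⟨a, T.sm ha⟩ : T.S 1) =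
      ⟨a * T.gT M ^ r, T.sm (mul_mem ha (pow_mem (gT_mem M) r))⟩ := by
  induction r with
  | zero => exact Subtype.ext (by simp)
  | succ r ih =>
    refine Subtype.ext ?_
    have hm := mul_mem ha (pow_mem (gT_mem (T := T) M) r)
    rw [pow_succ', Module.End.mul_apply, Module.End.mul_apply, ih, LP_eq I Q hd, ad_zero hm,
      ← mul_assoc, hg, mul_assoc, ← pow_succ']

include hd in
theorem LP_split (m r : ℕ) (hr : r ≤ m) {a : E} (ha : a ∈ T.S 0)
    (hg : T.gT M * a = a * T.gT M) :
    (((Lm Q ^ (m - r)) ((Pm I M ^ r) ⟨a, T.sm ha⟩) : T.S 1) : E) =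
      if 2 * r ≤ m then T.spT M (m - 2 * r) * (a * T.gT M ^ r)
      else T.ppT pI M (2 * r - m) * (a * T.gT M ^ (m - r)) := by
  have hc : Commute (Lm Q) (Pm I M) := LinearMap.ext fun X => LP_comm I Q hd X
  rw [← Module.End.mul_apply]
  split_ifs with h
  · rw [show m - r = (m - 2 * r) + r by omega, pow_add, mul_assoc, ← hc.mul_pow,
      Module.End.mul_apply, LP_pow_scalar I Q hd r ha hg, Lm_pow_scalar Q]
    exact mul_mem ha (pow_mem (gT_mem M) r)
  · obtain ⟨s, hs⟩ : ∃ s, m - r = s := ⟨_, rfl⟩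
    rw [hs, show r = s + (2 * r - m) by omega, pow_add, ← mul_assoc, ← hc.mul_pow,
      ((hc.symm.mul_right (Commute.refl _)).pow_pow _ _).symm.eq, Module.End.mul_apply,
      LP_pow_scalar I Q hd s ha hg, Pm_pow_scalar I,
      show 2 * (s + (2 * r - m)) - m = 2 * r - m by omega]
    exact mul_mem ha (pow_mem (gT_mem M) s)

end CH
end Tower
end QMA
end

section
namespace QMA
namespace Tower

variable {E : Type*} [Ring E] [Algebra ℂ E] {q μ : ℂ} {T : Tower E q μ}

/-! ### The Cayley–Hamilton identity in the tower -/

section identity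
variable {pI : E → E} (I : PhInv T pI) {M : E} (Q : QM T M)

theorem We_zero : T.We M 0 = M := by
  simp [We, Mp, As, mtr, cp]

/-- The wedge powers as elements of the first strand. -/
noncomputable def Wv (Q : QM T M) (i : ℕ) : T.S 1 := ⟨T.We M i, Q.We_mem i⟩

/-- Images of the wedge powers under `π`. -/
noncomputable def Vv (T : Tower E q μ) (M : E) (i : ℕ) : T.S 1 := ⟨T.pp (T.We M i), pp_mem _⟩

/-- The elementary symmetric functions as elements of the first strand. -/
noncomputable def av (T : Tower E q μ) (M : E) (i : ℕ) : T.S 1 := ⟨T.aT M i, T.sm (aT_mem M i)⟩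

theorem Wv_zero : Wv Q 0 = Lm Q (av T M 0) := Subtype.ext <| by
  change T.We M 0 = M * T.ph 1
  rw [ph_scalar (one_mem _), mul_one, We_zero]

include Q in
theorem Vv_zero : Vv T M 0 = Pm I M (av T M 0) := Subtype.ext <| by
  change T.pp (T.We M 0) = μ • pI (T.xi M * T.ad 1)
  rw [ad_zero (one_mem _), mul_one, We_zero, I.pp_eq Q.mem]

theorem Wv_succ {k i : ℕ} (hg : Gen q μ k) (hi : i + 2 ≤ k) :
    Wv Q (i + 1) = cA q (i + 1) • Lm Q (av T M (i + 1) + al q (i + 1) • Wv Q i +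
      (be q μ (i + 1) * μ⁻¹) • Vv T M i) := Subtype.ext <| by
  change T.We M (i + 1) = cA q (i + 1) • (M * T.ph (T.tr 0 (T.We M i) + al q (i + 1) • T.We M i +
    (be q μ (i + 1) * μ⁻¹) • T.pp (T.We M i)))
  have h := Q.We_mem i
  have ht : T.tr 0 (T.We M i) ∈ T.S 1 := T.sm (T.tr_mem 0 _)
  have hs := Subalgebra.smul_mem _ h (al q (i + 1))
  have hp := pp_mem (T := T) (T.We M i)
  rw [Q.We_succ hg hi, ph_add (add_mem ht hs) (Subalgebra.smul_mem _ hp _), ph_add ht hs,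
    ph_smul h, ph_smul hp, ph_scalar (T.tr_mem 0 _), ph_pp h, smul_smul, mul_assoc,
    inv_mul_cancel₀ T.mu0, mul_one]

theorem Vv_succ {k i : ℕ} (hg : Gen q μ k) (hi : i + 2 ≤ k) :
    Vv T M (i + 1) = cA q (i + 1) • Pm I M ((1 + (q - q⁻¹) * al q (i + 1)) • av T M (i + 1) +
      al q (i + 1) • Vv T M i + (μ * (be q μ (i + 1) - (q - q⁻¹) * al q (i + 1))) • Wv Q i) :=
  Subtype.ext <| by
  change T.pp (T.We M (i + 1)) = cA q (i + 1) • (μ • pI (T.xi M * T.ad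
    ((1 + (q - q⁻¹) * al q (i + 1)) • T.tr 0 (T.We M i) +
      al q (i + 1) • T.pp (T.We M i) + (μ * (be q μ (i + 1) - (q - q⁻¹) * al q (i + 1))) • T.We M i)))
  have h := Q.We_mem i
  have ht0 := T.tr_mem 0 (T.We M i)
  have ht : M * T.tr 0 (T.We M i) ∈ T.S 1 := mul_mem Q.mem (T.sm ht0)
  have hp : M * T.ph (T.We M i) ∈ T.S 1 := mul_mem Q.mem (ph_mem _)
  have hx : M * T.xi (T.We M i) ∈ T.S 1 := mul_mem Q.mem (xi_mem _)
  have hps := Subalgebra.smul_mem _ hp (al q (i + 1))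
  have hxs := Subalgebra.smul_mem _ hx (be q μ (i + 1))
  have e : M * (T.tr 0 (T.We M i) + al q (i + 1) • T.ph (T.We M i) +
      be q μ (i + 1) • T.xi (T.We M i)) = M * T.tr 0 (T.We M i) +
      al q (i + 1) • (M * T.ph (T.We M i)) + be q μ (i + 1) • (M * T.xi (T.We M i)) := by
    simp only [mul_add, mul_smul_comm]
  have e2 : T.xi (M * (T.tr 0 (T.We M i) + al q (i + 1) • T.ph (T.We M i) +
      be q μ (i + 1) • T.xi (T.We M i))) = T.xi M * T.ad
    ((1 + (q - q⁻¹) * al q (i + 1)) • T.tr 0 (T.We M i) +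
      al q (i + 1) • T.pp (T.We M i) +
      (μ * (be q μ (i + 1) - (q - q⁻¹) * al q (i + 1))) • T.We M i) := by
    rw [e, xi_add (add_mem ht hps) hxs, xi_add ht hps, xi_smul hp, xi_smul hx,
      xi_mul_right Q.mem ht0, Q.xi_M_ph, Q.xi_M_xi]
    simp only [ad_add, ad_smul, ad_pp h, ad_zero ht0, tr_zero_ad, mul_add, mul_sub, mul_smul_comm]
    module
  have hm := mul_mem Q.mem (add_mem (add_mem (T.sm ht0) (Subalgebra.smul_mem _
    (ph_mem (T := T) (T.We M i)) (al q (i + 1)))) (Subalgebra.smul_mem _ (xi_mem (T := T) (T.We M i))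
      (be q μ (i + 1))))
  rw [Q.We_succ hg hi, pp_smul hm, I.pp_eq hm, e2]

variable (hd : dl q μ ≠ 0)

include I hd in
theorem GInv.Wv_Vv {k : ℕ} (hg : Gen q μ k) (i : ℕ) (hi : i + 1 ≤ k) :
    GInv T M (Wv Q i : E) ∧ GInv T M (Vv T M i : E) := by
  induction i with
  | zero =>
    rw [Wv_zero Q, Vv_zero I Q]
    exact ⟨GInv.Lm Q hd (X := av T M 0) GInv.one, GInv.Pm I Q hd (X := av T M 0) GInv.one⟩
  | succ i ih =>
    obtain ⟨h1, h2⟩ := ih (by omega)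
    have h3 : GInv T M (av T M (i + 1) : E) := h1.tr
    rw [Wv_succ Q hg hi, Vv_succ I Q hg hi]
    exact ⟨(GInv.Lm Q hd ((h3.add (h1.smul _)).add (h2.smul _))).smul _,
      (GInv.Pm I Q hd (((h3.smul _).add (h2.smul _)).add (h1.smul _))).smul _⟩

include I Q hd in
theorem g_aT {k : ℕ} (hg : Gen q μ k) (j : ℕ) (hj : j ≤ k) :
    T.gT M * T.aT M j = T.aT M j * T.gT M := by
  cases j with
  | zero => exact (mul_one _).trans (one_mul _).symm
  | succ i =>
    have h := ((GInv.Wv_Vv I Q hd hg i hj).1.tr).2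
    rwa [ad_zero (T.tr_mem 0 _)] at h

include I Q in
theorem We_cut_zero {n : ℕ} (hg : Gen q μ (n + 1))
    (h : T.As 0 (n + 1) * T.sg (n + 1) n * T.As 0 (n + 1) = 0) :
    av T M (n + 1) + al q (n + 1) • Wv Q n + (be q μ (n + 1) * μ⁻¹) • Vv T M n = 0 := by
  refine Subtype.ext (I.inj (SetLike.coe_mem _) (zero_mem _) ?_)
  have hW := Q.We_mem n
  have ht : T.tr 0 (T.We M n) ∈ T.S 1 := T.sm (T.tr_mem 0 _)
  have hs := Subalgebra.smul_mem _ hW (al q (n + 1))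
  have hp := pp_mem (T := T) (T.We M n)
  have h0 := ph_smul (T := T) (zero_mem (T.S 1)) (0 : ℂ)
  rw [zero_smul, zero_smul] at h0
  change T.ph (T.tr 0 (T.We M n) + al q (n + 1) • T.We M n +
    (be q μ (n + 1) * μ⁻¹) • T.pp (T.We M n)) = T.ph 0
  rw [h0, ← Q.We_cut hg h, ph_add (add_mem ht hs) (Subalgebra.smul_mem _ hp _), ph_add ht hs,
    ph_smul hW, ph_smul hp, ph_scalar (T.tr_mem 0 _), ph_pp hW, smul_smul, mul_assoc,
    inv_mul_cancel₀ T.mu0, mul_one]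

end identity

section scalars

theorem zpow_two_mul_neg (q : ℂ) (n : ℕ) : q ^ (-(2 * (n : ℤ))) = ((q ^ n) ^ 2)⁻¹ := by
  rw [_root_.zpow_neg, show (2 * (n : ℤ)) = ((n * 2 : ℕ) : ℤ) by push_cast; ring, _root_.zpow_natCast, pow_mul]

theorem zpow_one_sub (hq : q ≠ 0) (n : ℕ) :
    q ^ (1 - 2 * (n : ℤ)) = q * ((q ^ n) ^ 2)⁻¹ := by
  rw [sub_eq_add_neg, zpow_add₀ hq, _root_.zpow_one, zpow_two_mul_neg]

theorem den_ne (hq : q ≠ 0) {n : ℕ} (h : μ + q ^ (1 - 2 * (n : ℤ)) ≠ 0) :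
    μ * q ^ (2 * n) + q ≠ 0 := fun h' => h <| by
  have hz : q ^ n ≠ 0 := pow_ne_zero n hq
  rw [zpow_one_sub hq]
  rw [mul_comm 2 n, pow_mul] at h'
  field_simp
  rw [mul_zero]
  exact h'

theorem pow_mul_al (hq : q ≠ 0) (n : ℕ) : q ^ n * al q n = -qn q n := by
  have hz : q ^ n ≠ 0 := pow_ne_zero n hq
  rw [al, qn, zpow_two_mul_neg, _root_.zpow_neg, _root_.zpow_natCast]
  field_simp
  ring

theorem pow_mul_be (hq : q ≠ 0) (hl : q - q⁻¹ ≠ 0) (hμ : μ ≠ 0) {n : ℕ}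
    (h : μ + q ^ (1 - 2 * (n : ℤ)) ≠ 0) :
    q ^ n * (be q μ n * μ⁻¹) =
      -((q - q⁻¹) * q ^ (2 * n) / (μ * q ^ (2 * n) + q)) * qn q n := by
  have hz : q ^ n ≠ 0 := pow_ne_zero n hq
  have h1 := den_ne hq h
  rw [zpow_one_sub hq] at h
  rw [be, qn, zpow_two_mul_neg, zpow_one_sub hq, _root_.zpow_neg, _root_.zpow_natCast]
  rw [mul_comm 2 n, pow_mul] at h1 ⊢
  generalize q ^ n = z at *
  generalize q - q⁻¹ = l at *
  field_simp
  ring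

theorem pow_mul_al' (hq : q ≠ 0) (hl : q - q⁻¹ ≠ 0) (n : ℕ) :
    q ^ n * (1 + (q - q⁻¹) * al q n) = q⁻¹ ^ n := by
  have hz : q ^ n ≠ 0 := pow_ne_zero n hq
  rw [al, zpow_two_mul_neg, inv_pow]
  generalize q ^ n = z at *
  generalize q - q⁻¹ = l at *
  field_simp
  ring

theorem pow_mul_be' (hq : q ≠ 0) (hl : q - q⁻¹ ≠ 0) {n : ℕ}
    (h : μ + q ^ (1 - 2 * (n : ℤ)) ≠ 0) :
    q ^ n * (μ * (be q μ n - (q - q⁻¹) * al q n)) =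
      μ * (q - q⁻¹) * q / (μ * q ^ (2 * n) + q) * qn q n := by
  have hz : q ^ n ≠ 0 := pow_ne_zero n hq
  have h1 := den_ne hq h
  rw [zpow_one_sub hq] at h
  rw [be, al, qn, zpow_two_mul_neg, zpow_one_sub hq, _root_.zpow_neg, _root_.zpow_natCast]
  rw [mul_comm 2 n, pow_mul] at h1 ⊢
  generalize q ^ n = z at *
  generalize q - q⁻¹ = l at *
  have h2 : μ + q * (z ^ 2)⁻¹ = (μ * z ^ 2 + q) / z ^ 2 := by field_simp
  rw [h2]
  generalize hD : μ * z ^ 2 + q = D at *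
  obtain rfl : q = D - μ * z ^ 2 := by rw [← hD]; ring
  field_simp
  ring

theorem qn_mul_cA {n : ℕ} (h : qn q (n + 1) ≠ 0) : qn q (n + 1) * cA q n = q ^ n := by
  rw [cA, mul_div_cancel₀ _ h]

theorem qn_one (hl : q - q⁻¹ ≠ 0) : qn q 1 = 1 := by
  rw [qn, Nat.cast_one, _root_.zpow_one, _root_.zpow_neg, _root_.zpow_one, div_self hl]

end scalars

section identity
variable {pI : E → E} (I : PhInv T pI) {M : E} (Q : QM T M) (hd : dl q μ ≠ 0)

include hd in
/-- The parent Cayley–Hamilton identity before collecting terms. -/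
theorem CH_solved {n : ℕ} (hg : Gen q μ (n + 1)) (hm : μ * q ^ (2 * (n + 1)) = -q⁻¹)
    (h : T.As 0 (n + 1) * T.sg (n + 1) n * T.As 0 (n + 1) = 0) :
    solW q (Lm Q) (Pm I M) (av T M) (n + 1) = 0 := by
  have hq := T.q0
  have hl := T.lam
  refine solW_eq_zero (μ := μ) (x := fun i => qn q (i + 1) • Wv Q i)
    (y := fun i => qn q (i + 1) • Vv T M i) q _ _ _ hq hl
    (fun i h1 h2 => den_ne hq (hg.mu_ne i h1 h2)) (LP_comm I Q hd) ?_ ?_ ?_ ?_ n rfl hm ?_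
  · intro i hi
    have e1 := pow_mul_al hq (i + 1)
    have e2 := pow_mul_be hq hl T.mu0 (hg.mu_ne (i + 1) (by omega) (by omega))
    change qn q (i + 1 + 1) • Wv Q (i + 1) = _
    rw [Wv_succ Q hg hi, smul_smul, qn_mul_cA (hg.qn_ne _ (by omega) hi), ← map_smul]
    congr 1
    linear_combination (norm := module) e1 • Wv Q i + e2 • Vv T M i
  · intro i hi
    have e1 := pow_mul_al hq (i + 1)
    have e2 := pow_mul_al' hq hl (i + 1)
    have e3 := pow_mul_be' hq hl (hg.mu_ne (i + 1) (by omega) (by omega))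
    change qn q (i + 1 + 1) • Vv T M (i + 1) = _
    rw [Vv_succ I Q hg hi, smul_smul, qn_mul_cA (hg.qn_ne _ (by omega) hi), ← map_smul]
    congr 1
    linear_combination (norm := module) e1 • Vv T M i + e2 • av T M (i + 1) + e3 • Wv Q i
  · change qn q 1 • _ = _
    rw [qn_one hl, one_smul, Wv_zero]
  · change qn q 1 • _ = _
    rw [qn_one hl, one_smul, Vv_zero I Q]
  · have e := We_cut_zero I Q hg h
    have e1 := pow_mul_al hq (n + 1)
    have e2 := pow_mul_be hq hl T.mu0 (hg.mu_ne (n + 1) (by omega) le_rfl)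
    linear_combination (norm := module) q ^ (n + 1) • e - e1 • Wv Q n - e2 • Vv T M n

/-- The coefficients of the Cayley–Hamilton identity. -/
noncomputable def eT (T : Tower E q μ) (M : E) (i : ℕ) : E :=
  ∑ s ∈ Finset.range (i / 2 + 1), T.aT M (i - 2 * s) * T.gT M ^ s

include I Q hd in
theorem CH {k : ℕ} (hk : 1 ≤ k) (hg : Gen q μ k) (hm : μ * q ^ (2 * k) = -q⁻¹)
    (h : T.As 0 k * T.sg k (k - 1) * T.As 0 k = 0) :
    ∑ i ∈ Finset.range (k + 1), (-q) ^ i • (T.spT M (k - i) * T.eT M i) +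
      q ^ (2 * k) • ∑ i ∈ Finset.range k,
        (-q) ^ (-(i : ℤ)) • (T.ppT pI M (k - i) * T.eT M i) = 0 := by
  obtain ⟨n, rfl⟩ : ∃ n, k = n + 1 := ⟨k - 1, by omega⟩
  have hq := T.q0
  have h1 := CH_solved I Q hd hg hm h
  rw [solW_eq q _ _ _ hq] at h1
  have h2 := (smul_eq_zero.1 h1).resolve_left (pow_ne_zero _ (by norm_num))
  have h3 : ∑ j ∈ Finset.range (n + 1 + 1), ∑ r ∈ Finset.range (n + 1 - j + 1),
      ((-q) ^ j * q ^ (2 * r)) • (if 2 * r ≤ n + 1 - j then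
        T.spT M (n + 1 - j - 2 * r) * (T.aT M j * T.gT M ^ r)
      else T.ppT pI M (2 * r - (n + 1 - j)) * (T.aT M j * T.gT M ^ (n + 1 - j - r))) = 0 := by
    have h4 := congrArg (T.S 1).val h2
    rw [map_zero, map_sum] at h4
    rw [← h4]
    refine Finset.sum_congr rfl fun j hj => ?_
    rw [map_sum]
    refine Finset.sum_congr rfl fun r hr => ?_
    have hj := Finset.mem_range.1 hj
    have hr := Finset.mem_range.1 hr
    rw [map_smul]
    congr 1
    exact (LP_split I Q hd (n + 1 - j) r (by omega) (aT_mem M j)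
      (g_aT I Q hd hg j (by omega))).symm
  rw [sum_triangle_eq] at h3
  rw [← h3]
  congr 1
  · refine Finset.sum_congr rfl fun i hi => ?_
    rw [eT, Finset.mul_sum, Finset.smul_sum]
    refine Finset.sum_congr rfl fun s hs => ?_
    have hi := Finset.mem_range.1 hi
    have hs := Finset.mem_range.1 hs
    rw [if_pos (by omega), show n + 1 - (i - 2 * s) - 2 * s = n + 1 - i by omega]
    congr 1
    obtain ⟨d, rfl⟩ : ∃ d, i = d + 2 * s := ⟨i - 2 * s, by omega⟩
    rw [show d + 2 * s - 2 * s = d by omega, pow_add, (even_two_mul s).neg_pow]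
  · rw [Finset.smul_sum]
    refine Finset.sum_congr rfl fun i hi => ?_
    rw [eT, Finset.mul_sum, Finset.smul_sum, Finset.smul_sum]
    refine Finset.sum_congr rfl fun s hs => ?_
    have hi := Finset.mem_range.1 hi
    have hs := Finset.mem_range.1 hs
    rw [if_neg (by omega), show 2 * (n + 1 - i + s) - (n + 1 - (i - 2 * s)) = n + 1 - i by omega,
      show n + 1 - (i - 2 * s) - (n + 1 - i + s) = s by omega, smul_smul]
    congr 1
    obtain ⟨d, rfl⟩ : ∃ d, i = d + 2 * s := ⟨i - 2 * s, by omega⟩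
    obtain ⟨c, hc⟩ : ∃ c, n + 1 = c + (d + 2 * s) := ⟨n + 1 - (d + 2 * s), by omega⟩
    rw [hc, show d + 2 * s - 2 * s = d by omega, show c + (d + 2 * s) - (d + 2 * s) = c by omega,
      _root_.zpow_neg, _root_.zpow_natCast, pow_add (-q), (even_two_mul s).neg_pow, neg_pow q]
    have h5 : (-1 : ℂ) ^ d * (-1) ^ d = 1 := by rw [← mul_pow]; simp
    have h6 : (-1 : ℂ) ^ d ≠ 0 := pow_ne_zero _ (by norm_num)
    field_simp
    linear_combination (-(q ^ (c * 2) * q ^ (d * 2) * q ^ (s * 4))) * h5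

end identity
end Tower
end QMA
end

section
namespace QMA
namespace Tower
variable {E : Type*} [Ring E] [Algebra ℂ E] {q μ : ℂ} {T : Tower E q μ}

/-! ### An explicit formula for the inverse of `φ` -/

theorem F_trF : T.F 0 * T.tr 1 (T.F 0) = T.tr 2 (T.F 1) * T.F 0 := by
  have mF := T.F_mem 0
  have m3 : T.F 1 * T.F 0 * T.Fi 1 ∈ T.S 3 :=
    mul_mem (mul_mem (T.F_mem 1) (T.sm mF)) (T.Fi_mem 1)
  rw [← T.tr_conj mF, ← T.tr_mul_left mF m3, ← T.tr_mul_right mF (T.F_mem 1)]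
  congr 1
  exact (T.FF 1).rcan (tl fun x => by
    simp only [mul_assoc, ra2 (T.FF 1).r, one_mul, ra3 (T.Fbraid 0)])

theorem K_trF : T.K 0 * T.tr 2 (T.F 1) * T.F 0 = μ • (T.K 0 * T.H 0) := by
  have mF : T.F 1 ∈ T.S 3 := T.F_mem 1
  have mK : T.K 1 ∈ T.S 3 := T.K_mem 1
  have mF0 := T.F_mem 0
  have h : T.K 0 * T.F 1 * T.F 0 = T.K 0 * (T.H 0 * T.K 1) := by
    have h1 := T.K121 0
    rw [H_K]
    exact tl fun x => by simp only [mul_assoc, ra3 h1]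
  rw [← T.tr_mul_left (T.K_mem 0) mF, ← T.tr_mul_right mF0 (mul_mem (T.sm (T.K_mem 0)) mF), h,
    T.tr_mul_left (T.K_mem 0) (mul_mem (T.sm (H_mem 0)) mK), T.tr_mul_left (T.sm (H_mem 0)) mK,
    T.tr_K, mul_smul_comm, mul_one, mul_smul_comm]

/-- Cup-resolution of `F` on the first strand. -/
theorem exists_cupF : ∃ h ∈ T.S 1, T.F 0 * T.K 0 = h * T.K 0 ∧
    (T.Fi 0 * h * T.F 0) * T.K 1 = T.F 1 * T.K 1 := by
  obtain ⟨h, mh, hh⟩ := T.resL 0 _ (T.F_mem 0)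
  refine ⟨h, mh, hh, ?_⟩
  have c : h * T.Fi 1 = T.Fi 1 * h := T.Fi_comm (n := 1) mh
  have h2 : T.F 0 * T.K 1 = T.Fi 1 * T.K 0 * T.F 1 * T.F 0 := T.F1K2 0
  have h3 : T.Fi 0 * T.Fi 1 * T.F 0 = T.F 1 * (T.Fi 0 * T.Fi 1) := by
    rw [mul_assoc]
    exact (T.FFi12 0).symm ▸ (mul_assoc _ _ _).symm
  have h4 : T.K 1 * (T.Fi 0 * T.Fi 1) = T.Fi 0 * T.Fi 1 * T.K 0 := T.KFi12 0
  exact tl fun x => by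
    simp only [mul_assoc, ra2 h2, ra2 c, ra2 hh.symm, ra3 h3,
      ra2 h4.symm, ra2 (T.FF 1).r, ra2 (T.FF 0).r, one_mul]

section inverse
variable {fi fi' : E}

theorem K_F (hf : Inv2 (T.tr 1 (T.F 0)) fi) :
    T.K 0 * T.F 0 = μ • (T.K 0 * T.H 0 * fi) := by
  refine hf.rcan ?_
  rw [mul_assoc, F_trF, ← mul_assoc, K_trF, smul_mul_assoc, mul_assoc, hf.r, mul_one]

theorem K_cupF {h : E} (mh : h ∈ T.S 1) (e1 : T.Fi 0 * h * T.F 0 * T.K 1 = T.F 1 * T.K 1) :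
    T.K 0 * (T.Fi 0 * h * T.F 0) = μ⁻¹ • (T.K 0 * T.H 0 * T.tr 1 (T.Fi 0)) := by
  have m1 : T.Fi 0 * h * T.F 0 ∈ T.S 2 :=
    mul_mem (mul_mem (T.Fi_mem 0) (T.sm mh)) (T.F_mem 0)
  have mF : T.F 1 ∈ T.S 3 := T.F_mem 1
  have mK : T.K 1 ∈ T.S 3 := T.K_mem 1
  have mt : T.tr 1 (T.Fi 0) ∈ T.S 1 := T.tr_mem 1 _
  have mt2 : T.tr 1 (T.Fi 0) ∈ T.S 2 := T.sm mt
  have a1 : T.K 0 * (T.Fi 0 * h * T.F 0) =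
      μ⁻¹ • T.tr 2 (T.K 0 * (T.Fi 0 * h * T.F 0 * T.K 1)) := by
    generalize T.Fi 0 * h * T.F 0 = z at *
    rw [← mul_assoc, T.tr_mul_left (mul_mem (T.K_mem 0) m1) mK, T.tr_K, mul_smul_comm, mul_one,
      smul_smul, inv_mul_cancel₀ T.mu0, one_smul]
  have c : T.K 1 * T.tr 1 (T.Fi 0) = T.tr 1 (T.Fi 0) * T.K 1 := (T.K_comm (n := 1) mt).symm
  have h3 : T.K 0 * (T.F 1 * T.F 0) = T.F 1 * T.F 0 * T.K 1 := T.KF21 0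
  have h4 := T.tr_spec (T.Fi_mem 0)
  have a2 : T.K 0 * (T.F 1 * T.K 1) = μ⁻¹ • (T.K 0 * T.F 1 * T.F 0 * T.tr 1 (T.Fi 0)) := by
    calc T.K 0 * (T.F 1 * T.K 1) = T.K 0 * (T.F 1 * T.F 0) * T.Fi 0 * T.K 1 := tl fun x => by
          simp only [mul_assoc, ra2 (T.FF 0).l, one_mul]
      _ = T.F 1 * T.F 0 * (T.K 1 * T.Fi 0 * T.K 1) := by rw [h3]; simp only [mul_assoc]
      _ = μ⁻¹ • (T.F 1 * T.F 0 * T.K 1 * T.tr 1 (T.Fi 0)) := by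
          rw [h4, mul_smul_comm, ← c]; simp only [mul_assoc]
      _ = _ := by rw [← h3]; simp only [mul_assoc]
  have m4 : T.K 0 * T.F 1 ∈ T.S 3 := mul_mem (T.sm (T.K_mem 0)) mF
  have m5 : T.K 0 * T.F 1 * T.F 0 ∈ T.S 3 := mul_mem m4 (T.sm (T.F_mem 0))
  rw [a1, e1, a2, T.tr_smul _ (mul_mem m5 (T.sm mt)), T.tr_mul_right mt2 m5,
    T.tr_mul_right (T.F_mem 0) m4, T.tr_mul_left (T.K_mem 0) mF, K_trF, smul_mul_assoc]
  simp only [smul_smul]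
  rw [mul_assoc, inv_mul_cancel₀ T.mu0, mul_one]

variable (T) in
/-- The candidate for the inverse of `φ` with weight `p`. -/
noncomputable def pIw (p X : E) : E := T.tr 1 (T.Fi 0 * (p * X) * T.Ri 0 * T.F 0)

theorem pIw_spec {Y p : E} (hY : Y ∈ T.S 1) (hp : p ∈ T.S 1) {h : E} (mh : h ∈ T.S 1)
    (hh : T.F 0 * T.K 0 = h * T.K 0) :
    T.K 0 * (p * Y * T.Fi 0 * h * T.R 0) = μ⁻¹ • (T.K 0 * T.ad (T.pIw p Y)) := by
  have mpY := mul_mem hp hY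
  have mZ : T.Fi 0 * (p * Y) * T.Ri 0 * T.F 0 ∈ T.S 2 :=
    mul_mem (mul_mem (mul_mem (T.Fi_mem 0) (T.sm mpY)) (T.Ri_mem 0)) (T.F_mem 0)
  have mW : p * Y * T.Fi 0 * h * T.R 0 ∈ T.S 2 :=
    mul_mem (mul_mem (mul_mem (T.sm mpY) (T.Fi_mem 0)) (T.sm mh)) (T.R_mem 0)
  have mI : T.pIw p Y ∈ T.S 1 := T.tr_mem 1 _
  have key : T.K 1 * (T.K 0 * (p * Y * T.Fi 0 * h * T.R 0)) * T.K 1 =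
      μ⁻¹ • (T.ad (T.pIw p Y) * T.K 1) := by
    have e1 : μ⁻¹ • (T.ad (T.pIw p Y) * T.K 1) =
        T.H 0 * (T.K 1 * (T.Fi 0 * (p * Y) * T.Ri 0 * T.F 0) * T.K 1) * T.G 0 := by
      have c := G_K_comm (T := T) 0
      rw [T.tr_spec mZ, mul_smul_comm, smul_mul_assoc, ad]
      congr 1
      exact tl fun x => by simp only [mul_assoc, ra2 c, pIw]
    have e2 : T.F 1 * T.Ri 0 * T.Fi 1 = T.Fi 0 * T.Ri 1 * T.F 0 := by
      have := T.Ri_inter (T.RF12 0)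
      simp only [zero_add] at this
      exact (T.FF 1).rcan ((T.FF 0).lcan (tl fun x => by
        simp only [mul_assoc, ra2 (T.FF 1).r, ra2 (T.FF 0).l, one_mul,
          ra3 this.symm]))
    have e3 : T.H 0 * T.K 1 = T.K 1 * T.K 0 * (T.F 1 * T.F 0) := H_K 0
    have e4 : T.K 1 * T.G 0 = T.Fi 0 * T.Fi 1 * T.K 0 * T.K 1 := by
      rw [← G_K_comm 0]; exact G_K 0
    have c1 : T.F 1 * (p * Y) = p * Y * T.F 1 := (T.F_comm (n := 1) mpY).symm
    have c2 : h * T.Ri 1 = T.Ri 1 * h := T.Ri_comm (n := 1) mh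
    have e5 : T.R 0 * T.K 1 = T.Ri 1 * T.K 0 * T.K 1 := T.R1K2 0
    rw [e1]
    generalize p * Y = z at *
    refine tl fun x => ?_
    simp only [mul_assoc, ra2 e4, ra2 e3, ra2 (T.FF 0).l, one_mul, ra2 c1, ra3 e2, ra2 hh, ra2 e5,
      ra2 c2]
  have e := T.tr_eq (mul_mem (T.K_mem 0) mW) (ad_mem mI) key
  rw [T.cap (n := 0) mW, e]

theorem phInv_of_weight (hf : Inv2 (T.tr 1 (T.F 0)) fi) (hf' : Inv2 (T.tr 1 (T.Fi 0)) fi')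
    (m : fi ∈ T.S 1) (m' : fi' ∈ T.S 1) : PhInv T (T.pIw (fi' * fi)) := by
  obtain ⟨h, mh, h1, h2⟩ := T.exists_cupF
  have mI : ∀ X, T.pIw (fi' * fi) X ∈ T.S 1 := fun X => T.tr_mem 1 _
  have key : ∀ Y ∈ T.S 1, T.K 0 * T.cp Y 1 =
      μ • (T.K 0 * T.ad (T.pIw (fi' * fi) Y) * T.Ri 0) := by
    intro Y hY
    have e := pIw_spec hY (mul_mem m' m) mh h1
    have mY := mul_mem (mul_mem m' m) hY
    have mH : T.Fi 0 * h * T.F 0 ∈ T.S 2 :=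
      mul_mem (mul_mem (T.Fi_mem 0) (T.sm mh)) (T.F_mem 0)
    have c : fi' * fi * Y * (T.Fi 0 * h * T.F 0) = T.Fi 0 * h * T.F 0 * (fi' * fi * Y) := by
      refine T.cup_cancel (n := 1) (mul_mem (T.sm mY) mH) (mul_mem mH (T.sm mY)) ?_
      have c1 := T.F_comm (n := 1) mY
      have c2 := T.K_comm (n := 1) mY
      generalize fi' * fi * Y = z at *
      rw [mul_assoc, h2, mul_assoc, c2, ← mul_assoc, ← mul_assoc, h2, c1, mul_assoc, c2, mul_assoc]
    have a1 := K_cupF mh h2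
    have a2 := K_F hf
    have e2 : T.K 0 * (fi' * fi * Y * T.Fi 0 * h * T.R 0) =
        (μ⁻¹ * μ⁻¹) • (T.K 0 * T.cp Y 1 * T.R 0) := by
      calc T.K 0 * (fi' * fi * Y * T.Fi 0 * h * T.R 0)
          = T.K 0 * (fi' * fi * Y * (T.Fi 0 * h * T.F 0)) * T.Fi 0 * T.R 0 := tl fun x => by
            simp only [mul_assoc, ra2 (T.FF 0).l, one_mul]
        _ = μ⁻¹ • (T.K 0 * T.H 0 * fi * Y * T.Fi 0 * T.R 0) := by
            rw [c, ← mul_assoc (T.K 0), a1]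
            simp only [smul_mul_assoc]
            congr 1
            exact tl fun x => by simp only [mul_assoc, ra2 hf'.l, one_mul]
        _ = (μ⁻¹ * μ⁻¹) • (T.K 0 * T.cp Y 1 * T.R 0) := by
            rw [cp1, ← mul_assoc (T.K 0), ← mul_assoc (T.K 0), a2]
            simp only [smul_mul_assoc, smul_smul, mul_assoc]
            rw [inv_mul_cancel₀ T.mu0, mul_one]
    rw [e2] at e
    refine (T.RR 0).rcan ?_
    rw [smul_mul_assoc, mul_assoc (T.K 0 * _), (T.RR 0).r, mul_one, ← mul_one (T.K 0 * _ * T.R 0)]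
    have e3 := congrArg ((μ * μ) • ·) e
    simp only [smul_smul] at e3
    rw [show μ * μ * (μ⁻¹ * μ⁻¹) = 1 by field_simp [T.mu0], one_smul,
      show μ * μ * μ⁻¹ = μ by field_simp [T.mu0]] at e3
    rw [mul_one, e3]
  have can : ∀ X ∈ T.S 1, ∀ Y ∈ T.S 1, T.K 0 * T.cp X 1 = T.K 0 * T.cp Y 1 → X = Y := by
    intro X hX Y hY e
    rw [cp1, cp1, ← mul_assoc, ← mul_assoc, ← mul_assoc, ← mul_assoc, K_F hf] at e
    have e1 := (T.FF 0).symm.rcan e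
    simp only [smul_mul_assoc] at e1
    have e2 := T.smul_mu_inj e1
    simp only [mul_assoc] at e2
    have e3 := T.cap_cancel (n := 0) (mul_mem (H_mem 0) (mul_mem m hX))
      (mul_mem (H_mem 0) (mul_mem m hY)) e2
    exact hf.symm.lcan ((GH 0).symm.lcan e3)
  have canad : ∀ X ∈ T.S 1, ∀ Y ∈ T.S 1, T.K 0 * T.ad X * T.Ri 0 = T.K 0 * T.ad Y * T.Ri 0 →
      X = Y := by
    intro X hX Y hY e
    have e1 := T.cap_cancel (n := 0) (ad_mem hX) (ad_mem hY) ((T.RR 0).symm.rcan e)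
    rw [ad, ad] at e1
    exact (GH 0).symm.lcan ((GH 0).rcan e1)
  refine ⟨fun X _ => mI X, fun X hX => ?_, fun X hX => ?_⟩
  · refine canad _ (mI _) _ hX (T.smul_mu_inj ?_)
    rw [← K_cp_ph hX, key _ (ph_mem X)]
  · refine can _ (ph_mem _) _ hX ?_
    rw [K_cp_ph (mI X), key _ hX]

end inverse
end Tower
end QMA
end

noncomputable section
namespace QMA
open Finset

/-- A family of mutually commuting systems of matrix units over a coefficient algebra. -/
structure Units (N : ℕ) (A E : Type*) [Ring A] [Algebra ℂ A] [Ring E] [Algebra ℂ E] where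
  lam : A →ₐ[ℂ] E
  e : ℕ → Fin N → Fin N → E
  e_mul : ∀ n i j k l, e n i j * e n k l = if j = k then e n i l else 0
  e_one : ∀ n, ∑ i, e n i i = 1
  e_comm : ∀ n m i j k l, n ≠ m → e n i j * e m k l = e m k l * e n i j
  lam_e : ∀ a n i j, lam a * e n i j = e n i j * lam a

/-- The matrix units acting on functions of infinitely many indices. -/
def Units.fn (N : ℕ) [NeZero N] (A : Type*) [Ring A] [Algebra ℂ A] :
    Units N A (Module.End ℂ ((ℕ → Fin N) → A)) where
  lam := Algebra.lsmul ℂ ℂ ((ℕ → Fin N) → A)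
  e n i j :=
    { toFun := fun v a => if a n = i then v (Function.update a n j) else 0
      map_add' := fun v w => by ext a; simp only [Pi.add_apply]; split_ifs <;> simp
      map_smul' := fun c v => by ext a; simp only [Pi.smul_apply]; split_ifs <;> simp }
  e_mul n i j k l := by
    ext v a
    by_cases h : j = k <;> by_cases h' : a n = i <;> simp [h, h']
  e_one n := by
    ext v a
    simp [LinearMap.sum_apply, Finset.sum_apply]
  e_comm n m i j k l h := by
    ext v a
    by_cases h1 : a n = i <;> by_cases h2 : a m = k <;>
      simp [h1, h2, Function.update_of_ne h, Function.update_of_ne h.symm,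
        Function.update_comm h]
  lam_e a n i j := by
    ext v b
    by_cases h : b n = i <;> simp [h]

theorem Units.fn_inj (N : ℕ) [NeZero N] (A : Type*) [Ring A] [Algebra ℂ A] :
    Function.Injective (Units.fn N A).lam := fun a b h => by
  have := congrFun (LinearMap.congr_fun h (fun _ => 1)) (fun _ => 0)
  simpa [Units.fn] using this

/-- The block of an operator at given values of the last index. -/
def slice {N n : ℕ} {A : Type*} (X : MatV N (n + 1) A) (i j : Fin N) : MatV N n A :=
  fun a b => X (Fin.snoc a i) (Fin.snoc b j)

section slice
variable {N n : ℕ} {A : Type*}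

theorem slice_ext {X Y : MatV N (n + 1) A} (h : ∀ i j, slice X i j = slice Y i j) : X = Y := by
  ext a b
  have := congrFun (congrFun (h (a (Fin.last n)) (b (Fin.last n))) (Fin.init a)) (Fin.init b)
  simpa only [slice, Fin.snoc_init_self] using this

variable [Ring A]

theorem slice_add (X Y : MatV N (n + 1) A) (i j : Fin N) :
    slice (X + Y) i j = slice X i j + slice Y i j := rfl

theorem slice_one (i j : Fin N) :
    slice (1 : MatV N (n + 1) A) i j = if i = j then 1 else 0 := by
  ext a b
  by_cases h : i = j
  · subst h
    by_cases h' : a = b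
    · subst h'
      simp [slice]
    · have : (Fin.snoc a i : Fin (n + 1) → Fin N) ≠ Fin.snoc b i := fun e =>
        h' (Fin.snoc_inj.mp e).1
      simp [slice, Matrix.one_apply_ne this, Matrix.one_apply_ne h']
  · have : (Fin.snoc a i : Fin (n + 1) → Fin N) ≠ Fin.snoc b j := fun e =>
      h (Fin.snoc_inj.mp e).2
    simp [slice, h, Matrix.one_apply_ne this]

theorem slice_mul (X Y : MatV N (n + 1) A) (i j : Fin N) :
    slice (X * Y) i j = ∑ k, slice X i k * slice Y k j := by
  ext a b
  simp only [slice, Matrix.mul_apply, Matrix.sum_apply]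
  rw [← (Fin.snocEquiv fun _ => Fin N).sum_comp, Fintype.sum_prod_type]
  rfl

theorem ptrace_eq (D : Matrix (Fin N) (Fin N) A) (X : MatV N (n + 1) A) :
    ptrace D X = fun a b => ∑ m, ∑ c, D m c * slice X c m a b := rfl

theorem slice_ext1 (X : MatV N n A) (i j : Fin N) :
    slice (ext1 X) i j = if i = j then X else 0 := by
  ext a b
  by_cases h : i = j <;> simp [slice, ext1, h]

end slice

namespace Units
variable {N : ℕ} {A E : Type*} [Ring A] [Algebra ℂ A] [Ring E] [Algebra ℂ E] (u : Units N A E)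

/-- The action of an operator on the strands `p, …, p + n - 1`. -/
def act (p : ℕ) : (n : ℕ) → MatV N n A → E
  | 0, X => u.lam (X (fun i => i.elim0) (fun i => i.elim0))
  | n + 1, X => ∑ i, ∑ j, act p n (slice X i j) * u.e (p + n) i j

theorem act_succ (p n : ℕ) (X : MatV N (n + 1) A) :
    u.act p (n + 1) X = ∑ i, ∑ j, u.act p n (slice X i j) * u.e (p + n) i j := rfl

theorem act_e {p n m : ℕ} (X : MatV N n A) (h : m < p ∨ p + n ≤ m) (k l : Fin N) :
    u.act p n X * u.e m k l = u.e m k l * u.act p n X := by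
  induction n with
  | zero => exact u.lam_e _ _ _ _
  | succ n ih =>
    simp only [act_succ, Finset.sum_mul, Finset.mul_sum, mul_assoc]
    refine Finset.sum_congr rfl fun i _ => Finset.sum_congr rfl fun j _ => ?_
    rw [u.e_comm _ m _ _ _ _ (by omega), ← mul_assoc, ih _ (by omega), mul_assoc]

theorem act_add (p : ℕ) {n : ℕ} (X Y : MatV N n A) :
    u.act p n (X + Y) = u.act p n X + u.act p n Y := by
  induction n with
  | zero => exact map_add _ _ _
  | succ n ih => simp only [act_succ, slice_add, ih, add_mul, Finset.sum_add_distrib]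

theorem act_smul (p : ℕ) {n : ℕ} (c : ℂ) (X : MatV N n A) :
    u.act p n (c • X) = c • u.act p n X := by
  induction n with
  | zero => exact map_smul _ _ _
  | succ n ih =>
    have : ∀ i j, slice (c • X) i j = c • slice X i j := fun i j => rfl
    simp only [act_succ, this, ih, smul_mul_assoc, Finset.smul_sum]

/-- The action as a linear map. -/
def actL (p n : ℕ) : MatV N n A →ₗ[ℂ] E where
  toFun := u.act p n
  map_add' := u.act_add p
  map_smul' := u.act_smul p

theorem act_zero (p n : ℕ) : u.act p n 0 = 0 := (u.actL p n).map_zero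

theorem act_sum (p n : ℕ) {ι : Type*} (s : Finset ι) (f : ι → MatV N n A) :
    u.act p n (∑ i ∈ s, f i) = ∑ i ∈ s, u.act p n (f i) := map_sum (u.actL p n) f s

theorem act_one (p n : ℕ) : u.act p n 1 = 1 := by
  induction n with
  | zero => exact (congrArg u.lam (Matrix.one_apply_eq _)).trans (map_one _)
  | succ n ih =>
    simp only [act_succ, slice_one, apply_ite (u.act p n), ih, act_zero, ite_mul, one_mul,
      zero_mul, Finset.sum_ite_eq, Finset.mem_univ, if_true, u.e_one]

theorem act_mul (p : ℕ) {n : ℕ} (X Y : MatV N n A) :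
    u.act p n (X * Y) = u.act p n X * u.act p n Y := by
  induction n with
  | zero =>
    refine Eq.trans (congrArg u.lam ?_) (map_mul u.lam _ _)
    rw [Matrix.mul_apply, Fintype.sum_unique]
    congr
  | succ n ih =>
    have key : ∀ i j k l, u.act p n (slice X i j) * u.e (p + n) i j *
        (u.act p n (slice Y k l) * u.e (p + n) k l) =
        if j = k then u.act p n (slice X i j * slice Y k l) * u.e (p + n) i l else 0 := by
      intro i j k l
      rw [mul_assoc, ← mul_assoc (u.e _ _ _), ← u.act_e _ (by omega), mul_assoc, u.e_mul, ih]
      split_ifs <;> simp [mul_assoc]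
    simp only [act_succ, slice_mul, act_sum, Finset.sum_mul]
    simp only [Finset.mul_sum, key]
    refine Finset.sum_congr rfl fun i _ => ?_
    rw [Finset.sum_comm]
    refine Finset.sum_congr rfl fun j _ => ?_
    symm
    rw [Finset.sum_eq_single j]
    · simp
    · intro b _ hb
      simp [hb.symm]
    · simp

/-- The action as an algebra homomorphism. -/
def actH (p n : ℕ) : MatV N n A →ₐ[ℂ] E :=
  AlgHom.ofLinearMap (u.actL p n) (u.act_one p n) (u.act_mul p)

theorem coef {n : ℕ} {x : Fin N → Fin N → E}
    (hx : ∀ i j k l, x i j * u.e n k l = u.e n k l * x i j) (a b : Fin N) :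
    ∑ k, u.e n k a * (∑ i, ∑ j, x i j * u.e n i j) * u.e n b k = x a b := by
  have key : ∀ k, u.e n k a * (∑ i, ∑ j, x i j * u.e n i j) * u.e n b k = x a b * u.e n k k := by
    intro k
    simp only [Finset.mul_sum, Finset.sum_mul]
    rw [Finset.sum_eq_single a, Finset.sum_eq_single b]
    · rw [← mul_assoc, ← hx, mul_assoc, mul_assoc, u.e_mul, if_pos rfl, u.e_mul, if_pos rfl]
    · intro c _ hc
      rw [mul_assoc, mul_assoc, u.e_mul, if_neg hc, mul_zero, mul_zero]
    · simp
    · intro c _ hc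
      refine Finset.sum_eq_zero fun j _ => ?_
      rw [← mul_assoc, ← hx, mul_assoc (x c j), u.e_mul, if_neg hc.symm, mul_zero, zero_mul]
    · simp
  simp only [key, ← Finset.mul_sum, u.e_one, mul_one]

theorem coef_inj {n : ℕ} {x y : Fin N → Fin N → E}
    (hx : ∀ i j k l, x i j * u.e n k l = u.e n k l * x i j)
    (hy : ∀ i j k l, y i j * u.e n k l = u.e n k l * y i j)
    (h : ∑ i, ∑ j, x i j * u.e n i j = ∑ i, ∑ j, y i j * u.e n i j) : x = y := by
  ext a b
  rw [← u.coef hx, ← u.coef hy, h]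

theorem act_inj (hu : Function.Injective u.lam) (p n : ℕ) : Function.Injective (u.act p n) := by
  induction n with
  | zero =>
    intro X Y h
    ext a b
    have := hu h
    rwa [Subsingleton.elim a (fun i => i.elim0), Subsingleton.elim b (fun i => i.elim0)]
  | succ n ih =>
    intro X Y h
    refine slice_ext fun i j => ih ?_
    exact congrFun (congrFun (u.coef_inj (x := fun i j => u.act p n (slice X i j))
      (y := fun i j => u.act p n (slice Y i j)) (fun i j k l => u.act_e _ (by omega) _ _)
      (fun i j k l => u.act_e _ (by omega) _ _) h) i) j

theorem act_ext1 (p : ℕ) {n : ℕ} (X : MatV N n A) : u.act p (n + 1) (ext1 X) = u.act p n X := by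
  simp only [act_succ, slice_ext1, apply_ite (u.act p n), act_zero, ite_mul, zero_mul,
    Finset.sum_ite_eq, Finset.mem_univ, if_true, ← Finset.mul_sum, u.e_one, mul_one]

end Units
end QMA
end

noncomputable section
namespace QMA
open Finset

section slice
variable {N n : ℕ} [NeZero N] {A : Type*} [Ring A]

theorem idx_snoc_last (a : Fin n → Fin N) (i : Fin N) :
    idx (Fin.snoc a i : Fin (n + 1) → Fin N) n = i := by
  rw [idx, dif_pos (Nat.lt_succ_self n)]
  exact Fin.snoc_last (α := fun _ => Fin N) i a

theorem idx_snoc_lt {p : ℕ} (h : p < n) (a : Fin n → Fin N) (i : Fin N) :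
    idx (Fin.snoc a i : Fin (n + 1) → Fin N) p = idx a p := by
  rw [idx, dif_pos (by omega), idx, dif_pos h]
  exact Fin.snoc_castSucc (α := fun _ => Fin N) i a ⟨p, h⟩

theorem slice_lift2_top (X : MatV N 2 A) (i i' j j' : Fin N) :
    slice (slice (lift2 n X : MatV N (n + 2) A) i' j') i j =
      Matrix.diagonal fun _ => X ![i, i'] ![j, j'] := by
  ext a b
  have h : (∀ m : Fin (n + 2), (m : ℕ) = n ∨ (m : ℕ) = n + 1 ∨
      (Fin.snoc (Fin.snoc a i : Fin (n + 1) → Fin N) i' : Fin (n + 2) → Fin N) m =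
      (Fin.snoc (Fin.snoc b j : Fin (n + 1) → Fin N) j' : Fin (n + 2) → Fin N) m) ↔ a = b := by
    rw [Fin.forall_fin_succ', Fin.forall_fin_succ']
    simp only [Fin.val_castSucc, Fin.val_last, Fin.snoc_castSucc, Fin.snoc_last, true_or, or_true,
      and_true]
    constructor
    · intro h
      ext m
      rcases h m with h | h | h
      · have := m.2; omega
      · have := m.2; omega
      · rw [h]
    · rintro rfl m
      simp
  simp only [slice, lift2, h]
  rw [idx_snoc_lt (Nat.lt_succ_self n), idx_snoc_lt (Nat.lt_succ_self n)]
  simp only [idx_snoc_last, Matrix.diagonal_apply]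

theorem lift2_ext1 {p : ℕ} (h : p + 2 ≤ n) (X : MatV N 2 A) :
    (lift2 p X : MatV N (n + 1) A) = ext1 (lift2 p X) := by
  refine slice_ext fun i j => ?_
  rw [slice_ext1]
  ext a b
  have h' : (∀ m : Fin (n + 1), (m : ℕ) = p ∨ (m : ℕ) = p + 1 ∨
      (Fin.snoc a i : Fin (n + 1) → Fin N) m = (Fin.snoc b j : Fin (n + 1) → Fin N) m) ↔
      (∀ m : Fin n, (m : ℕ) = p ∨ (m : ℕ) = p + 1 ∨ a m = b m) ∧ i = j := by
    rw [Fin.forall_fin_succ']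
    simp only [Fin.val_castSucc, Fin.val_last, Fin.snoc_castSucc, Fin.snoc_last]
    have h1 : n ≠ p := by omega
    have h2 : n ≠ p + 1 := by omega
    simp only [h1, h2, false_or]
  simp only [slice, lift2, h']
  rw [idx_snoc_lt (by omega), idx_snoc_lt (by omega), idx_snoc_lt (by omega),
    idx_snoc_lt (by omega)]
  by_cases hij : i = j <;> simp [hij, lift2]

theorem slice_lift1_top (X : Matrix (Fin N) (Fin N) A) (i j : Fin N) :
    slice (lift1 n X : MatV N (n + 1) A) i j = Matrix.diagonal fun _ => X i j := by
  ext a b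
  have h : (∀ m : Fin (n + 1), (m : ℕ) = n ∨
      (Fin.snoc a i : Fin (n + 1) → Fin N) m =
      (Fin.snoc b j : Fin (n + 1) → Fin N) m) ↔ a = b := by
    rw [Fin.forall_fin_succ']
    simp only [Fin.val_castSucc, Fin.val_last, Fin.snoc_castSucc, Fin.snoc_last, true_or, or_true,
      and_true]
    constructor
    · intro h
      ext m
      rcases h m with h | h
      · have := m.2; omega
      · rw [h]
    · rintro rfl m
      simp
  simp only [slice, lift1, h]
  simp only [idx_snoc_last, Matrix.diagonal_apply]

theorem lift1_ext1 {p : ℕ} (h : p + 1 ≤ n) (X : Matrix (Fin N) (Fin N) A) :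
    (lift1 p X : MatV N (n + 1) A) = ext1 (lift1 p X) := by
  refine slice_ext fun i j => ?_
  rw [slice_ext1]
  ext a b
  have h' : (∀ m : Fin (n + 1), (m : ℕ) = p ∨
      (Fin.snoc a i : Fin (n + 1) → Fin N) m = (Fin.snoc b j : Fin (n + 1) → Fin N) m) ↔
      (∀ m : Fin n, (m : ℕ) = p ∨ a m = b m) ∧ i = j := by
    rw [Fin.forall_fin_succ']
    simp only [Fin.val_castSucc, Fin.val_last, Fin.snoc_castSucc, Fin.snoc_last]
    have h1 : n ≠ p := by omega
    simp only [h1, false_or]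
  simp only [slice, lift1, h']
  rw [idx_snoc_lt (by omega), idx_snoc_lt (by omega)]
  by_cases hij : i = j <;> simp [hij, lift1]

end slice

namespace Units
variable {N : ℕ} {A E : Type*} [Ring A] [Algebra ℂ A] [Ring E] [Algebra ℂ E] (u : Units N A E)

/-- An `N × N` matrix acting on the strand `p`. -/
def mat (p : ℕ) (X : Matrix (Fin N) (Fin N) A) : E := ∑ i, ∑ j, u.lam (X i j) * u.e p i j

theorem act_diag (p n : ℕ) (c : A) :
    u.act p n (Matrix.diagonal fun _ => c) = u.lam c := by
  induction n with
  | zero => exact congrArg u.lam (Matrix.diagonal_apply_eq _ _)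
  | succ n ih =>
    have : ∀ i j, slice (Matrix.diagonal fun _ => c : MatV N (n + 1) A) i j =
        if i = j then Matrix.diagonal fun _ => c else 0 := by
      intro i j
      have h : (Matrix.diagonal fun _ => c : MatV N (n + 1) A) =
          ext1 (Matrix.diagonal fun _ => c) := by
        ext a b
        have : a = b ↔ a (Fin.last n) = b (Fin.last n) ∧ Fin.init a = Fin.init b := by
          rw [and_comm, ← Fin.snoc_inj (α := fun _ => Fin N), Fin.snoc_init_self,
            Fin.snoc_init_self]
        simp only [Matrix.diagonal_apply, ext1, this, ite_and, Fin.init]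
        rfl
      rw [h, slice_ext1]
    simp only [act_succ, this, apply_ite (u.act p n), ih, act_zero, ite_mul, zero_mul,
      Finset.sum_ite_eq, Finset.mem_univ, if_true, ← Finset.mul_sum, u.e_one, mul_one]

theorem act_two (p : ℕ) (X : MatV N 2 A) :
    u.act p 2 X = ∑ i', ∑ j', (∑ i, ∑ j, u.lam (X ![i, i'] ![j, j']) * u.e p i j) *
      u.e (p + 1) i' j' := by
  have : ∀ i i' : Fin N, (Fin.snoc (Fin.snoc (fun i => i.elim0 : Fin 0 → Fin N) i :
      Fin 1 → Fin N) i' : Fin 2 → Fin N) = ![i, i'] := by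
    intro i i'
    ext m
    fin_cases m <;> rfl
  simp only [act, slice, this]
  rfl

theorem act_one_strand (p : ℕ) (X : MatV N 1 A) : u.act p 1 X = u.mat p (toN X) := by
  have : ∀ i : Fin N, (Fin.snoc (fun i => i.elim0 : Fin 0 → Fin N) i :
      Fin 1 → Fin N) = fun _ => i := by
    intro i
    ext m
    fin_cases m; rfl
  simp only [act, slice, this]
  rfl

variable [NeZero N]

theorem act_lift2 (p : ℕ) {n j : ℕ} (h : j + 2 ≤ n) (X : MatV N 2 A) :
    u.act p n (lift2 j X) = u.act (p + j) 2 X := by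
  induction n with
  | zero => omega
  | succ n ih =>
    rcases Nat.lt_or_ge n (j + 2) with h' | h'
    · obtain rfl : n = j + 1 := by omega
      rw [act_two]
      simp only [act_succ, slice_lift2_top, act_diag, add_assoc]
    · rw [lift2_ext1 h', act_ext1, ih h']

theorem act_lift1 (p : ℕ) {n j : ℕ} (h : j + 1 ≤ n) (X : Matrix (Fin N) (Fin N) A) :
    u.act p n (lift1 j X) = u.mat (p + j) X := by
  induction n with
  | zero => omega
  | succ n ih =>
    rcases Nat.lt_or_ge n (j + 1) with h' | h'
    · obtain rfl : n = j := by omega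
      simp only [act_succ, slice_lift1_top, act_diag, mat]
    · rw [lift1_ext1 h', act_ext1, ih h']

end Units
end QMA
end

noncomputable section
namespace QMA
open Finset

/-! ### The operator `K` on two strands -/

section twoStrand
variable {N : ℕ} {q μ : ℂ} {R : MatV N 2 ℂ}

theorem mul_apply_two {A : Type*} [Ring A] (X Y : MatV N 2 A) (a b : Fin 2 → Fin N) :
    (X * Y) a b = ∑ k, ∑ l, X a ![k, l] * Y ![k, l] b := by
  rw [Matrix.mul_apply, ← (finTwoArrowEquiv (Fin N)).symm.sum_comp, Fintype.sum_prod_type]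
  rfl

theorem ext_two {A : Type*} {X Y : MatV N 2 A}
    (h : ∀ a b c d, X ![a, b] ![c, d] = Y ![a, b] ![c, d]) : X = Y := by
  ext a b
  have := h (a 0) (a 1) (b 0) (b 1)
  have e : ∀ a : Fin 2 → Fin N, ![a 0, a 1] = a := fun a => by
    ext m; fin_cases m <;> rfl
  rwa [e, e] at this

theorem bmwK_comm : bmwK q μ R * R = R * bmwK q μ R := by
  simp only [bmwK, smul_mul_assoc, mul_smul_comm]
  congr 1
  noncomm_ring

variable [NeZero N]

theorem bmwK_R (h : IsBMW q μ R) : bmwK q μ R * R = μ • bmwK q μ R := by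
  have h1 : bmwK q μ R * (μ • 1 - R) = 0 := by rw [bmwK, smul_mul_assoc, h.1, smul_zero]
  rw [mul_sub, mul_smul_comm, mul_one, sub_eq_zero] at h1
  exact h1.symm

theorem bmwK_def (hq : q ≠ 0) (hl : q - q⁻¹ ≠ 0) (hm : μ ≠ 0) (hR : IsUnit R.det)
    (h : IsBMW q μ R) : bmwK q μ R = (q - q⁻¹)⁻¹ • (R⁻¹ - R) + 1 := by
  have e1 : R * R⁻¹ = 1 := Matrix.mul_nonsing_inv _ hR
  have hK : bmwK q μ R * R⁻¹ = μ⁻¹ • bmwK q μ R := by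
    rw [eq_inv_smul_iff₀ hm, ← smul_mul_assoc, ← bmwK_R h, mul_assoc, e1, mul_one]
  have h2 : bmwK q μ R = μ • (bmwK q μ R * R⁻¹) := by
    rw [hK, smul_smul, mul_inv_cancel₀ hm, one_smul]
  rw [h2]
  have h3 : (q • (1 : MatV N 2 ℂ) - R) * (q⁻¹ • (1 : MatV N 2 ℂ) + R) * R⁻¹ =
      R⁻¹ + (q - q⁻¹) • 1 - R := by
    simp only [sub_mul, mul_add, add_mul, smul_mul_assoc, mul_smul_comm, one_mul, mul_one,
      mul_assoc, e1, smul_smul, mul_inv_cancel₀ hq,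
      smul_add, one_smul]
    match_scalars <;> field_simp <;> ring
  rw [bmwK, smul_mul_assoc, h3, smul_smul, mul_inv_cancel_left₀ hm, smul_sub, smul_add, smul_smul,
    inv_mul_cancel₀ hl, one_smul, smul_sub]
  abel

end twoStrand

section rankOne
variable {N : ℕ}

/-- A rank one two-strand operator with nondegenerate factors. -/
structure Rank1 (K : MatV N 2 ℂ) (U W : Matrix (Fin N) (Fin N) ℂ) : Prop where
  eq : ∀ a b i j, K ![a, b] ![i, j] = U a b * W i j
  hU : IsUnit U.det
  hW : IsUnit W.det

theorem exists_rank1 {K : MatV N 2 ℂ} {D : Matrix (Fin N) (Fin N) ℂ} {c : ℂ} (hK : K ≠ 0)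
    (hc : c ≠ 0) (hD : IsUnit D.det)
    (h : ∀ x y a b f g, ∑ d, K ![a, b] ![y, d] * K ![x, d] ![f, g] =
      c * D x y * K ![a, b] ![f, g]) :
    ∃ U W, Rank1 K U W := by
  obtain ⟨a0, b0, f0, g0, h0⟩ : ∃ a b f g, K ![a, b] ![f, g] ≠ 0 := by
    by_contra! hn
    exact hK (ext_two hn)
  let U : Matrix (Fin N) (Fin N) ℂ := Matrix.of fun a b => K ![a, b] ![f0, g0]
  let X : Fin N → Fin N → Matrix (Fin N) (Fin N) ℂ := fun a b =>
    Matrix.of fun i j => K ![a, b] ![i, j]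
  have hX : ∀ a b, X a b * U.transpose = (c * U a b) • D.transpose := by
    intro a b
    ext y x
    simp only [Matrix.mul_apply, Matrix.transpose_apply, Matrix.smul_apply, smul_eq_mul, X, U,
      Matrix.of_apply]
    rw [h]; ring
  have hdet := congrArg Matrix.det (hX a0 b0)
  rw [Matrix.det_mul, Matrix.det_smul, Matrix.det_transpose, Matrix.det_transpose] at hdet
  have hr : IsUnit ((c * U a0 b0) ^ Fintype.card (Fin N) * D.det) :=
    ((isUnit_iff_ne_zero.mpr (mul_ne_zero hc h0)).pow _).mul hD
  rw [← hdet] at hr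
  have hU : IsUnit U.det := isUnit_of_mul_isUnit_right hr
  have hU' : IsUnit U.transpose.det := by rwa [Matrix.det_transpose]
  refine ⟨U, c • (D.transpose * U.transpose⁻¹), fun a b i j => ?_, hU, ?_⟩
  · have : X a b = (c * U a b) • (D.transpose * U.transpose⁻¹) := by
      rw [← smul_mul_assoc, ← hX, mul_assoc, Matrix.mul_nonsing_inv _ hU', mul_one]
    have := congrFun (congrFun this i) j
    simp only [X, Matrix.of_apply] at this
    rw [this, Matrix.smul_apply, Matrix.smul_apply, smul_eq_mul, smul_eq_mul]
    ring
  · rw [Matrix.det_smul, Matrix.det_mul, Matrix.det_transpose]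
    exact ((isUnit_iff_ne_zero.mpr hc).pow _).mul
      (hD.mul (Matrix.isUnit_nonsing_inv_det_iff.mpr hU'))

variable [NeZero N]

theorem lift1_zero_apply (X : Matrix (Fin N) (Fin N) ℂ) (a b c d : Fin N) :
    (lift1 0 X : MatV N 2 ℂ) ![a, b] ![c, d] = if b = d then X a c else 0 := by
  simp only [lift1, Fin.forall_fin_two, idx]
  simp

theorem lift1_one_apply (X : Matrix (Fin N) (Fin N) ℂ) (a b c d : Fin N) :
    (lift1 1 X : MatV N 2 ℂ) ![a, b] ![c, d] = if a = c then X b d else 0 := by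
  simp only [lift1, Fin.forall_fin_two, idx]
  simp

variable {K : MatV N 2 ℂ} {U W : Matrix (Fin N) (Fin N) ℂ}

theorem Rank1.left (h : Rank1 K U W) (X : Matrix (Fin N) (Fin N) ℂ) :
    lift1 1 X * K = lift1 0 (U * X.transpose * U⁻¹) * K := by
  refine ext_two fun a b c d => ?_
  have e : (U * X.transpose * U⁻¹) * U = U * X.transpose := by
    rw [mul_assoc, Matrix.nonsing_inv_mul _ h.hU, mul_one]
  have e' := congrFun (congrFun e a) b
  simp only [Matrix.mul_apply (M := U * X.transpose * U⁻¹), Matrix.mul_apply (M := U)] at e'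
  simp only [mul_apply_two, lift1_one_apply, lift1_zero_apply, h.eq, ite_mul, zero_mul]
  simp only [Finset.sum_ite_eq, Finset.mem_univ, if_true, ← mul_assoc, ← Finset.sum_mul]
  rw [Finset.sum_comm]
  simp only [Finset.sum_ite_eq, Finset.mem_univ, if_true, ← mul_assoc, ← Finset.sum_mul, e']
  simp [mul_comm]

theorem Rank1.right (h : Rank1 K U W) (X : Matrix (Fin N) (Fin N) ℂ) :
    K * lift1 1 X = K * lift1 0 (W * X * W⁻¹).transpose := by
  refine ext_two fun a b c d => ?_
  have e : (W * X * W⁻¹) * W = W * X := by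
    rw [mul_assoc, Matrix.nonsing_inv_mul _ h.hW, mul_one]
  generalize W * X * W⁻¹ = Z at e
  have e' := congrFun (congrFun e c) d
  simp only [Matrix.mul_apply] at e'
  simp only [mul_apply_two, lift1_one_apply, lift1_zero_apply, h.eq, mul_ite, mul_zero]
  rw [Finset.sum_comm]
  simp only [Finset.sum_ite_eq, Finset.sum_ite_eq', Finset.mem_univ, if_true, mul_assoc,
    ← Finset.mul_sum, Matrix.transpose_apply, ← e']
  simp only [mul_comm]

end rankOne
end QMA
end

noncomputable section
namespace QMA
open Finset

section words
variable {E : Type*} [Ring E] [Algebra ℂ E]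

/-- The Birman–Murakami–Wenzl relations on three strands. -/
structure Rel3 (q μ : ℂ) (r1 r2 s1 s2 k1 k2 : E) : Prop where
  i1 : Inv2 r1 s1
  i2 : Inv2 r2 s2
  braid : r1 * r2 * r1 = r2 * r1 * r2
  d1 : k1 = (q - q⁻¹)⁻¹ • (s1 - r1) + 1
  d2 : k2 = (q - q⁻¹)⁻¹ • (s2 - r2) + 1
  rk2 : r2 * k2 = μ • k2
  k21 : k2 * k1 = k2 * r1 * r2
  k21' : k2 * k1 = k2 * s1 * s2
  k121 : k1 * k2 * k1 = k1

variable {q μ : ℂ} {r1 r2 s1 s2 k1 k2 : E} (h : Rel3 q μ r1 r2 s1 s2 k1 k2)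
include h

theorem Rel3.k212 : k2 * k1 * k2 = k2 := by
  have b := h.braid
  have e1 : r1 * r2 * k1 = k2 * (r1 * r2) := by
    have : s2 * (r1 * r2) = r1 * r2 * s1 :=
      h.i2.inter h.i1 (tl fun x => by simp only [mul_assoc, ra3 b])
    simp only [h.d1, h.d2, mul_add, add_mul, mul_sub, sub_mul, mul_smul_comm, smul_mul_assoc,
      mul_one, one_mul, this, b]
    simp only [mul_assoc]
  have e2 : r2 * r1 * k2 = k1 * (r2 * r1) := by
    have : s1 * (r2 * r1) = r2 * r1 * s2 :=
      h.i1.inter h.i2 (tl fun x => by simp only [mul_assoc, ra3 b])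
    simp only [h.d1, h.d2, mul_add, add_mul, mul_sub, sub_mul, mul_smul_comm, smul_mul_assoc,
      mul_one, one_mul, this, ← b]
    simp only [mul_assoc]
  have e3 : r1 * k1 = k1 * r1 := by
    simp only [h.d1, mul_add, add_mul, mul_sub, sub_mul, mul_smul_comm, smul_mul_assoc,
      mul_one, one_mul, h.i1.l, h.i1.r]
  have o1 : r1 * r2 * r1 * k1 = k2 * (r1 * r2 * r1) := by
    rw [mul_assoc, e3, ← mul_assoc, e1, mul_assoc]
  have o2 : r1 * r2 * r1 * k2 = k1 * (r1 * r2 * r1) := by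
    rw [mul_assoc r1, mul_assoc, e2, ← mul_assoc, e3, mul_assoc]
  refine ((h.i1.mul h.i2).mul h.i1).lcan ?_
  rw [← mul_assoc, ← mul_assoc, o2, mul_assoc k1, o1, mul_assoc, mul_assoc k2, o2, ← mul_assoc,
    ← mul_assoc, h.k121]

theorem Rel3.k2r1k2 (hm : μ ≠ 0) : k2 * r1 * k2 = μ⁻¹ • k2 := by
  rw [eq_inv_smul_iff₀ hm, ← mul_smul_comm, ← h.rk2, ← mul_assoc, ← h.k21, h.k212]

theorem Rel3.k2s1k2 : k2 * s1 * k2 = μ • k2 := by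
  have : k2 = μ • (s2 * k2) := by
    rw [← mul_smul_comm, ← h.rk2, ← mul_assoc, h.i2.r, one_mul]
  calc k2 * s1 * k2 = k2 * s1 * (μ • (s2 * k2)) := by rw [← this]
    _ = μ • (k2 * s1 * s2 * k2) := by rw [mul_smul_comm]; simp only [mul_assoc]
    _ = μ • k2 := by rw [← h.k21', h.k212]

end words

namespace Units
variable {N : ℕ} {E : Type*} [Ring E] [Algebra ℂ E] (u : Units N ℂ E)

theorem lam_eq (c : ℂ) : u.lam c = c • 1 := by
  rw [← Algebra.algebraMap_eq_smul_one]; exact u.lam.commutes c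

variable {q μ : ℂ} {R : MatV N 2 ℂ}

theorem act_two' (p : ℕ) (X : MatV N 2 ℂ) :
    u.act p 2 X = ∑ b, ∑ d, ∑ a, ∑ c, X ![a, b] ![c, d] • (u.e p a c * u.e (p + 1) b d) := by
  simp only [act_two, lam_eq, Finset.sum_mul, smul_mul_assoc, one_mul]

theorem act_inv (p : ℕ) (hR : IsUnit R.det) : Inv2 (u.act p 2 R) (u.act p 2 R⁻¹) :=
  ⟨by rw [← act_mul, Matrix.mul_nonsing_inv _ hR, act_one],
   by rw [← act_mul, Matrix.nonsing_inv_mul _ hR, act_one]⟩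

variable [NeZero N]

theorem act_lift1_zero_single (p : ℕ) (i j : Fin N) :
    u.act p 2 (lift1 0 (Matrix.single i j 1)) = u.e p i j := by
  rw [u.act_lift1 p (by omega), mat]
  simp only [lam_eq, Matrix.single_apply, ite_smul, one_smul, zero_smul, ite_mul, one_mul,
    zero_mul, ite_and, add_zero]
  simp

theorem rel3 (hq : q ≠ 0) (hl : q - q⁻¹ ≠ 0) (hm : μ ≠ 0) (hR : IsUnit R.det) (hb : IsBraid R)
    (h : IsBMW q μ R) (p : ℕ) :
    Rel3 q μ (u.act p 2 R) (u.act (p + 1) 2 R) (u.act p 2 R⁻¹) (u.act (p + 1) 2 R⁻¹)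
      (u.act p 2 (bmwK q μ R)) (u.act (p + 1) 2 (bmwK q μ R)) := by
  have l0 : ∀ X, u.act p 3 (lift2 0 X) = u.act p 2 X := fun X => u.act_lift2 p (by omega) X
  have l1 : ∀ X, u.act p 3 (lift2 1 X) = u.act (p + 1) 2 X := fun X => u.act_lift2 p (by omega) X
  have hd : ∀ p, u.act p 2 (bmwK q μ R) =
      (q - q⁻¹)⁻¹ • (u.act p 2 R⁻¹ - u.act p 2 R) + 1 := fun p => by
    rw [bmwK_def hq hl hm hR h]
    exact (map_add (u.actH p 2) _ _).trans
      (congrArg₂ _ ((map_smul (u.actH p 2) _ _).trans (congrArg _ (map_sub (u.actH p 2) _ _)))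
        (u.act_one p 2))
  have kr := bmwK_R h
  obtain ⟨-, h2, h3, h4⟩ := h
  refine ⟨u.act_inv p hR, u.act_inv (p + 1) hR, ?_, hd p, hd (p + 1), ?_, ?_, ?_, ?_⟩
  · simpa only [act_mul, l0, l1] using congrArg (u.act p 3) hb
  · rw [← act_mul, ← bmwK_comm, kr, act_smul]
  · simpa only [act_mul, l0, l1] using congrArg (u.act p 3) h2
  · simpa only [act_mul, l0, l1] using congrArg (u.act p 3) h3
  · simpa only [act_mul, l0, l1] using congrArg (u.act p 3) h4

end Units

theorem sum_comm_pairs {M ι κ : Type*} [AddCommMonoid M] [Fintype ι] [Fintype κ]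
    (f : ι → ι → κ → κ → M) :
    ∑ a, ∑ c, ∑ b, ∑ d, f a c b d = ∑ b, ∑ d, ∑ a, ∑ c, f a c b d := by
  calc ∑ a, ∑ c, ∑ b, ∑ d, f a c b d = ∑ a, ∑ b, ∑ d, ∑ c, f a c b d :=
        Finset.sum_congr rfl fun a _ => Finset.sum_comm.trans
          (Finset.sum_congr rfl fun b _ => Finset.sum_comm)
    _ = ∑ b, ∑ a, ∑ d, ∑ c, f a c b d := Finset.sum_comm
    _ = _ := Finset.sum_congr rfl fun b _ => Finset.sum_comm

section skew
variable {N : ℕ} [NeZero N]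

theorem skew_sandwich {K X Ψ : MatV N 2 ℂ} (hΨ : SkewPair X Ψ) {c : ℂ}
    (h : (Units.fn N ℂ).act 1 2 K * (Units.fn N ℂ).act 0 2 X * (Units.fn N ℂ).act 1 2 K =
      c • (Units.fn N ℂ).act 1 2 K) (x y : Fin N) :
    K * lift1 0 (Matrix.single y x 1) * K = (c * Dof Ψ x y) • K := by
  set u := Units.fn N ℂ
  refine u.act_inj (Units.fn_inj N ℂ) 1 2 ?_
  rw [u.act_mul, u.act_mul, u.act_lift1_zero_single, u.act_smul]
  set k := u.act 1 2 K with hk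
  have ke : ∀ i j, k * u.e 0 i j = u.e 0 i j * k := fun i j => u.act_e _ (by omega) i j
  let Z : Fin N → Fin N → _ := fun b d => k * u.e 1 b d * k
  have h1 : ∑ a, ∑ c, (∑ b, ∑ d, X ![a, b] ![c, d] • Z b d) * u.e 0 a c =
      ∑ a, ∑ b, (if a = b then c • k else 0) * u.e 0 a b := by
    have h2 : ∑ a, ∑ b, (if a = b then c • k else 0) * u.e 0 a b = c • k := by
      simp only [ite_mul, zero_mul, Finset.sum_ite_eq, Finset.mem_univ, if_true,
        ← Finset.mul_sum, u.e_one, mul_one]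
    rw [h2, ← h, u.act_two']
    simp only [Finset.mul_sum, Finset.sum_mul, mul_smul_comm, smul_mul_assoc]
    rw [sum_comm_pairs]
    refine Finset.sum_congr rfl fun b _ => Finset.sum_congr rfl fun d _ =>
      Finset.sum_congr rfl fun a _ => Finset.sum_congr rfl fun c _ => ?_
    simp only [Z]
    rw [mul_assoc _ k, ke, ← mul_assoc, mul_assoc k, u.e_comm 1 0 _ _ _ _ one_ne_zero]
  have zc : ∀ b d i j, Z b d * u.e 0 i j = u.e 0 i j * Z b d := fun b d i j => by
    simp only [Z]
    rw [mul_assoc, ke, ← mul_assoc, mul_assoc k, u.e_comm 1 0 _ _ _ _ one_ne_zero, ← mul_assoc, ke,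
      mul_assoc, mul_assoc, mul_assoc]
  have h3 := u.coef_inj (n := 0) 
    (fun i j a b => by
      simp only [Finset.mul_sum, Finset.sum_mul, mul_smul_comm, smul_mul_assoc, zc])
    (fun i j a b => by
      split_ifs
      · rw [smul_mul_assoc, mul_smul_comm, ke]
      · rw [zero_mul, mul_zero]) h1
  have h4 : ∀ a c', (∑ b, ∑ d, X ![a, b] ![c', d] • Z b d) = if a = c' then c • k else 0 :=
    fun a c' => congrFun (congrFun h3 a) c'
  have h5 : ∑ m, ∑ c', Ψ ![x, m] ![y, c'] • (∑ b, ∑ d, X ![c', b] ![m, d] • Z b d) =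
      (c * Dof Ψ x y) • k := by
    simp only [h4, smul_ite, smul_zero, Finset.sum_ite_eq', Finset.mem_univ, if_true, smul_smul,
      ← Finset.sum_smul, Dof, Finset.mul_sum, mul_comm]
  rw [← h5]
  simp only [Finset.smul_sum, smul_smul]
  rw [sum_comm_pairs]
  simp only [← Finset.sum_smul, hΨ.2, ite_smul, one_smul, zero_smul, ite_and]
  simp [Z]

theorem sandwich_apply {K : MatV N 2 ℂ} {c : ℂ} {x y : Fin N}
    (h : K * lift1 0 (Matrix.single y x 1) * K = c • K) (a b f g : Fin N) :
    ∑ d, K ![a, b] ![y, d] * K ![x, d] ![f, g] = c * K ![a, b] ![f, g] := by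
  have := congrFun (congrFun h ![a, b]) ![f, g]
  rw [Matrix.smul_apply, smul_eq_mul] at this
  rw [← this]
  simp only [mul_apply_two, lift1_zero_apply, Matrix.single_apply, mul_ite, mul_zero, mul_one,
    Finset.sum_mul, ite_mul, zero_mul, ite_and]
  simp

end skew
end QMA
end

noncomputable section
namespace QMA
open Finset

namespace Units
variable {N : ℕ} {A E : Type*} [Ring A] [Algebra ℂ A] [Ring E] [Algebra ℂ E] (u : Units N A E)

/-- Restriction of the coefficients to the scalars. -/
def C : Units N ℂ E where
  lam := Algebra.ofId ℂ E
  e := u.e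
  e_mul := u.e_mul
  e_one := u.e_one
  e_comm := u.e_comm
  lam_e a n i j := Algebra.commutes a (u.e n i j)

theorem C_e : u.C.e = u.e := rfl

theorem act_cmap (p : ℕ) {n : ℕ} (X : MatV N n ℂ) : u.act p n (cmap X) = u.C.act p n X := by
  induction n with
  | zero => exact u.lam.commutes _
  | succ n ih =>
    have : ∀ i j, slice (cmap X : MatV N (n + 1) A) i j = cmap (slice X i j) := fun i j => rfl
    simp only [act_succ, this, ih, C_e]

theorem act_comm {p n p' m : ℕ} (h : p + n ≤ p') (X : MatV N n A) (Y : MatV N m ℂ) :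
    u.act p n X * u.C.act p' m Y = u.C.act p' m Y * u.act p n X := by
  induction m with
  | zero => exact (Algebra.commutes _ _).symm
  | succ m ih =>
    simp only [act_succ, Finset.mul_sum, Finset.sum_mul, C_e]
    refine Finset.sum_congr rfl fun i _ => Finset.sum_congr rfl fun j _ => ?_
    rw [← mul_assoc, ih, mul_assoc, u.act_e X (Or.inr (by omega)), mul_assoc]

theorem mat_cmap (p : ℕ) (X : Matrix (Fin N) (Fin N) ℂ) : u.mat p (cmap X) = u.C.mat p X := by
  unfold mat
  exact Finset.sum_congr rfl fun i _ => Finset.sum_congr rfl fun j _ =>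
    congrArg (· * _) (u.lam.commutes _)

variable [NeZero N]

theorem mat_single (i j : Fin N) (p : ℕ) : u.C.mat p (Matrix.single i j 1) = u.e p i j := by
  have h := u.C.act_lift1_zero_single p i j
  rwa [u.C.act_lift1 p (by omega)] at h

end Units

/-- Standing assumptions on a compatible pair of R-matrices. -/
structure Setup {N : ℕ} [NeZero N] (q μ : ℂ) (R F ΨR : MatV N 2 ℂ) : Prop where
  q0 : q ≠ 0
  l0 : q - q⁻¹ ≠ 0
  m0 : μ ≠ 0
  Rbraid : IsBraid R
  Rdet : IsUnit R.det
  Fbraid : IsBraid F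
  Fdet : IsUnit F.det
  comp : Compatible R F
  skew : SkewPair R ΨR
  strict : IsUnit (Dof ΨR).det
  Gdet : IsUnit (Gmat q μ R F).det
  bmw : IsBMW q μ R

namespace Setup
variable {N : ℕ} [NeZero N] {q μ : ℂ} {R F ΨR : MatV N 2 ℂ} (s : Setup q μ R F ΨR)
include s

theorem K_ne : bmwK q μ R ≠ 0 := by
  intro h
  have h0 : (lift2 1 (0 : MatV N 2 ℂ) : MatV N 3 ℂ) = 0 := by
    ext a b; simp [lift2]
  have : Gmat q μ R F = 0 := by
    unfold Gmat
    rw [h, h0, zero_mul, zero_mul]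
    ext i j
    simp [toN, trTail, ptrace]
  have g := s.Gdet
  have : Nonempty (Fin N) := ⟨⟨0, Nat.pos_of_ne_zero (NeZero.ne N)⟩⟩
  rw [‹Gmat q μ R F = 0›, Matrix.det_zero] at g
  exact not_isUnit_zero g

theorem sandwich (x y : Fin N) :
    bmwK q μ R * lift1 0 (Matrix.single y x 1) * bmwK q μ R =
      (μ⁻¹ * Dof ΨR x y) • bmwK q μ R :=
  skew_sandwich s.skew
    (((Units.fn N ℂ).rel3 s.q0 s.l0 s.m0 s.Rdet s.Rbraid s.bmw 0).k2r1k2 s.m0) x y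

theorem rank1 : ∃ U W, Rank1 (bmwK q μ R) U W :=
  exists_rank1 s.K_ne (inv_ne_zero s.m0) s.strict fun x y => sandwich_apply (s.sandwich x y)

theorem Dof_inv {ΨRinv : MatV N 2 ℂ} (h : SkewPair R⁻¹ ΨRinv) :
    Dof ΨRinv = (μ⁻¹) ^ 2 • Dof ΨR := by
  ext x y
  have h1 := skew_sandwich h
    ((Units.fn N ℂ).rel3 s.q0 s.l0 s.m0 s.Rdet s.Rbraid s.bmw 0).k2s1k2 x y
  rw [s.sandwich] at h1
  have h2 := smul_left_injective ℂ s.K_ne h1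
  have := s.m0
  simp only [Matrix.smul_apply, smul_eq_mul]
  field_simp at h2 ⊢
  linear_combination -h2

variable {A E : Type*} [Ring A] [Algebra ℂ A] [Ring E] [Algebra ℂ E] (u : Units N A E)

theorem KeK (n : ℕ) (x y : Fin N) :
    u.C.act n 2 (bmwK q μ R) * u.e n y x * u.C.act n 2 (bmwK q μ R) =
      (μ⁻¹ * Dof ΨR x y) • u.C.act n 2 (bmwK q μ R) := by
  rw [← u.C.act_smul, ← s.sandwich, u.C.act_mul, u.C.act_mul, u.C.act_lift1_zero_single]
  rfl

theorem KxK (n : ℕ) (X : MatV N (n + 1) A) :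
    u.C.act n 2 (bmwK q μ R) * u.act 0 (n + 1) X * u.C.act n 2 (bmwK q μ R) =
      μ⁻¹ • (u.act 0 n (ptrace (cmap (Dof ΨR)) X) * u.C.act n 2 (bmwK q μ R)) := by
  have hp : ptrace (cmap (Dof ΨR)) X = ∑ i, ∑ j, Dof ΨR j i • slice X i j := by
    ext a b
    simp only [ptrace, Matrix.sum_apply, Matrix.smul_apply, slice, cmap, Matrix.map_apply]
    rw [Finset.sum_comm]
    simp only [Algebra.smul_def]
  have kek := s.KeK u n
  have kc : ∀ Y : MatV N n A, u.act 0 n Y * u.C.act n 2 (bmwK q μ R) =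
      u.C.act n 2 (bmwK q μ R) * u.act 0 n Y := fun Y => u.act_comm (by omega) Y _
  generalize u.C.act n 2 (bmwK q μ R) = k at *
  rw [hp, u.act_succ]
  simp only [Units.act_sum, Units.act_smul, Finset.mul_sum, Finset.sum_mul,
    Finset.smul_sum, zero_add]
  refine Finset.sum_congr rfl fun i _ => Finset.sum_congr rfl fun j _ => ?_
  rw [← mul_assoc, ← kc, mul_assoc, mul_assoc, ← mul_assoc k (u.e n i j), kek]
  simp only [mul_smul_comm, smul_mul_assoc, smul_smul]

omit s in
theorem lift_K {U W : Matrix (Fin N) (Fin N) ℂ} (h : Rank1 (bmwK q μ R) U W) (n : ℕ)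
    (X : Matrix (Fin N) (Fin N) ℂ) : u.C.mat (n + 1) X * u.C.act n 2 (bmwK q μ R) =
      u.C.mat n (U * X.transpose * U⁻¹) * u.C.act n 2 (bmwK q μ R) := by
  have := congrArg (u.C.act n 2) (h.left X)
  simpa only [u.C.act_mul, u.C.act_lift1 n (show 1 + 1 ≤ 2 by omega),
    u.C.act_lift1 n (show 0 + 1 ≤ 2 by omega), add_zero] using this

omit s in
theorem K_lift {U W : Matrix (Fin N) (Fin N) ℂ} (h : Rank1 (bmwK q μ R) U W) (n : ℕ)
    (X : Matrix (Fin N) (Fin N) ℂ) : u.C.act n 2 (bmwK q μ R) * u.C.mat (n + 1) X =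
      u.C.act n 2 (bmwK q μ R) * u.C.mat n (W * X * W⁻¹).transpose := by
  have := congrArg (u.C.act n 2) (h.right X)
  simpa only [u.C.act_mul, u.C.act_lift1 n (show 1 + 1 ≤ 2 by omega),
    u.C.act_lift1 n (show 0 + 1 ≤ 2 by omega), add_zero] using this

theorem cancel_K (n : ℕ) (X : MatV N n A)
    (h : u.act 0 n X * u.C.act n 2 (bmwK q μ R) = 0) : u.act 0 n X = 0 := by
  have xc : ∀ m, n ≤ m → ∀ i j, u.act 0 n X * u.e m i j = u.e m i j * u.act 0 n X :=
    fun m hm i j => u.act_e X (Or.inr (by omega)) i j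
  set x := u.act 0 n X
  have h1 : ∀ b d, (∑ a, ∑ c, (bmwK q μ R ![a, b] ![c, d] • x) * u.e n a c) = 0 := by
    intro b d
    refine congrFun (congrFun (u.coef_inj (n := n + 1)
      (x := fun b d => ∑ a, ∑ c, (bmwK q μ R ![a, b] ![c, d] • x) * u.e n a c)
      (y := fun _ _ => 0) (fun b d i j => ?_) (fun _ _ _ _ => by rw [zero_mul, mul_zero]) ?_) b) d
    · simp only [Finset.sum_mul, Finset.mul_sum, smul_mul_assoc, mul_smul_comm]
      refine Finset.sum_congr rfl fun a _ => Finset.sum_congr rfl fun c _ => ?_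
      rw [mul_assoc, u.e_comm n _ _ _ _ _ (by omega), ← mul_assoc, xc _ (by omega), mul_assoc]
    · simp only [zero_mul, Finset.sum_const_zero]
      rw [← h, u.C.act_two']
      simp only [Finset.sum_mul, Finset.mul_sum, smul_mul_assoc, mul_smul_comm, mul_assoc,
        Units.C_e]
  have h2 : ∀ a b c d, bmwK q μ R ![a, b] ![c, d] • x = 0 := by
    intro a b c d
    refine congrFun (congrFun (u.coef_inj (n := n)
      (x := fun a c => bmwK q μ R ![a, b] ![c, d] • x) (y := fun _ _ => 0)
      (fun i j k l => ?_) (fun _ _ _ _ => by rw [zero_mul, mul_zero]) ?_) a) c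
    · rw [smul_mul_assoc, xc _ le_rfl, mul_smul_comm]
    · rw [h1 b d]; simp only [zero_mul, Finset.sum_const_zero]
  by_contra hx
  refine s.K_ne (ext_two fun a b c d => ?_)
  exact (smul_eq_zero.1 (h2 a b c d)).resolve_right hx

/-- The tower of strand algebras attached to a compatible pair. -/
def tower : Tower E q μ where
  S n := (u.actH 0 n).range
  mono n := by
    rintro _ ⟨X, rfl⟩
    exact ⟨ext1 X, u.act_ext1 0 X⟩
  R n := u.C.act n 2 R
  Ri n := u.C.act n 2 R⁻¹
  F n := u.C.act n 2 F
  Fi n := u.C.act n 2 F⁻¹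
  K n := u.C.act n 2 (bmwK q μ R)
  R_mem n := ⟨cmap (lift2 n R), by
    exact (u.act_cmap 0 _).trans ((u.C.act_lift2 0 le_rfl _).trans (by rw [zero_add]))⟩
  Ri_mem n := ⟨cmap (lift2 n R⁻¹), by
    exact (u.act_cmap 0 _).trans ((u.C.act_lift2 0 le_rfl _).trans (by rw [zero_add]))⟩
  F_mem n := ⟨cmap (lift2 n F), by
    exact (u.act_cmap 0 _).trans ((u.C.act_lift2 0 le_rfl _).trans (by rw [zero_add]))⟩
  Fi_mem n := ⟨cmap (lift2 n F⁻¹), by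
    exact (u.act_cmap 0 _).trans ((u.C.act_lift2 0 le_rfl _).trans (by rw [zero_add]))⟩
  R_comm' n := by
    rintro _ ⟨X, rfl⟩
    exact u.act_comm (by omega) X R
  F_comm' n := by
    rintro _ ⟨X, rfl⟩
    exact u.act_comm (by omega) X F
  RR n := u.C.act_inv n s.Rdet
  FF n := u.C.act_inv n s.Fdet
  Rbraid n := (u.C.rel3 s.q0 s.l0 s.m0 s.Rdet s.Rbraid s.bmw n).braid
  Fbraid n := by
    have := congrArg (u.C.act n 3) s.Fbraid
    simpa only [u.C.act_mul, u.C.act_lift2 n (show 0 + 2 ≤ 3 by omega),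
      u.C.act_lift2 n (show 1 + 2 ≤ 3 by omega), add_zero] using this
  RFF n := by
    have := congrArg (u.C.act n 3) s.comp.1
    simpa only [u.C.act_mul, u.C.act_lift2 n (show 0 + 2 ≤ 3 by omega),
      u.C.act_lift2 n (show 1 + 2 ≤ 3 by omega), add_zero] using this
  FFR n := by
    have := congrArg (u.C.act n 3) s.comp.2
    simpa only [u.C.act_mul, u.C.act_lift2 n (show 0 + 2 ≤ 3 by omega),
      u.C.act_lift2 n (show 1 + 2 ≤ 3 by omega), add_zero] using this
  Kdef n := (u.C.rel3 s.q0 s.l0 s.m0 s.Rdet s.Rbraid s.bmw n).d1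
  q0 := s.q0
  lam := s.l0
  mu0 := s.m0
  RK n := by rw [← u.C.act_mul, ← bmwK_comm, bmwK_R s.bmw, u.C.act_smul]
  KR n := by rw [← u.C.act_mul, bmwK_R s.bmw, u.C.act_smul]
  K21 n := (u.C.rel3 s.q0 s.l0 s.m0 s.Rdet s.Rbraid s.bmw n).k21
  K21' n := (u.C.rel3 s.q0 s.l0 s.m0 s.Rdet s.Rbraid s.bmw n).k21'
  K121 n := (u.C.rel3 s.q0 s.l0 s.m0 s.Rdet s.Rbraid s.bmw n).k121
  tr_ex n := by
    rintro _ ⟨X, rfl⟩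
    exact ⟨_, Subalgebra.smul_mem _ (AlgHom.mem_range_self (u.actH 0 n)
      (ptrace (cmap (Dof ΨR)) X)) μ⁻¹, (s.KxK u n X).trans (smul_mul_assoc _ _ _).symm⟩
  resL n := by
    rintro _ ⟨X, rfl⟩
    obtain ⟨U, W, h⟩ := s.rank1
    refine ⟨∑ i, ∑ j, u.act 0 (n + 1) (slice X i j) *
      u.C.mat n (U * (Matrix.single i j 1).transpose * U⁻¹), ?_, ?_⟩
    · refine sum_mem fun i _ => sum_mem fun j _ => mul_mem (AlgHom.mem_range_self (u.actH 0 (n + 1)) _) ?_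
      refine ⟨lift1 n (cmap (U * (Matrix.single i j 1).transpose * U⁻¹)), ?_⟩
      exact (u.act_lift1 0 le_rfl _).trans ((u.mat_cmap _ _).trans (by rw [zero_add]))
    · simp only [Finset.sum_mul, mul_assoc (u.act _ _ _), ← lift_K u h, u.mat_single]
      exact ((congrArg (· * _) (u.act_succ 0 (n + 1) X)).trans
        (by simp only [Finset.sum_mul, mul_assoc, zero_add]))
  resR n := by
    rintro _ ⟨X, rfl⟩
    obtain ⟨U, W, h⟩ := s.rank1
    refine ⟨∑ i, ∑ j, u.C.mat n (W * Matrix.single i j 1 * W⁻¹).transpose *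
      u.act 0 (n + 1) (slice X i j), ?_, ?_⟩
    · refine sum_mem fun i _ => sum_mem fun j _ => mul_mem ?_ (AlgHom.mem_range_self (u.actH 0 (n + 1)) _)
      refine ⟨lift1 n (cmap (W * Matrix.single i j 1 * W⁻¹).transpose), ?_⟩
      exact (u.act_lift1 0 le_rfl _).trans ((u.mat_cmap _ _).trans (by rw [zero_add]))
    · simp only [Finset.mul_sum, ← mul_assoc, ← K_lift u h, u.mat_single]
      refine (congrArg (_ * ·) (u.act_succ 0 (n + 1) X)).trans ?_
      simp only [Finset.mul_sum, mul_assoc, zero_add]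
      refine Finset.sum_congr rfl fun i _ => Finset.sum_congr rfl fun j _ => ?_
      rw [u.act_e _ (by omega)]
  cancel n := by
    rintro _ ⟨X, rfl⟩ h
    exact s.cancel_K u n X h

end Setup
end QMA
end

noncomputable section
namespace QMA
open Finset

/-- A matrix as an operator on one strand. -/
def ofN {N : ℕ} {A : Type*} (X : Matrix (Fin N) (Fin N) A) : MatV N 1 A :=
  Matrix.of fun a b => X (a 0) (b 0)

theorem ofN_mul {N : ℕ} {A : Type*} [Ring A] (X Y : Matrix (Fin N) (Fin N) A) :
    ofN (X * Y) = ofN X * ofN Y := by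
  ext a b
  rw [Matrix.mul_apply]
  exact ((Equiv.funUnique (Fin 1) (Fin N)).sum_comp (fun k => X (a 0) k * Y k (b 0))).symm

namespace Units
variable {N : ℕ} {A E : Type*} [Ring A] [Algebra ℂ A] [Ring E] [Algebra ℂ E] (u : Units N A E)

theorem C_self (u : Units N ℂ E) : u.C = u := by
  obtain ⟨l, e, h1, h2, h3, h4⟩ := u
  have : l = Algebra.ofId ℂ E := Subsingleton.elim _ _
  subst this
  rfl

theorem mat_toN_act (p : ℕ) (X : Matrix (Fin N) (Fin N) A) : u.mat p X = u.act p 1 (ofN X) :=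
  (u.act_one_strand p (ofN X)).symm

theorem mat_mul (p : ℕ) (X Y : Matrix (Fin N) (Fin N) A) :
    u.mat p (X * Y) = u.mat p X * u.mat p Y := by
  rw [mat_toN_act, mat_toN_act, mat_toN_act, ← act_mul, ofN_mul]

theorem mat_one (p : ℕ) : u.mat p 1 = 1 := by
  simp only [mat, Matrix.one_apply, apply_ite u.lam, map_one, map_zero, ite_mul, one_mul, zero_mul,
    Finset.sum_ite_eq, Finset.mem_univ, if_true, u.e_one]

theorem mat_add (p : ℕ) (X Y : Matrix (Fin N) (Fin N) A) :
    u.mat p (X + Y) = u.mat p X + u.mat p Y := by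
  simp only [mat, Matrix.add_apply, map_add, add_mul, Finset.sum_add_distrib]

theorem mat_smul (p : ℕ) (c : ℂ) (X : Matrix (Fin N) (Fin N) A) :
    u.mat p (c • X) = c • u.mat p X := by
  simp only [mat, Matrix.smul_apply, map_smul, smul_mul_assoc, Finset.smul_sum]

theorem mat_zero (p : ℕ) : u.mat p 0 = 0 := by
  simp only [mat, Matrix.zero_apply, map_zero, zero_mul, Finset.sum_const_zero]

theorem mat_sum (p : ℕ) {ι : Type*} (t : Finset ι) (f : ι → Matrix (Fin N) (Fin N) A) :
    u.mat p (∑ i ∈ t, f i) = ∑ i ∈ t, u.mat p (f i) :=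
  map_sum (AddMonoidHom.mk' (u.mat p) (u.mat_add p)) f t

theorem mat_rmulE (p : ℕ) (X : Matrix (Fin N) (Fin N) A) (c : A) :
    u.mat p (rmulE X c) = u.mat p X * u.lam c := by
  simp only [mat, rmulE, map_mul, Finset.sum_mul, mul_assoc, ← u.lam_e c]

theorem mat_inj (hu : Function.Injective u.lam) (p : ℕ) : Function.Injective (u.mat p) := by
  intro X Y h
  have h1 := u.coef_inj (n := p) (x := fun i j => u.lam (X i j)) (y := fun i j => u.lam (Y i j))
    (fun _ _ _ _ => u.lam_e _ _ _ _) (fun _ _ _ _ => u.lam_e _ _ _ _) h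
  ext i j
  exact hu (congrFun (congrFun h1 i) j)

theorem mat_inv (p : ℕ) {X : Matrix (Fin N) (Fin N) ℂ} (h : IsUnit X.det) :
    Inv2 (u.C.mat p X) (u.C.mat p X⁻¹) :=
  ⟨by rw [← mat_mul, Matrix.mul_nonsing_inv _ h, mat_one],
   by rw [← mat_mul, Matrix.nonsing_inv_mul _ h, mat_one]⟩

end Units

section contraction
variable {N : ℕ} [NeZero N]

theorem Rank1.single {K : MatV N 2 ℂ} {U W : Matrix (Fin N) (Fin N) ℂ} (h : Rank1 K U W)
    (c a d b : Fin N) :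
    K * (lift1 0 (Matrix.single c a 1) * lift1 1 (Matrix.single d b 1)) * K =
      (W c d * U a b) • K := by
  have e : ∀ i j k l, (lift1 0 (Matrix.single c a 1) * lift1 1 (Matrix.single d b 1) : MatV N 2 ℂ)
      ![i, j] ![k, l] = if c = i ∧ a = k ∧ d = j ∧ b = l then 1 else 0 := by
    intro i j k l
    rw [mul_apply_two]
    simp only [lift1_zero_apply, lift1_one_apply, Matrix.single_apply]
    simp [ite_and]
    split_ifs <;> simp_all
  refine ext_two fun i j k l => ?_
  simp only [mul_apply_two, e, h.eq, Matrix.smul_apply, smul_eq_mul]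
  simp [ite_and]
  ring

variable {E : Type*} [Ring E] [Algebra ℂ E] (u : Units N ℂ E)

theorem Rank1.contract {K : MatV N 2 ℂ} {U W : Matrix (Fin N) (Fin N) ℂ} (h : Rank1 K U W)
    (Z : MatV N 3 ℂ) :
    u.act 1 2 K * u.act 0 3 Z * u.act 1 2 K =
      u.act 0 1 (trTail (1 : Matrix (Fin N) (Fin N) ℂ) 2 (lift2 1 K * Z)) * u.act 1 2 K := by
  have hs : ∀ c a d b, u.act 1 2 K * (u.e 1 c a * u.e 2 d b) * u.act 1 2 K =
      (W c d * U a b) • u.act 1 2 K := by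
    intro c a d b
    have := congrArg (u.act 1 2) (h.single c a d b)
    rw [u.act_mul, u.act_mul, u.act_mul, u.act_smul, u.act_lift1_zero_single,
      u.act_lift1 1 (show 1 + 1 ≤ 2 by omega)] at this
    rw [← this]
    congr 3
    exact (u.mat_single d b 2).symm.trans (by rw [u.C_self])
  have kc : ∀ Y : MatV N 1 ℂ, u.act 0 1 Y * u.act 1 2 K = u.act 1 2 K * u.act 0 1 Y := fun Y =>
    by simpa only [u.C_self] using u.act_comm (show 0 + 1 ≤ 1 by omega) Y K
  have ht : trTail (1 : Matrix (Fin N) (Fin N) ℂ) 2 (lift2 1 K * Z) =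
      ∑ b, ∑ a, ∑ d, ∑ c, (W c d * U a b) • slice (slice Z d b) c a := by
    have h1 : trTail (1 : Matrix (Fin N) (Fin N) ℂ) 2 (lift2 1 K * Z) =
        ∑ a, ∑ b, slice (slice (lift2 1 K * Z) b b) a a := by
      ext x y
      simp only [trTail, ptrace, Matrix.one_apply, ite_mul, one_mul, zero_mul,
        Finset.sum_ite_eq, Finset.mem_univ, if_true, Matrix.sum_apply, slice]
    have h2 : ∀ a b, slice (slice (lift2 1 K * Z) b b) a a =
        ∑ d, ∑ c, (W c d * U a b) • slice (slice Z d b) c a := by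
      intro a b
      have sl : ∀ (f : Fin N → MatV N 2 ℂ), slice (∑ d, f d) a a = ∑ d, slice (f d) a a := by
        intro f
        ext x y
        simp only [slice, Matrix.sum_apply]
      rw [slice_mul, sl]
      simp only [slice_mul, slice_lift2_top, h.eq]
      refine Finset.sum_congr rfl fun d _ => Finset.sum_congr rfl fun c _ => ?_
      ext x y
      rw [Matrix.diagonal_mul, Matrix.smul_apply, smul_eq_mul, mul_comm (W c d)]
    rw [h1, Finset.sum_comm]
    simp only [h2]
  have hz : u.act 0 3 Z = ∑ d, ∑ b, ∑ c, ∑ a,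
      u.act 0 1 (slice (slice Z d b) c a) * (u.e 1 c a * u.e 2 d b) := by
    rw [u.act_succ]
    simp only [u.act_succ 0 1, Finset.sum_mul, zero_add, mul_assoc]
  rw [ht, hz]
  simp only [u.act_sum, u.act_smul]
  generalize u.act 1 2 K = k at *
  simp only [Finset.sum_mul, Finset.mul_sum]
  rw [Finset.sum_comm]
  refine Finset.sum_congr rfl fun b _ => ?_
  refine Eq.trans (Finset.sum_congr rfl fun d _ => Finset.sum_comm) (Finset.sum_comm.trans ?_)
  refine Finset.sum_congr rfl fun a _ => Finset.sum_congr rfl fun d _ =>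
    Finset.sum_congr rfl fun c _ => ?_
  rw [← mul_assoc k, ← kc, mul_assoc _ k, mul_assoc, hs, mul_smul_comm, smul_mul_assoc]

end contraction
end QMA
end

noncomputable section
namespace QMA
open Finset

theorem Units.act_cmap_lift2 {N : ℕ} [NeZero N] {A E : Type*} [Ring A] [Algebra ℂ A] [Ring E]
    [Algebra ℂ E] (u : Units N A E) {n j : ℕ} (h : j + 2 ≤ n) (X : MatV N 2 ℂ) :
    u.act 0 n (cmap (lift2 j X)) = u.C.act j 2 X := by
  rw [u.act_cmap, u.C.act_lift2 0 h, zero_add]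

namespace Setup
variable {N : ℕ} [NeZero N] {q μ : ℂ} {R F ΨR : MatV N 2 ℂ} (s : Setup q μ R F ΨR)
variable {A E : Type*} [Ring A] [Algebra ℂ A] [Ring E] [Algebra ℂ E] (u : Units N A E)

theorem act_mem (n : ℕ) (X : MatV N n A) : u.act 0 n X ∈ (s.tower u).S n :=
  AlgHom.mem_range_self (u.actH 0 n) X

theorem mat_mem (X : Matrix (Fin N) (Fin N) A) : u.mat 0 X ∈ (s.tower u).S 1 := by
  rw [u.mat_toN_act]; exact s.act_mem u 1 _

theorem Cmat_mem (X : Matrix (Fin N) (Fin N) ℂ) : u.C.mat 0 X ∈ (s.tower u).S 1 := by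
  rw [← u.mat_cmap]; exact s.mat_mem u _

theorem tr_act (n : ℕ) (X : MatV N (n + 1) A) :
    (s.tower u).tr n (u.act 0 (n + 1) X) = u.act 0 n (ptrace (cmap (Dof ΨR)) X) :=
  (s.tower u).tr_eq (s.act_mem u _ _) (s.act_mem u _ _) (s.KxK u n X)

theorem mtr_act (n : ℕ) (X : MatV N n A) :
    (s.tower u).mtr 0 n (u.act 0 n X) = u.lam (trAll (cmap (Dof ΨR)) n X) := by
  induction n with
  | zero => rfl
  | succ n ih =>
    change (s.tower u).mtr 0 n ((s.tower u).tr (0 + n) _) = _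
    rw [zero_add, s.tr_act, ih]
    rfl

theorem G_eq : (s.tower u).G 0 = u.C.mat 0 (Gmat q μ R F) := by
  obtain ⟨U, W, h⟩ := s.rank1
  have h1 := h.contract u.C (lift2 0 F⁻¹ * lift2 1 F⁻¹)
  rw [u.C.act_mul, u.C.act_lift2 0 (show 0 + 2 ≤ 3 by omega),
    u.C.act_lift2 0 (show 1 + 2 ≤ 3 by omega), ← mul_assoc (lift2 1 (bmwK q μ R)),
    u.C.act_one_strand] at h1
  exact (s.tower u).cancel_eq (Tower.G_mem 0) (s.Cmat_mem u _)
    ((Tower.G_spec 0).symm.trans h1)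

theorem H_eq : (s.tower u).H 0 = u.C.mat 0 (Gmat q μ R F)⁻¹ := by
  have h1 := (s.tower u).GH 0
  have h2 := u.C.mat_inv 0 s.Gdet
  rw [s.G_eq] at h1
  exact h2.lcan (h1.l.trans h2.l.symm)

variable (M X : Matrix (Fin N) (Fin N) A)

theorem cp_eq {n j : ℕ} (h : j + 1 ≤ n) :
    (s.tower u).cp (u.mat 0 X) j = u.act 0 n (Mcopy F X j) := by
  induction j with
  | zero => exact (u.act_lift1 0 h X).symm
  | succ j ih =>
    rw [Mcopy, u.act_mul, u.act_mul, ← ih (by omega), u.act_cmap_lift2 (by omega),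
      u.act_cmap_lift2 (by omega)]
    rfl

theorem Mp_eq {n j : ℕ} (h : j ≤ n) :
    (s.tower u).Mp (u.mat 0 M) 0 j = u.act 0 n (Mprod F M j) := by
  induction j with
  | zero => exact (u.act_one 0 n).symm
  | succ j ih =>
    rw [Mprod, u.act_mul, ← ih (by omega), ← s.cp_eq u M h, Tower.Mp, zero_add]

theorem As_eq (i : ℕ) : (s.tower u).As 0 i = u.C.act 0 i (asym q μ R i) := by
  induction i with
  | zero => exact (u.C.act_one 0 0).symm
  | succ i ih =>
    cases i with
    | zero => exact (u.C.act_one 0 1).symm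
    | succ i =>
      rw [asym, u.C.act_smul, u.C.act_mul, u.C.act_mul, u.C.act_ext1, ← ih, u.C.act_add,
        u.C.act_add, u.C.act_smul, u.C.act_smul, u.C.act_one, u.C.act_lift2 0 le_rfl,
        u.C.act_lift2 0 le_rfl, Tower.As]
      simp only [Tower.cA, Tower.sg, Tower.al, Tower.be, Tower.qn, nq, tower, Nat.cast_add,
        Nat.cast_one]
      rfl

theorem aT_eq (i : ℕ) :
    (s.tower u).aT (u.mat 0 M) i = u.lam (aElt q μ R F ΨR M i) := by
  cases i with
  | zero => exact (map_one u.lam).symm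
  | succ i =>
    rw [aElt, ← s.mtr_act, u.act_mul, ← s.Mp_eq u M le_rfl, u.act_cmap, ← s.As_eq u,
      Tower.mtr_bot]
    rfl

theorem gT_eq : (s.tower u).gT (u.mat 0 M) = u.lam (gElt q μ R F ΨR M) := by
  rw [gElt, map_smul, ← s.mtr_act, u.act_mul, ← s.Mp_eq u M le_rfl, u.act_cmap_lift2 le_rfl]
  have : (μ * (Tower.dl q μ)⁻¹) = μ * (q - q⁻¹) / ((q - μ) * (q⁻¹ + μ)) := by
    rw [Tower.dl, inv_div, mul_div_assoc]
  rw [Tower.gT, this]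
  simp only [Tower.mtr, Tower.Mp, one_mul, zero_add]
  rfl

theorem ph_eq : (s.tower u).ph (u.mat 0 X) = u.mat 0 (phi R F ΨR X) := by
  rw [phi, ← u.act_one_strand, ← s.tr_act, u.act_mul, u.act_mul, u.act_mul,
    u.act_cmap_lift2 le_rfl, u.act_cmap_lift2 le_rfl, u.act_cmap_lift2 le_rfl,
    u.act_lift1 0 (by omega)]
  rfl

theorem xi_eq : (s.tower u).xi (u.mat 0 X) = u.mat 0 (QMA.xi q μ R F ΨR X) := by
  rw [QMA.xi, ← u.act_one_strand, ← s.tr_act, u.act_mul, u.act_mul, u.act_mul,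
    u.act_cmap_lift2 le_rfl, u.act_cmap_lift2 le_rfl, u.act_cmap_lift2 le_rfl,
    u.act_lift1 0 (by omega)]
  rfl

theorem spT_eq (n : ℕ) :
    (s.tower u).spT (u.mat 0 M) n = u.mat 0 (starPow R F ΨR M n) := by
  induction n with
  | zero => exact (u.mat_one 0).symm
  | succ n ih => rw [starPow, u.mat_mul, ← s.ph_eq, ← ih]; rfl

theorem eT_eq {k i : ℕ} (h : i ≤ k) :
    (s.tower u).eT (u.mat 0 M) i = u.lam (eps q μ R F ΨR M k i) := by
  rw [eps, if_pos h, map_sum, Tower.eT]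
  simp only [map_mul, map_pow, ← s.aT_eq, ← s.gT_eq]

theorem ppT_eq {ΨF ΨFinv ΨRinv : MatV N 2 ℂ} {pI : E → E}
    (hp : ∀ X, pI (u.mat 0 X) = u.mat 0 (phiInv μ R F ΨF ΨFinv ΨRinv X)) (n : ℕ) :
    (s.tower u).ppT pI (u.mat 0 M) n =
      u.mat 0 (piPow q μ R F ΨR ΨF ΨFinv ΨRinv M n) := by
  induction n with
  | zero => exact (u.mat_one 0).symm
  | succ n ih =>
    rw [piPow, u.mat_smul, ← hp, u.mat_mul, u.mat_mul, u.mat_mul, u.mat_cmap, u.mat_cmap, ← s.H_eq,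
      ← s.G_eq, ← ih, ← s.xi_eq, Tower.ppT, Tower.ad]
    simp only [mul_assoc]

theorem QM_of (hM : QMArel R F M) : Tower.QM (s.tower u) (u.mat 0 M) := by
  refine ⟨s.mat_mem u M, ?_⟩
  have := congrArg (u.act 0 2) hM
  rw [u.act_mul, u.act_mul, u.act_mul, u.act_mul, u.act_cmap_lift2 le_rfl,
    ← s.cp_eq u M (by omega), ← s.cp_eq u M (by omega), mul_assoc] at this
  exact this

theorem cut {k : ℕ} (hk : 1 ≤ k) (h : HeightCut q μ R k) :
    (s.tower u).As 0 k * (s.tower u).sg k (k - 1) * (s.tower u).As 0 k = 0 := by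
  have := congrArg (u.C.act 0 (k + 1)) h
  rw [u.C.act_mul, u.C.act_mul, u.C.act_ext1, ← s.As_eq, u.C.act_add,
    u.C.act_add, u.C.act_smul, u.C.act_smul, u.C.act_one, u.C.act_lift2 0 (by omega),
    u.C.act_lift2 0 (by omega), u.C.act_zero, zero_add] at this
  exact this

end Setup
end QMA
end

noncomputable section
namespace QMA
open Finset

section skewInverse
variable {N : ℕ}

/-- The partial transpose with respect to which skew inversion is matrix inversion. -/
def skewHat (X : MatV N 2 ℂ) : Matrix (Fin N × Fin N) (Fin N × Fin N) ℂ :=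
  Matrix.of fun x y => X ![x.1, y.2] ![x.2, y.1]

theorem SkewPair.inv2 {X Ψ : MatV N 2 ℂ} (h : SkewPair X Ψ) : Inv2 (skewHat X) (skewHat Ψ) := by
  constructor
  · ext ⟨a, b⟩ ⟨c, d⟩
    rw [Matrix.mul_apply, Fintype.sum_prod_type, Finset.sum_comm]
    refine (h.1 a d b c).trans ?_
    simp only [Matrix.one_apply, Prod.mk.injEq, eq_comm (a := d)]
  · ext ⟨a, b⟩ ⟨c, d⟩
    rw [Matrix.mul_apply, Fintype.sum_prod_type, Finset.sum_comm]
    refine (h.2 a d b c).trans ?_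
    simp only [Matrix.one_apply, Prod.mk.injEq, eq_comm (a := d)]

theorem Inv2.commute {E : Type*} [Ring E] {a b g : E} (h : Inv2 a b) (c : g * a = a * g) :
    g * b = b * g := by
  refine h.lcan ?_
  rw [← mul_assoc, ← c, mul_assoc, h.l, mul_one, ← mul_assoc, h.l, one_mul]

variable [NeZero N]

theorem SkewPair.weight {X Ψ : MatV N 2 ℂ} {D f : Matrix (Fin N) (Fin N) ℂ} (h : SkewPair X Ψ)
    (hf : ∀ a c, f a c = ∑ d, ∑ b, D d b * X ![a, b] ![c, d])
    (h1 : X * lift1 0 f = lift1 1 f * X) (h2 : lift1 0 f * X = X * lift1 1 f) :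
    Dof Ψ * f = D ∧ f * Dof Ψ = D := by
  have hD : ∀ x y, ∑ a, ∑ c, Ψ ![x, c] ![y, a] * f a c = D x y := by
    have e : (skewHat Ψ).mulVec ((skewHat X).mulVec fun p => D p.1 p.2) = fun p => D p.1 p.2 := by
      rw [Matrix.mulVec_mulVec, h.inv2.r, Matrix.one_mulVec]
    intro x y
    have := congrFun e (x, y)
    simp only [Matrix.mulVec, dotProduct, Fintype.sum_prod_type] at this
    rw [← this]
    refine Finset.sum_congr rfl fun a _ => Finset.sum_congr rfl fun c _ => ?_
    rw [hf]
    simp only [skewHat, Matrix.of_apply, mul_comm]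
  have e1 : ∀ a b c d, ∑ e, Ψ ![a, b] ![e, d] * f e c = ∑ e, f b e * Ψ ![a, e] ![c, d] := by
    have := h.inv2.commute (g := Matrix.of fun x y => if x.1 = y.1 then f y.2 x.2 else 0) (by
      ext ⟨a, c⟩ ⟨d, b⟩
      have := congrFun (congrFun h1 ![a, b]) ![c, d]
      simp only [mul_apply_two, lift1_zero_apply, lift1_one_apply] at this
      simp only [Matrix.mul_apply, Fintype.sum_prod_type, skewHat, Matrix.of_apply]
      simpa [mul_comm] using this)
    intro a b c d
    have := congrFun (congrFun this (a, c)) (d, b)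
    simp only [Matrix.mul_apply, Fintype.sum_prod_type, skewHat, Matrix.of_apply] at this
    simpa [mul_comm] using this
  have e2 : ∀ a b c d, ∑ e, f a e * Ψ ![e, b] ![c, d] = ∑ e, Ψ ![a, b] ![c, e] * f e d := by
    have := h.inv2.commute (g := Matrix.of fun x y => if x.2 = y.2 then f x.1 y.1 else 0) (by
      ext ⟨a, c⟩ ⟨d, b⟩
      have := congrFun (congrFun h2 ![a, b]) ![c, d]
      simp only [mul_apply_two, lift1_zero_apply, lift1_one_apply] at this
      simp only [Matrix.mul_apply, Fintype.sum_prod_type, skewHat, Matrix.of_apply]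
      simpa [mul_comm] using this)
    intro a b c d
    have := congrFun (congrFun this (a, c)) (d, b)
    simp only [Matrix.mul_apply, Fintype.sum_prod_type, skewHat, Matrix.of_apply] at this
    simpa [mul_comm] using this
  constructor
  · ext x y
    rw [← hD, Matrix.mul_apply]
    simp only [Dof, Finset.sum_mul]
    rw [Finset.sum_comm]
    refine Finset.sum_congr rfl fun d _ => (e1 x d y d).trans ?_
    exact Finset.sum_congr rfl fun e _ => mul_comm _ _
  · ext x y
    rw [← hD, Matrix.mul_apply]
    simp only [Dof, Finset.mul_sum]
    rw [Finset.sum_comm, Finset.sum_comm (f := fun a c => Ψ ![x, c] ![y, a] * f a c)]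
    exact Finset.sum_congr rfl fun d _ => e2 x d y d

/-- The weighted trace of a two-strand operator over its second strand. -/
def trTwo (D : Matrix (Fin N) (Fin N) ℂ) (X : MatV N 2 ℂ) : Matrix (Fin N) (Fin N) ℂ :=
  toN (ptrace D X)

theorem trTwo_apply (D : Matrix (Fin N) (Fin N) ℂ) (X : MatV N 2 ℂ) (a c : Fin N) :
    trTwo D X a c = ∑ d, ∑ b, D d b * X ![a, b] ![c, d] := by
  have : ∀ i j : Fin N, (Fin.snoc (fun _ : Fin 1 => i) j : Fin 2 → Fin N) = ![i, j] := by
    intro i j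
    ext t
    fin_cases t <;> rfl
  simp only [trTwo, toN, ptrace, this]

theorem ptrace_lift2_one (D : Matrix (Fin N) (Fin N) ℂ) (X : MatV N 2 ℂ) :
    (ptrace D (lift2 1 X) : MatV N 2 ℂ) = lift1 1 (trTwo D X) := by
  refine ext_two fun a b c d => ?_
  rw [lift1_one_apply, trTwo_apply]
  have : ∀ i j, slice (lift2 1 X : MatV N 3 ℂ) i j ![a, b] ![c, d] =
      if a = c then X ![b, i] ![d, j] else 0 := by
    intro i j
    have e := congrFun (congrFun (slice_lift2_top (n := 1) X b i d j) ![a]) ![c]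
    have hs : ∀ i j : Fin N, (Fin.snoc ![i] j : Fin 2 → Fin N) = ![i, j] := by
      intro i j
      ext t
      fin_cases t <;> rfl
    simp only [slice, hs] at e
    simp only [slice, e, Matrix.diagonal_apply]
    simp
  rw [ptrace_eq]
  simp only [this]
  split_ifs <;> simp

end skewInverse
end QMA
end

noncomputable section
namespace QMA
open Finset

theorem Tower.braid_trace {E : Type*} [Ring E] [Algebra ℂ E] {q μ : ℂ} {T : Tower E q μ}
    {x y z : E} (hx : x ∈ T.S 2) (hy : y ∈ T.S 3) (hz : z ∈ T.S 3) (hb : x * y * x = y * x * y)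
    (hi : Inv2 y z) (h : T.tr 2 (y * x * z) = T.tr 1 x) (h' : T.tr 2 (z * x * y) = T.tr 1 x) :
    x * T.tr 1 x = T.tr 2 y * x ∧ T.tr 1 x * x = x * T.tr 2 y := by
  have hx' := T.sm (n := 3) hx
  constructor
  · rw [← h, ← T.tr_mul_left hx (mul_mem (mul_mem hy hx') hz), ← T.tr_mul_right hx hy]
    congr 1
    exact hi.rcan (tl fun t => by simp only [mul_assoc, ra2 hi.r, one_mul, ra3 hb])
  · rw [← h', ← T.tr_mul_right hx (mul_mem (mul_mem hz hx') hy), ← T.tr_mul_left hx hy]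
    congr 1
    exact hi.lcan (tl fun t => by simp only [mul_assoc, ra2 hi.l, one_mul, ra3 hb])

theorem ptrace_mul_weight {N n : ℕ} [NeZero N] {A : Type*} [Ring A]
    (D P : Matrix (Fin N) (Fin N) A) (Y : MatV N (n + 1) A) :
    ptrace (D * P) Y = ptrace D (lift1 n P * Y) := by
  ext a b
  simp only [ptrace_eq, slice_mul, slice_lift1_top, Matrix.sum_apply, Matrix.diagonal_mul]
  simp only [Matrix.mul_apply, Finset.sum_mul, Finset.mul_sum, mul_assoc]
  exact Finset.sum_congr rfl fun m _ => Finset.sum_comm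

namespace Setup
variable {N : ℕ} [NeZero N] {q μ : ℂ} {R F ΨR : MatV N 2 ℂ} (s : Setup q μ R F ΨR)
include s
variable {A E : Type*} [Ring A] [Algebra ℂ A] [Ring E] [Algebra ℂ E] (u : Units N A E)

theorem tr_one_act (X : MatV N 2 ℂ) :
    (s.tower u).tr 1 (u.C.act 0 2 X) = u.C.mat 0 (trTwo (Dof ΨR) X) := by
  rw [← u.act_cmap, s.tr_act, u.act_one_strand, ← u.mat_cmap]
  congr 1
  ext i j
  simp [toN, ptrace, cmap, trTwo]

theorem tr_two_act (X : MatV N 2 ℂ) :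
    (s.tower u).tr 2 (u.C.act 1 2 X) = u.C.mat 1 (trTwo (Dof ΨR) X) := by
  have h := u.C.act_lift2 0 (show 1 + 2 ≤ 3 by omega) X
  rw [zero_add] at h
  have e : ptrace (cmap (Dof ΨR)) (cmap (lift2 1 X : MatV N 3 ℂ)) =
      (cmap (lift1 1 (trTwo (Dof ΨR) X)) : MatV N 2 A) := by
    rw [← ptrace_lift2_one]
    ext i j
    simp [ptrace, cmap]
  rw [← h, ← u.act_cmap, s.tr_act, e, u.act_cmap, u.C.act_lift1 0 (by omega)]

theorem lift_trTwo {Z : MatV N 2 ℂ}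
    (h : let T := s.tower (Units.fn N ℂ); let a := (Units.fn N ℂ).C
      a.act 0 2 Z * T.tr 1 (a.act 0 2 Z) = T.tr 2 (a.act 1 2 Z) * a.act 0 2 Z ∧
        T.tr 1 (a.act 0 2 Z) * a.act 0 2 Z = a.act 0 2 Z * T.tr 2 (a.act 1 2 Z)) :
    Z * lift1 0 (trTwo (Dof ΨR) Z) = lift1 1 (trTwo (Dof ΨR) Z) * Z ∧
      lift1 0 (trTwo (Dof ΨR) Z) * Z = Z * lift1 1 (trTwo (Dof ΨR) Z) := by
  have inj := (Units.fn N ℂ).C.act_inj (FaithfulSMul.algebraMap_injective ℂ _) 0 2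
  dsimp only at h
  rw [s.tr_one_act, s.tr_two_act] at h
  have l0 := (Units.fn N ℂ).C.act_lift1 0 (show 0 + 1 ≤ 2 by omega) (trTwo (Dof ΨR) Z)
  have l1 := (Units.fn N ℂ).C.act_lift1 0 (show 1 + 1 ≤ 2 by omega) (trTwo (Dof ΨR) Z)
  constructor <;> apply inj <;> rw [Units.act_mul, Units.act_mul, l0, l1]
  exacts [h.1, h.2]

theorem lift_trTwo_F :
    F * lift1 0 (trTwo (Dof ΨR) F) = lift1 1 (trTwo (Dof ΨR) F) * F ∧
      lift1 0 (trTwo (Dof ΨR) F) * F = F * lift1 1 (trTwo (Dof ΨR) F) := by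
  refine s.lift_trTwo ?_
  intro T a
  exact Tower.braid_trace (T.F_mem 0) (T.F_mem 1) (T.Fi_mem 1) (T.Fbraid 0) (T.FF 1)
    (T.tr_conj (T.F_mem 0)) (T.tr_conj' (T.F_mem 0))

theorem lift_trTwo_Finv :
    F⁻¹ * lift1 0 (trTwo (Dof ΨR) F⁻¹) = lift1 1 (trTwo (Dof ΨR) F⁻¹) * F⁻¹ ∧
      lift1 0 (trTwo (Dof ΨR) F⁻¹) * F⁻¹ = F⁻¹ * lift1 1 (trTwo (Dof ΨR) F⁻¹) := by
  refine s.lift_trTwo ?_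
  intro T a
  have hb : T.Fi 0 * T.Fi 1 * T.Fi 0 = T.Fi 1 * T.Fi 0 * T.Fi 1 :=
    (T.FF 1).lcan ((T.FF 0).rcan (tl fun x => by
      have := T.FFi12 0
      rw [← mul_assoc] at this
      simp only [mul_assoc, ra2 (T.FF 1).l, ra2 (T.FF 0).r, one_mul]
      exact (ra3 this x).trans (by simp only [mul_assoc, zero_add])))
  exact Tower.braid_trace (T.Fi_mem 0) (T.Fi_mem 1) (T.F_mem 1) hb (T.FF 1).symm
    (T.tr_conj' (T.Fi_mem 0)) (T.tr_conj (T.Fi_mem 0))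

variable {ΨF ΨFinv ΨRinv : MatV N 2 ℂ}

theorem isUnit_trTwo {ΨZ : MatV N 2 ℂ} {f : Matrix (Fin N) (Fin N) ℂ}
    (h : Dof ΨZ * f = Dof ΨR) : IsUnit f.det := by
  have := s.strict
  rw [← h, Matrix.det_mul] at this
  exact isUnit_of_mul_isUnit_right this

theorem exists_phInv (hF : SkewPair F ΨF) (hF' : SkewPair F⁻¹ ΨFinv)
    (hR : SkewPair R⁻¹ ΨRinv) : ∃ pI, Tower.PhInv (s.tower u) pI ∧
      ∀ X, pI (u.mat 0 X) = u.mat 0 (phiInv μ R F ΨF ΨFinv ΨRinv X) := by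
  obtain ⟨r1, r2⟩ := s.lift_trTwo_F
  obtain ⟨r3, r4⟩ := s.lift_trTwo_Finv
  obtain ⟨w1, -⟩ := hF.weight (trTwo_apply _ _) r1 r2
  obtain ⟨w2, w3⟩ := hF'.weight (trTwo_apply _ _) r3 r4
  have d1 := s.isUnit_trTwo w1
  have d2 := s.isUnit_trTwo w2
  have e1 := s.tr_one_act u F
  have e2 := s.tr_one_act u F⁻¹
  set D := Dof ΨR with hD
  set f := trTwo D F
  set f' := trTwo D F⁻¹
  have m0 := s.m0
  have hDi : (Dof ΨRinv)⁻¹ = μ ^ 2 • D⁻¹ := by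
    refine Matrix.inv_eq_right_inv ?_
    rw [s.Dof_inv hR, smul_mul_smul_comm, Matrix.mul_nonsing_inv _ s.strict, ← mul_pow,
      inv_mul_cancel₀ m0, one_pow, one_smul]
  have x1 : Dof ΨF = D * f⁻¹ := by
    rw [← w1, mul_assoc, Matrix.mul_nonsing_inv _ d1, mul_one]
  have x2 : Dof ΨFinv = D * f'⁻¹ := by
    rw [← w2, mul_assoc, Matrix.mul_nonsing_inv _ d2, mul_one]
  have x3 : f'⁻¹ * D = D * f'⁻¹ := by
    rw [← x2, ← w3, ← mul_assoc, Matrix.nonsing_inv_mul _ d2, one_mul]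
  have hw : Dof ΨFinv * (Dof ΨRinv)⁻¹ * Dof ΨF = D * (μ ^ 2 • (f'⁻¹ * f⁻¹)) := by
    rw [hDi, x1, x2, ← x3, Matrix.mul_smul, Matrix.smul_mul, mul_assoc f'⁻¹,
      Matrix.mul_nonsing_inv _ s.strict, mul_one, ← mul_assoc, x3, mul_assoc, Matrix.mul_smul]
  have i1 : Inv2 ((s.tower u).tr 1 ((s.tower u).F 0)) (u.C.mat 0 f⁻¹) := by
    have := u.mat_inv 0 d1
    rwa [← e1] at this
  have i2 : Inv2 ((s.tower u).tr 1 ((s.tower u).Fi 0)) (u.C.mat 0 f'⁻¹) := by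
    have := u.mat_inv 0 d2
    rwa [← e2] at this
  refine ⟨_, Tower.phInv_of_weight i1 i2 (s.Cmat_mem u _) (s.Cmat_mem u _), fun X => ?_⟩
  have j1 : u.C.mat 0 f * u.C.act 0 2 F = u.C.act 0 2 F * u.C.mat 1 f := by
    have := congrArg (u.C.act 0 2) r2
    rwa [Units.act_mul, Units.act_mul, u.C.act_lift1 0 (by omega),
      u.C.act_lift1 0 (by omega)] at this
  have j2 : u.C.mat 1 f' * u.C.act 0 2 F⁻¹ = u.C.act 0 2 F⁻¹ * u.C.mat 0 f' := by
    have := congrArg (u.C.act 0 2) r3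
    rw [Units.act_mul, Units.act_mul, u.C.act_lift1 0 (by omega),
      u.C.act_lift1 0 (by omega)] at this
    exact this.symm
  have j3 : u.C.mat 1 (f'⁻¹ * f⁻¹) * u.C.act 0 2 F⁻¹ =
      u.C.act 0 2 F⁻¹ * (u.C.mat 0 f'⁻¹ * u.C.mat 0 f⁻¹) := by
    have a0 := u.mat_inv 0 d1
    have a1 := u.mat_inv 1 d1
    have b0 := u.mat_inv 0 d2
    have b1 := u.mat_inv 1 d2
    have FF := u.C.act_inv 0 s.Fdet
    have c1 : u.C.mat 1 f * u.C.act 0 2 F⁻¹ = u.C.act 0 2 F⁻¹ * u.C.mat 0 f :=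
      FF.lcan (FF.symm.rcan (tl fun x => by
        simp only [mul_assoc, ra2 FF.l, one_mul, ra2 FF.r, ra2 j1.symm]))
    have c2 := a1.inter a0 c1
    have c3 := b1.inter b0 j2
    rw [u.C.mat_mul, mul_assoc, c2, ← mul_assoc, c3, mul_assoc]
  rw [phiInv, hw, u.mat_smul, ← u.act_one_strand]
  have hc : (cmap (D * (μ ^ 2 • (f'⁻¹ * f⁻¹))) : Matrix (Fin N) (Fin N) A) =
      cmap D * cmap (μ ^ 2 • (f'⁻¹ * f⁻¹)) := Matrix.map_mul
  have e : u.act 0 2 (lift1 1 (cmap (μ ^ 2 • (f'⁻¹ * f⁻¹))) * (cmap (lift2 0 F⁻¹) * lift1 0 X *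
      cmap (lift2 0 R⁻¹) * cmap (lift2 0 F))) = μ ^ 2 • ((s.tower u).Fi 0 *
      (u.C.mat 0 f'⁻¹ * u.C.mat 0 f⁻¹ * u.mat 0 X) * (s.tower u).Ri 0 * (s.tower u).F 0) := by
    rw [u.act_mul, u.act_mul, u.act_mul, u.act_mul,
      u.act_cmap_lift2 le_rfl, u.act_cmap_lift2 le_rfl, u.act_cmap_lift2 le_rfl,
      u.act_lift1 0 (by omega), u.act_lift1 0 (by omega), u.mat_cmap, u.C.mat_smul, smul_mul_assoc]
    refine congrArg (μ ^ 2 • ·) (tl fun x => ?_)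
    simp only [zero_add, mul_assoc, ra2 j3]
    rfl
  have m : (s.tower u).Fi 0 * (u.C.mat 0 f'⁻¹ * u.C.mat 0 f⁻¹ * u.mat 0 X) * (s.tower u).Ri 0 *
      (s.tower u).F 0 ∈ (s.tower u).S 2 :=
    mul_mem (mul_mem (mul_mem ((s.tower u).Fi_mem 0) ((s.tower u).sm (mul_mem (mul_mem
      (s.Cmat_mem u _) (s.Cmat_mem u _)) (s.mat_mem u X)))) ((s.tower u).Ri_mem 0))
      ((s.tower u).F_mem 0)
  rw [hc, ptrace_mul_weight, ← s.tr_act, e, (s.tower u).tr_smul _ m, smul_smul, ← mul_pow,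
    inv_mul_cancel₀ m0, one_pow, one_smul]
  rfl

end Setup
end QMA
end

noncomputable section

namespace QMA

variable {N : ℕ} [NeZero N] {A : Type*} [Ring A] [Algebra ℂ A]

/-- **Parent Cayley–Hamilton identity for symplectic quantum matrix algebras**
(Proposition 4.7 of Ogievetsky–Pyatov).

For a compatible pair `{R,F}` with `F` strict skew invertible and `R` skew invertible of
`Sp(2k)` type, the matrix `M` of generators of `M(R,F)` and its image `π(M)`, where
`π(X)₁ = Tr_{R(2)}(R₁ X₁ K₁)`, satisfy the `k`-th order matrix identity
`∑_{i=0}^{k} (-q)^i M^{[k-i]} ε_i + q^{2k} ∑_{i=0}^{k-1} (-q)^{-i} π(M)^{[k-i]} ε_i = 0`. -/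
theorem symplectic_parent_cayley_hamilton
    {N : ℕ} [NeZero N] (k : ℕ) (hk : 2 ≤ k) (q μ : ℂ)
    (hq0 : q ≠ 0) (hq1 : q ≠ 1) (hqm1 : q ≠ -1)
    (hμ0 : μ ≠ 0) (hμq : μ ≠ q) (hμq' : μ ≠ -q⁻¹)
    (hiq : ∀ i : ℕ, 2 ≤ i → i ≤ k → nq q i ≠ 0)
    (hμi : ∀ i : ℕ, 1 ≤ i → i ≤ k → μ ≠ -q ^ (1 - 2 * (i : ℤ)))
    (R F ΨR ΨF ΨFinv ΨRinv : MatV N 2 ℂ)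
    (hRbraid : IsBraid R) (hRdet : IsUnit R.det)
    (hFbraid : IsBraid F) (hFdet : IsUnit F.det)
    (hcomp : Compatible R F)
    (hΨR : SkewPair R ΨR) (hΨF : SkewPair F ΨF)
    (hΨFinv : SkewPair F⁻¹ ΨFinv) (hΨRinv : SkewPair R⁻¹ ΨRinv)
    (hRstrict : IsUnit (Dof ΨR).det) (hFstrict : IsUnit (Dof ΨF).det)
    (hRinvstrict : IsUnit (Dof ΨRinv).det)
    (hGdet : IsUnit (Gmat q μ R F).det)
    (hbmw : IsBMW q μ R)
    (hheight : HasHeight q μ R k)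
    (hμval : μ = -q ^ (-1 - 2 * (k : ℤ)))
    (A : Type*) [Ring A] [Algebra ℂ A]
    (M : Matrix (Fin N) (Fin N) A)
    (hM : QMArel R F M) :
    ∑ i ∈ Finset.range (k + 1),
        (-q) ^ i • rmulE (starPow R F ΨR M (k - i)) (eps q μ R F ΨR M k i) +
      q ^ (2 * k) •
        ∑ i ∈ Finset.range k,
          (-q) ^ (-(i : ℤ)) •
            rmulE (piPow q μ R F ΨR ΨF ΨFinv ΨRinv M (k - i)) (eps q μ R F ΨR M k i) = 0 := by
  have qq : q * q⁻¹ = 1 := mul_inv_cancel₀ hq0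
  have l0 : q - q⁻¹ ≠ 0 := by
    intro h
    have h1 : (q - 1) * (q + 1) = 0 := by linear_combination q * h + qq
    rcases mul_eq_zero.1 h1 with h2 | h2
    · exact hq1 (sub_eq_zero.1 h2)
    · exact hqm1 (eq_neg_of_add_eq_zero_left h2)
  have s : Setup q μ R F ΨR :=
    ⟨hq0, l0, hμ0, hRbraid, hRdet, hFbraid, hFdet, hcomp, hΨR, hRstrict, hGdet, hbmw⟩
  have hd : Tower.dl q μ ≠ 0 := by
    refine div_ne_zero (mul_ne_zero (sub_ne_zero.2 hμq.symm) fun h => hμq' ?_) l0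
    exact eq_neg_of_add_eq_zero_right h
  have hg : Tower.Gen q μ k :=
    ⟨hiq, fun i h1 h2 h => hμi i h1 h2 (eq_neg_of_add_eq_zero_left h)⟩
  have hm : μ * q ^ (2 * k) = -q⁻¹ := by
    rw [hμval, neg_mul, ← _root_.zpow_natCast q (2 * k), ← zpow_add₀ hq0, ← _root_.zpow_neg_one]
    congr 2
    push_cast
    ring
  obtain ⟨pI, I, hp⟩ := s.exists_phInv (Units.fn N A) hΨF hΨFinv hΨRinv
  refine (Units.fn N A).mat_inj (Units.fn_inj N A) 0 ?_
  have h := Tower.CH I (s.QM_of (Units.fn N A) M hM) hd (by omega) hg hm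
    (s.cut (Units.fn N A) (by omega) hheight.2.2)
  rw [Units.mat_zero, ← h]
  simp only [Units.mat_add, Units.mat_sum, Units.mat_smul, Units.mat_rmulE, s.spT_eq, s.ppT_eq _ _ hp]
  congr 1
  · refine Finset.sum_congr rfl fun i hi => ?_
    rw [s.eT_eq _ _ (Nat.lt_succ_iff.1 (Finset.mem_range.1 hi))]
  · refine congrArg _ (Finset.sum_congr rfl fun i hi => ?_)
    rw [s.eT_eq _ _ (Finset.mem_range.1 hi).le]

end QMA

end
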